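/- Let μ, k, c be nonzero real numbers and b ∈ ℝ with c² < −4(k² + b k); set κ = √(−(k²+bk) − c²/4). Then there exist functions s^h, β^h, s^v, β^v : (0,∞) → ℝ, each smooth, with lim_{r→0⁺} s^h(r) = lim_{r→0⁺} s^v(r) = 0, with s^h and s^v not identically zero, and with s^h(r) = O(r^κ) and s^v(r) = O(r^κ) as r → 0⁺, such that the pair (u, φ) defined as follows is a weak solution of the Ishimori system on (0,∞) × ℝ² (time interval I = (0,∞)): for t > 0 and |x| ≠ |y| set r = √(|x² − y²|/t) and α = (1/2) log(|x+y|/|x−y|), let (s,β) = (s^h, β^h) if |x| > |y| and (s,β) = (s^v, β^v) if |x| < |y|, and define u(t,x,y) = ( cos s(r), sin s(r) cos(β(r) + kα + μ log t), sin s(r) sin(β(r) + kα + μ log t) ) and φ(t,x,y) = cα + b log r − ∫₀^r (2k/r′)(1 − cos s(r′)) dr′; and set u(t,x,y) = (1,0,0) when |x| = |y|. Moreover: u is continuous on (0,∞) × ℝ²; u and φ are smooth on {t > 0, |x| ≠ |y|} and satisfy the Ishimori system pointwise there; and for each profile s ∈ {s^h, s^v}, the limit s⋆ := lim_{r→∞}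 s(r) exists and is strictly positive, with s(r) = s⋆ + O(r^{−2}) and s′(r) = O(1/r) as r → ∞. -/

import Mathlib

open Set Filter MeasureTheory Asymptotics

/-- Euclidean dot product on `ℝ³`. -/
noncomputable def dot3 (v w : Fin 3 → ℝ) : ℝ := v 0 * w 0 + v 1 * w 1 + v 2 * w 2

/-- Cross product on `ℝ³`. -/
noncomputable def cross3 (v w : Fin 3 → ℝ) : Fin 3 → ℝ :=
  ![v 1 * w 2 - v 2 * w 1, v 2 * w 0 - v 0 * w 2, v 0 * w 1 - v 1 * w 0]

/-- Directional (partial) derivative of a vector-valued map on `ℝ×ℝ²`. -/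
noncomputable def pdV (v : ℝ × ℝ × ℝ) (f : ℝ × ℝ × ℝ → Fin 3 → ℝ)
    (p : ℝ × ℝ × ℝ) : Fin 3 → ℝ := fderiv ℝ f p v

/-- Directional (partial) derivative of a scalar map on `ℝ×ℝ²`. -/
noncomputable def pdR (v : ℝ × ℝ × ℝ) (f : ℝ × ℝ × ℝ → ℝ) (p : ℝ × ℝ × ℝ) : ℝ :=
  fderiv ℝ f p v

/-- The coordinate directions `∂ₜ, ∂ₓ, ∂_y` on `ℝ×ℝ²`. -/
def et : ℝ × ℝ × ℝ := (1, 0, 0)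
def ex : ℝ × ℝ × ℝ := (0, 1, 0)
def ey : ℝ × ℝ × ℝ := (0, 0, 1)

/-- `(u,φ)` is a weak solution of the hyperbolic-hyperbolic Ishimori system on
`I × ℝ²`. -/
def IsWeakIshimori (I : Set ℝ) (u : ℝ × ℝ × ℝ → Fin 3 → ℝ) (φ : ℝ × ℝ × ℝ → ℝ) : Prop :=
  LocallyIntegrableOn u {p : ℝ × ℝ × ℝ | p.1 ∈ I} volume ∧
  LocallyIntegrableOn (pdV ex u) {p : ℝ × ℝ × ℝ | p.1 ∈ I} volume ∧
  LocallyIntegrableOn (pdV ey u) {p : ℝ × ℝ × ℝ | p.1 ∈ I} volume ∧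
  LocallyIntegrableOn φ {p : ℝ × ℝ × ℝ | p.1 ∈ I} volume ∧
  LocallyIntegrableOn (fun p => φ p • pdV ex u p) {p : ℝ × ℝ × ℝ | p.1 ∈ I} volume ∧
  LocallyIntegrableOn (fun p => φ p • pdV ey u p) {p : ℝ × ℝ × ℝ | p.1 ∈ I} volume ∧
  LocallyIntegrableOn (fun p => dot3 (u p) (cross3 (pdV ex u p) (pdV ey u p)))
    {p : ℝ × ℝ × ℝ | p.1 ∈ I} volume ∧
  (∀ ψ : ℝ × ℝ × ℝ → Fin 3 → ℝ, ContDiff ℝ (⊤ : ℕ∞) ψ → HasCompactSupport ψ →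
    (∀ p : ℝ × ℝ × ℝ, p.1 ∉ I → ψ p = 0) →
    ∫ p : ℝ × ℝ × ℝ,
      (dot3 (cross3 (u p) (pdV ey u p)) (pdV ey ψ p)
        - dot3 (cross3 (u p) (pdV ex u p)) (pdV ex ψ p)
        + dot3 (u p) (pdV et ψ p)
        - φ p * (dot3 (pdV ey u p) (pdV ex ψ p) - dot3 (pdV ex u p) (pdV ey ψ p))) = 0) ∧
  (∀ ρ : ℝ × ℝ × ℝ → ℝ, ContDiff ℝ (⊤ : ℕ∞) ρ → HasCompactSupport ρ →
    (∀ p : ℝ × ℝ × ℝ, p.1 ∉ I → ρ p = 0) →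
    ∫ p : ℝ × ℝ × ℝ,
      ((pdR ex (pdR ex ρ) p - pdR ey (pdR ey ρ) p) * φ p
        + 2 * ρ p * dot3 (u p) (cross3 (pdV ex u p) (pdV ey u p))) = 0)

/-- The similarity radial variable `r = √(|x² − y²|/t)`. -/
noncomputable def rOf (t x y : ℝ) : ℝ := Real.sqrt (|x ^ 2 - y ^ 2| / t)

/-- The hyperbolic angular coordinate `α = (1/2) log(|x+y|/|x−y|)`. -/
noncomputable def alphaOf (x y : ℝ) : ℝ := 1 / 2 * Real.log (|x + y| / |x - y|)

/-- The self-similar equivariant spin with radial profiles `(s,β)` in the horizontal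
(`|x| > |y|`) and vertical (`|x| < |y|`) cones; the rotation center `(1,0,0)` on the
cross `|x| = |y|`. -/
noncomputable def uSim (μ k : ℝ) (sh βh sv βv : ℝ → ℝ) (p : ℝ × ℝ × ℝ) : Fin 3 → ℝ :=
  if |p.2.1| > |p.2.2| then
    ![Real.cos (sh (rOf p.1 p.2.1 p.2.2)),
      Real.sin (sh (rOf p.1 p.2.1 p.2.2)) *
        Real.cos (βh (rOf p.1 p.2.1 p.2.2) + k * alphaOf p.2.1 p.2.2 + μ * Real.log p.1),
      Real.sin (sh (rOf p.1 p.2.1 p.2.2)) *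
        Real.sin (βh (rOf p.1 p.2.1 p.2.2) + k * alphaOf p.2.1 p.2.2 + μ * Real.log p.1)]
  else if |p.2.1| < |p.2.2| then
    ![Real.cos (sv (rOf p.1 p.2.1 p.2.2)),
      Real.sin (sv (rOf p.1 p.2.1 p.2.2)) *
        Real.cos (βv (rOf p.1 p.2.1 p.2.2) + k * alphaOf p.2.1 p.2.2 + μ * Real.log p.1),
      Real.sin (sv (rOf p.1 p.2.1 p.2.2)) *
        Real.sin (βv (rOf p.1 p.2.1 p.2.2) + k * alphaOf p.2.1 p.2.2 + μ * Real.log p.1)]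
  else ![1, 0, 0]

/-- The self-similar equivariant field
`φ = cα + b log r − ∫₀^r (2k/r′)(1 − cos s(r′)) dr′`. -/
noncomputable def φSim (k c b : ℝ) (sh sv : ℝ → ℝ) (p : ℝ × ℝ × ℝ) : ℝ :=
  if |p.2.1| > |p.2.2| then
    c * alphaOf p.2.1 p.2.2 + b * Real.log (rOf p.1 p.2.1 p.2.2)
      - ∫ r' in (0:ℝ)..rOf p.1 p.2.1 p.2.2, 2 * k / r' * (1 - Real.cos (sh r'))
  else if |p.2.1| < |p.2.2| then
    c * alphaOf p.2.1 p.2.2 + b * Real.log (rOf p.1 p.2.1 p.2.2)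
      - ∫ r' in (0:ℝ)..rOf p.1 p.2.1 p.2.2, 2 * k / r' * (1 - Real.cos (sv r'))
  else 0

theorem ish_global_ode {Y : Type*} [NormedAddCommGroup Y] [NormedSpace ℝ Y] [CompleteSpace Y]
    (w : ℝ → Y → Y) (K L : NNReal) (hK : ∀ t, LipschitzWith K (w t))
    (hc : ∀ x, Continuous (fun t => w t x)) (hL : ∀ t x, ‖w t x‖ ≤ L) (t0 : ℝ) (x0 : Y) :
    ∃ y : ℝ → Y, y t0 = x0 ∧ ∀ t, HasDerivAt y (w t (y t)) t := by
  have key : ∀ n : ℕ, ∃ y : ℝ → Y, y t0 = x0 ∧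
      ∀ t ∈ Ioo (t0 - (n + 1)) (t0 + (n + 1)), HasDerivAt y (w t (y t)) t := by
    intro n
    have hmem : t0 ∈ Icc (t0 - ((n:ℝ) + 1)) (t0 + (n + 1)) := by
      constructor <;> linarith [(Nat.cast_nonneg n : (0:ℝ) ≤ n)]
    have hpl : IsPicardLindelof w (tmin := t0 - ((n:ℝ) + 1)) (tmax := t0 + (n + 1)) ⟨t0, hmem⟩ x0
        (L * (n + 1)) 0 L K := by
      refine ⟨fun t _ => (hK t).lipschitzOnWith, fun x _ => (hc x).continuousOn,
        fun t _ x _ => hL t x, ?_⟩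
      simp
    obtain ⟨α, h1, h2⟩ := hpl.exists_eq_forall_mem_Icc_hasDerivWithinAt₀
    exact ⟨α, h1, fun t ht => (h2 t (Ioo_subset_Icc_self ht)).hasDerivAt (Icc_mem_nhds ht.1 ht.2)⟩
  choose y hy0 hy using key
  have huniq : ∀ n m : ℕ, n ≤ m → EqOn (y n) (y m) (Ioo (t0 - (n + 1)) (t0 + (n + 1))) := by
    intro n m hnm
    have hnm' : (n:ℝ) ≤ m := by exact_mod_cast hnm
    refine ODE_solution_unique_of_mem_Ioo (v := w) (s := fun _ => univ) (K := K) (t₀ := t0)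
      (fun t _ => (hK t).lipschitzOnWith) ?_ (fun t ht => ⟨hy n t ht, trivial⟩)
      (fun t ht => ⟨hy m t ⟨by linarith [ht.1], by linarith [ht.2]⟩, trivial⟩) ?_
    · constructor <;> linarith [(Nat.cast_nonneg n : (0:ℝ) ≤ n)]
    · rw [hy0, hy0]
  let N : ℝ → ℕ := fun t => ⌈|t - t0|⌉₊
  have hN : ∀ t, t ∈ Ioo (t0 - ((N t : ℝ) + 1)) (t0 + (N t + 1)) := by
    intro t
    have h1 : |t - t0| ≤ N t := Nat.le_ceil _
    have h2 := abs_le.1 h1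
    constructor <;> linarith [h2.1, h2.2]
  have hglob : ∀ n : ℕ, ∀ t ∈ Ioo (t0 - ((n:ℝ) + 1)) (t0 + (n + 1)), y (N t) t = y n t := by
    intro n t ht
    rcases le_total n (N t) with h | h
    · exact (huniq _ _ h ht).symm
    · exact huniq _ _ h (hN t)
  refine ⟨fun t => y (N t) t, ?_, ?_⟩
  · exact hy0 _
  · intro t
    have h1 := hy (N t) t (hN t)
    refine h1.congr_of_eventuallyEq ?_
    filter_upwards [Ioo_mem_nhds (hN t).1 (hN t).2] with τ hτ
    exact hglob _ τ hτ

theorem ish_cont_method (W : ℝ → Prop) (a : ℝ)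
    (h : ∀ b ≥ a, (∀ R ∈ Ico a b, W R) → ∀ᶠ R in nhds b, W R) : ∀ R ≥ a, W R := by
  by_contra hcon
  push Not at hcon
  obtain ⟨R1, hR1, hW1⟩ := hcon
  let S : Set ℝ := {R | a ≤ R ∧ ¬ W R}
  have hS : S.Nonempty := ⟨R1, hR1, hW1⟩
  have hbd : BddBelow S := ⟨a, fun R hR => hR.1⟩
  have hb : a ≤ sInf S := le_csInf hS (fun R hR => hR.1)
  have hev := h (sInf S) hb (by
    intro R hR
    by_contra hc
    exact absurd (csInf_le hbd (show R ∈ S from ⟨hR.1, hc⟩)) (not_le.2 hR.2))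
  have hmem : sInf S ∈ closure S := csInf_mem_closure hS hbd
  rw [mem_closure_iff_frequently] at hmem
  obtain ⟨R, hR, hR'⟩ := (hmem.and_eventually hev).exists
  exact hR.2 hR'

/-- the numerator of the radial vector field for `d`. -/
noncomputable def ishP (m k c K R E q : ℝ) : ℝ :=
  -(q - c) * (R / 2 - q) - 1 / 2 * E * (4 * m * q + 2 * K + 3 * k ^ 2 * E)
    + 1 / 2 * (2 - E) * (4 * m * (R / 2 - q) + 3 * k ^ 2 * E)

noncomputable def ishQ (m k c K E q : ℝ) : ℝ :=
  (2 - E) * (4 * m * q + 2 * K + 3 * k ^ 2 * E) - (q - c) ^ 2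

theorem ish_exp_lip {x y M : ℝ} (hx : x ≤ M) (hy : y ≤ M) :
    |Real.exp x - Real.exp y| ≤ Real.exp M * |x - y| := by
  wlog h : y ≤ x generalizing x y
  · rw [abs_sub_comm, abs_sub_comm x]
    exact this hy hx (le_of_not_ge h)
  have h1 : Real.exp y = Real.exp x * Real.exp (y - x) := by rw [← Real.exp_add]; ring_nf
  have h2 := Real.add_one_le_exp (y - x)
  have h3 := Real.exp_le_exp.2 h
  have h4 := Real.exp_le_exp.2 hx
  rw [abs_of_nonneg (by linarith), abs_of_nonneg (by linarith)]
  have h5 : Real.exp x - Real.exp y ≤ Real.exp x * (x - y) := by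
    rw [h1]; nlinarith [Real.exp_pos x]
  nlinarith

noncomputable def ishE (κ a : ℝ) (H : ℝ → ℝ) (R : ℝ) : ℝ := a * R ^ κ * Real.exp (H R)
noncomputable def ishJ (κ : ℝ) (H : ℝ → ℝ) (R : ℝ) : ℝ :=
  (∫ ρ in (0:ℝ)..R, ρ ^ κ * Real.exp (H ρ)) / (2 * (R ^ κ * Real.exp (H R)))

theorem ish_exp1 : Real.exp 1 ≤ 3 := by linarith [Real.exp_one_lt_d9]
theorem ish_exp2 : Real.exp 2 ≤ 8 := by
  have : Real.exp 2 = Real.exp 1 * Real.exp 1 := by rw [← Real.exp_add]; norm_num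
  rw [this]; nlinarith [Real.exp_one_lt_d9, Real.exp_pos 1]

theorem ishE_pos {κ a : ℝ} (ha : 0 < a) (H : ℝ → ℝ) {R : ℝ} (hR : 0 < R) : 0 < ishE κ a H R := by
  unfold ishE; positivity

theorem ishE_le {κ a : ℝ} (ha : 0 < a) (H : ℝ → ℝ) (hH : ∀ x, |H x| ≤ 1) {R : ℝ} (hR : 0 < R) :
    ishE κ a H R ≤ 3 * a * R ^ κ := by
  unfold ishE
  have h1 : Real.exp (H R) ≤ 3 :=
    (Real.exp_le_exp.2 (abs_le.1 (hH R)).2).trans ish_exp1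
  have h2 : 0 < a * R ^ κ := by positivity
  nlinarith

theorem ishE_lip {κ a : ℝ} (ha : 0 < a) (H H' : ℝ → ℝ) (hH : ∀ x, |H x| ≤ 1)
    (hH' : ∀ x, |H' x| ≤ 1) {R δ : ℝ} (hR : 0 < R) (hδ : ∀ x, |H x - H' x| ≤ δ) :
    |ishE κ a H R - ishE κ a H' R| ≤ 3 * a * R ^ κ * δ := by
  unfold ishE
  have h0 := ish_exp_lip (abs_le.1 (hH R)).2 (abs_le.1 (hH' R)).2
  have h2 : 0 < a * R ^ κ := by positivity
  rw [← mul_sub, abs_mul, abs_of_pos h2]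
  have h3 : |Real.exp (H R) - Real.exp (H' R)| ≤ 3 * δ :=
    h0.trans (mul_le_mul ish_exp1 (hδ R) (abs_nonneg _) (by norm_num))
  nlinarith

theorem ishJ_int {κ : ℝ} (hκ : 0 < κ) (H : ℝ → ℝ) (hc : Continuous H) :
    Continuous (fun ρ : ℝ => ρ ^ κ * Real.exp (H ρ)) := by
  have : Continuous (fun ρ : ℝ => ρ ^ κ) := Real.continuous_rpow_const hκ.le
  fun_prop

theorem ishJ_eq {κ : ℝ} (H : ℝ → ℝ) {R : ℝ} (hR : 0 < R) :
    ishJ κ H R = 1 / 2 * ∫ ρ in (0:ℝ)..R, ρ ^ κ / R ^ κ * Real.exp (H ρ - H R) := by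
  unfold ishJ
  have hp : 0 < R ^ κ := by positivity
  have : ∀ ρ, ρ ^ κ / R ^ κ * Real.exp (H ρ - H R)
      = (ρ ^ κ * Real.exp (H ρ)) * (R ^ κ * Real.exp (H R))⁻¹ := by
    intro ρ; rw [Real.exp_sub]; field_simp
  simp_rw [this]
  rw [intervalIntegral.integral_mul_const]
  have := Real.exp_pos (H R)
  field_simp

theorem ishJ_pos {κ : ℝ} (hκ : 0 < κ) (H : ℝ → ℝ) (hc : Continuous H) {R : ℝ} (hR : 0 < R) :
    0 < ishJ κ H R := by
  unfold ishJ
  have h1 : 0 < ∫ ρ in (0:ℝ)..R, ρ ^ κ * Real.exp (H ρ) := by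
    apply intervalIntegral.intervalIntegral_pos_of_pos_on
    · exact (ishJ_int hκ H hc).intervalIntegrable _ _
    · intro x hx
      have := hx.1
      positivity
    · exact hR
  positivity

theorem ishJ_lip {κ : ℝ} (hκ : 0 < κ) (H H' : ℝ → ℝ) (hc : Continuous H) (hc' : Continuous H')
    (hH : ∀ x, |H x| ≤ 1)
    (hH' : ∀ x, |H' x| ≤ 1) {R δ : ℝ} (hR : 0 < R) (hδ : ∀ x, |H x - H' x| ≤ δ) :
    |ishJ κ H R - ishJ κ H' R| ≤ 8 * R * δ := by
  rw [ishJ_eq H hR, ishJ_eq H' hR, ← mul_sub]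
  have hcp : Continuous (fun ρ : ℝ => ρ ^ κ / R ^ κ) :=
    (Real.continuous_rpow_const hκ.le).div_const _
  rw [← intervalIntegral.integral_sub (Continuous.intervalIntegrable (by fun_prop) _ _)
    (Continuous.intervalIntegrable (by fun_prop) _ _)]
  have hδ0 : 0 ≤ δ := (abs_nonneg _).trans (hδ 0)
  have h1 : ‖∫ ρ in (0:ℝ)..R, (ρ ^ κ / R ^ κ * Real.exp (H ρ - H R)
      - ρ ^ κ / R ^ κ * Real.exp (H' ρ - H' R))‖ ≤ (16 * δ) * |R - 0| := by
    apply intervalIntegral.norm_integral_le_of_norm_le_const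
    intro ρ hρ
    rw [uIoc_of_le hR.le] at hρ
    have hp : 0 < ρ ^ κ := Real.rpow_pos_of_pos hρ.1 _
    have hp2 : 0 < R ^ κ := by positivity
    have hle : ρ ^ κ / R ^ κ ≤ 1 := by
      rw [div_le_one hp2]; exact Real.rpow_le_rpow hρ.1.le hρ.2 hκ.le
    have h0 : 0 < ρ ^ κ / R ^ κ := by positivity
    rw [← mul_sub, norm_mul, Real.norm_eq_abs, Real.norm_eq_abs, abs_of_pos h0]
    have a1 := abs_le.1 (hH ρ)
    have a2 := abs_le.1 (hH R)
    have a3 := abs_le.1 (hH' ρ)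
    have a4 := abs_le.1 (hH' R)
    have a5 := abs_le.1 (hδ ρ)
    have a6 := abs_le.1 (hδ R)
    have h2 := ish_exp_lip (x := H ρ - H R) (y := H' ρ - H' R) (M := 2) (by linarith) (by linarith)
    have h3 : |(H ρ - H R) - (H' ρ - H' R)| ≤ 2 * δ := by
      rw [abs_le]; constructor <;> linarith
    have h4 : |Real.exp (H ρ - H R) - Real.exp (H' ρ - H' R)| ≤ 8 * (2 * δ) :=
      h2.trans (mul_le_mul ish_exp2 h3 (abs_nonneg _) (by norm_num))
    nlinarith [abs_nonneg (Real.exp (H ρ - H R) - Real.exp (H' ρ - H' R))]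
  rw [sub_zero, abs_of_pos hR, Real.norm_eq_abs] at h1
  rw [abs_mul, abs_of_pos (by norm_num : (0:ℝ) < 1 / 2)]
  linarith

theorem ishJ_le {κ : ℝ} (hκ : 0 < κ) (H : ℝ → ℝ) (hc : Continuous H)
    (hH : ∀ x, |H x| ≤ 1) {R : ℝ} (hR : 0 < R) :
    ishJ κ H R ≤ 4 * R := by
  rw [ishJ_eq H hR]
  have h1 : ‖∫ ρ in (0:ℝ)..R, (ρ ^ κ / R ^ κ * Real.exp (H ρ - H R))‖ ≤ 8 * |R - 0| := by
    apply intervalIntegral.norm_integral_le_of_norm_le_const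
    intro ρ hρ
    rw [uIoc_of_le hR.le] at hρ
    have hp : 0 < ρ ^ κ := Real.rpow_pos_of_pos hρ.1 _
    have hp2 : 0 < R ^ κ := by positivity
    have hle : ρ ^ κ / R ^ κ ≤ 1 := by
      rw [div_le_one hp2]; exact Real.rpow_le_rpow hρ.1.le hρ.2 hκ.le
    have h0 : 0 < ρ ^ κ / R ^ κ := by positivity
    have a1 := abs_le.1 (hH ρ)
    have a2 := abs_le.1 (hH R)
    rw [norm_mul, Real.norm_eq_abs, Real.norm_eq_abs, abs_of_pos h0, abs_of_pos (Real.exp_pos _)]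
    have h2 : Real.exp (H ρ - H R) ≤ 8 := (Real.exp_le_exp.2 (by linarith)).trans ish_exp2
    nlinarith [Real.exp_pos (H ρ - H R)]
  rw [sub_zero, abs_of_pos hR, Real.norm_eq_abs] at h1
  linarith [le_abs_self (∫ ρ in (0:ℝ)..R, (ρ ^ κ / R ^ κ * Real.exp (H ρ - H R)))]

theorem ishE_cont {κ a : ℝ} (hκ : 0 < κ) (H : ℝ → ℝ) (hc : Continuous H) :
    Continuous (ishE κ a H) := by
  have : Continuous (fun ρ : ℝ => ρ ^ κ) := Real.continuous_rpow_const hκ.le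
  unfold ishE
  fun_prop

theorem ishJ_cont {κ : ℝ} (hκ : 0 < κ) (H : ℝ → ℝ) (hc : Continuous H) :
    ContinuousOn (ishJ κ H) (Ioi 0) := by
  have h1 : Continuous (fun ρ : ℝ => ρ ^ κ) := Real.continuous_rpow_const hκ.le
  have h2 : Continuous (fun R => ∫ ρ in (0:ℝ)..R, ρ ^ κ * Real.exp (H ρ)) :=
    intervalIntegral.continuous_primitive
      (fun a b => (ishJ_int hκ H hc).intervalIntegrable a b) 0
  unfold ishJ
  apply ContinuousOn.div h2.continuousOn (by fun_prop)
  intro x hx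
  have : 0 < x := hx
  positivity

/-- abstract local data for the square root. -/
theorem ish_phi_lip (m k c K κ : ℝ) (hκ : 0 < κ) (hK : 4 * K = 4 * κ ^ 2 + c ^ 2) :
    ∃ L > (0:ℝ), ∃ ε > (0:ℝ), ∀ E q E' q' : ℝ, |E| < ε → |q| < ε → |E'| < ε → |q'| < ε →
      0 < ishQ m k c K E q ∧
      |Real.sqrt (ishQ m k c K E q) - Real.sqrt (ishQ m k c K E' q')| ≤
        L * (|E - E'| + |q - q'|) := by
  have h0 : ishQ m k c K 0 0 = (2 * κ) ^ 2 := by unfold ishQ; linarith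
  have hcd : ContDiffAt ℝ 1 (fun z : ℝ × ℝ => Real.sqrt (ishQ m k c K z.1 z.2)) (0, 0) := by
    apply ContDiffAt.sqrt
    · unfold ishQ; fun_prop
    · simp only [h0]; positivity
  obtain ⟨L, s, hs, hL⟩ := hcd.exists_lipschitzOnWith
  have hpos : ∀ᶠ z : ℝ × ℝ in nhds (0, 0), 0 < ishQ m k c K z.1 z.2 := by
    have hcont : ContinuousAt (fun z : ℝ × ℝ => ishQ m k c K z.1 z.2) (0, 0) := by
      unfold ishQ; fun_prop
    apply hcont.eventually (lt_mem_nhds ?_)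
    simp only [h0]; positivity
  obtain ⟨ε, hε, hb⟩ := Metric.mem_nhds_iff.1 (Filter.inter_mem hs hpos)
  refine ⟨L + 1, by positivity, ε, hε, ?_⟩
  intro E q E' q' hE hq hE' hq'
  have hm : ∀ x y : ℝ, |x| < ε → |y| < ε → (x, y) ∈ Metric.ball ((0:ℝ), (0:ℝ)) ε := by
    intro x y hx hy
    rw [Metric.mem_ball, Prod.dist_eq, max_lt_iff]
    simp [hx, hy]
  have h1 := hb (hm E q hE hq)
  have h2 := hb (hm E' q' hE' hq')
  refine ⟨h1.2, ?_⟩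
  have h3 := hL.dist_le_mul _ h1.1 _ h2.1
  rw [Real.dist_eq, Prod.dist_eq, Real.dist_eq, Real.dist_eq] at h3
  simp only at h3
  have h4 : max |E - E'| |q - q'| ≤ |E - E'| + |q - q'| :=
    max_le (by linarith [abs_nonneg (q - q')]) (by linarith [abs_nonneg (E - E')])
  have h5 : (L:ℝ) * max |E - E'| |q - q'| ≤ L * (|E - E'| + |q - q'|) :=
    mul_le_mul_of_nonneg_left h4 L.2
  nlinarith [abs_nonneg (q - q'), abs_nonneg (E - E')]

noncomputable def ishD (m k c K κ a : ℝ) (H : ℝ → ℝ) (R : ℝ) : ℝ :=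
  Real.sqrt (ishQ m k c K (ishE κ a H R) (R / 2 - ishJ κ H R))

noncomputable def ishf (m k c K κ a R0 : ℝ) (H : ℝ → ℝ) : ℝ → ℝ :=
  indicator (Ioc 0 R0) (fun ρ => (ishD m k c K κ a H ρ / 2 - κ) / ρ)

theorem ish_fixed (m k c K κ : ℝ) (hκ : 0 < κ) (hK : 4 * K = 4 * κ ^ 2 + c ^ 2) :
    ∃ R0 > (0:ℝ), ∀ a : ℝ, 0 < a → a ≤ 1 → ∃ H : ℝ → ℝ, Continuous H ∧ (∀ x, |H x| ≤ 1) ∧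
      (∀ R ∈ Ioo 0 R0, 0 < ishQ m k c K (ishE κ a H R) (R / 2 - ishJ κ H R) ∧
        HasDerivAt H ((ishD m k c K κ a H R / 2 - κ) / R) R) := by
  obtain ⟨L, hL, ε, hε, hphi⟩ := ish_phi_lip m k c K κ hκ hK
  -- choice of R0
  have hrp : Tendsto (fun R : ℝ => R ^ κ) (nhds 0) (nhds 0) := by
    have := (Real.continuous_rpow_const hκ.le).tendsto (0:ℝ)
    rwa [Real.zero_rpow hκ.ne'] at this
  have hid : Tendsto (fun R : ℝ => R) (nhds 0) (nhds 0) := tendsto_id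
  have e1 : ∀ᶠ R in nhds (0:ℝ), 3 * R ^ κ < ε := by
    have := hrp.const_mul 3
    rw [mul_zero] at this
    exact this.eventually (gt_mem_nhds hε)
  have e2 : ∀ᶠ R in nhds (0:ℝ), 5 * R < ε := by
    have := hid.const_mul 5
    rw [mul_zero] at this
    exact this.eventually (gt_mem_nhds hε)
  have e3 : ∀ᶠ R in nhds (0:ℝ), L / 2 * (3 * (R ^ κ / κ) + 8 * R) < 1 / 2 := by
    have := (((hrp.div_const κ).const_mul 3).add (hid.const_mul 8)).const_mul (L / 2)
    simp only [zero_div, mul_zero, add_zero] at this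
    exact this.eventually (gt_mem_nhds (by norm_num))
  obtain ⟨R0, hR0, hsm1, hsm2, hsm3⟩ : ∃ R0 > (0:ℝ), 3 * R0 ^ κ < ε ∧ 5 * R0 < ε ∧
      L / 2 * (3 * (R0 ^ κ / κ) + 8 * R0) < 1 / 2 := by
    have := ((e1.and (e2.and e3)).filter_mono (nhdsWithin_le_nhds (s := Ioi (0:ℝ))))
    obtain ⟨R, h1, h2⟩ := (this.and self_mem_nhdsWithin).exists
    exact ⟨R, h2, h1⟩
  refine ⟨R0, hR0, ?_⟩
  intro a ha ha1
  -- smallness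
  have hEs : ∀ H : ℝ → ℝ, (∀ x, |H x| ≤ 1) → ∀ R ∈ Ioc 0 R0, |ishE κ a H R| < ε := by
    intro H hH R hR
    rw [abs_of_pos (ishE_pos ha H hR.1)]
    have h1 := ishE_le (κ := κ) ha H hH hR.1
    have h2 : R ^ κ ≤ R0 ^ κ := Real.rpow_le_rpow hR.1.le hR.2 hκ.le
    have h3 : 0 < R ^ κ := Real.rpow_pos_of_pos hR.1 _
    nlinarith
  have hqb : ∀ H : ℝ → ℝ, Continuous H → (∀ x, |H x| ≤ 1) → ∀ R, 0 < R →
      |R / 2 - ishJ κ H R| ≤ 5 * R := by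
    intro H hc hH R hR
    have h1 := ishJ_le hκ H hc hH hR
    have h2 := ishJ_pos hκ H hc hR
    rw [abs_le]; constructor <;> linarith
  have hqs : ∀ H : ℝ → ℝ, Continuous H → (∀ x, |H x| ≤ 1) → ∀ R ∈ Ioc 0 R0,
      |R / 2 - ishJ κ H R| < ε := by
    intro H hc hH R hR
    linarith [hqb H hc hH R hR.1, hR.2]
  let g : ℝ → ℝ := indicator (Ioc 0 R0) (fun ρ => L / 2 * (3 * ρ ^ (κ - 1) + 8))
  have hgint : IntegrableOn (fun ρ : ℝ => L / 2 * (3 * ρ ^ (κ - 1) + 8)) (Ioc 0 R0) := by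
    rw [← intervalIntegrable_iff_integrableOn_Ioc_of_le hR0.le]
    apply IntervalIntegrable.const_mul
    apply IntervalIntegrable.add _ intervalIntegrable_const
    exact (intervalIntegral.intervalIntegrable_rpow' (by linarith)).const_mul _
  have hgI : Integrable g := by
    exact hgint.integrable_indicator measurableSet_Ioc
  have hgval : ∫ ρ, g ρ ≤ 1 / 2 := by
    have : ∫ ρ, g ρ = L / 2 * (3 * (R0 ^ κ / κ) + 8 * R0) := by
      rw [integral_indicator measurableSet_Ioc, ← intervalIntegral.integral_of_le hR0.le,
        intervalIntegral.integral_const_mul, intervalIntegral.integral_add,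
        intervalIntegral.integral_const_mul, integral_rpow (Or.inl (by linarith))]
      · simp only [sub_add_cancel, Real.zero_rpow hκ.ne', sub_zero,
          intervalIntegral.integral_const, smul_eq_mul]; ring
      · exact (intervalIntegral.intervalIntegrable_rpow' (by linarith)).const_mul _
      · exact intervalIntegrable_const
    rw [this]; exact hsm3.le
  have hfb : ∀ H : ℝ → ℝ, Continuous H → (∀ x, |H x| ≤ 1) → ∀ ρ,
      ‖ishf m k c K κ a R0 H ρ‖ ≤ g ρ := by
    intro H hc hH ρ
    simp only [ishf, g, indicator]
    split_ifs with hρ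
    · have hρ0 := hρ.1
      have h1 := (hphi _ _ 0 0 (hEs H hH ρ hρ) (hqs H hc hH ρ hρ) (by simpa using hε)
        (by simpa using hε)).2
      have h0 : Real.sqrt (ishQ m k c K 0 0) = 2 * κ := by
        rw [show ishQ m k c K 0 0 = (2 * κ) ^ 2 by unfold ishQ; linarith]
        exact Real.sqrt_sq (by linarith)
      rw [h0, sub_zero, sub_zero] at h1
      rw [norm_div, Real.norm_eq_abs, Real.norm_eq_abs, abs_of_pos hρ0, div_le_iff₀ hρ0]
      have h2 : |ishE κ a H ρ| ≤ 3 * ρ ^ κ := by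
        rw [abs_of_pos (ishE_pos ha H hρ0)]
        have h3 : 0 < ρ ^ κ := Real.rpow_pos_of_pos hρ0 _
        nlinarith [ishE_le (κ := κ) ha H hH hρ0]
      have h3 := hqb H hc hH ρ hρ0
      have h4 : ρ ^ (κ - 1) * ρ = ρ ^ κ := by
        rw [Real.rpow_sub_one hρ0.ne']; field_simp
      have h5 : |ishD m k c K κ a H ρ / 2 - κ| = 1 / 2 * |ishD m k c K κ a H ρ - 2 * κ| := by
        rw [show ishD m k c K κ a H ρ / 2 - κ = 1 / 2 * (ishD m k c K κ a H ρ - 2 * κ) by ring,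
          abs_mul, abs_of_pos (by norm_num : (0:ℝ) < 1 / 2)]
      rw [h5]
      have h6 : |ishD m k c K κ a H ρ - 2 * κ| ≤ L * (3 * ρ ^ κ + 5 * ρ) :=
        h1.trans (mul_le_mul_of_nonneg_left (by linarith) hL.le)
      have h7 : L / 2 * (3 * ρ ^ (κ - 1) + 8) * ρ = L / 2 * (3 * ρ ^ κ + 8 * ρ) := by
        rw [← h4]; ring
      rw [h7]
      nlinarith [mul_pos hL hρ0]
    · simp
  have hfd : ∀ H H' : ℝ → ℝ, Continuous H → Continuous H' → (∀ x, |H x| ≤ 1) →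
      (∀ x, |H' x| ≤ 1) → ∀ δ, (∀ x, |H x - H' x| ≤ δ) → ∀ ρ,
      ‖ishf m k c K κ a R0 H ρ - ishf m k c K κ a R0 H' ρ‖ ≤ δ * g ρ := by
    intro H H' hc hc' hH hH' δ hδ ρ
    simp only [ishf, g, indicator]
    have hδ0 : 0 ≤ δ := (abs_nonneg _).trans (hδ 0)
    split_ifs with hρ
    · have hρ0 := hρ.1
      have h1 := (hphi _ _ _ _ (hEs H hH ρ hρ) (hqs H hc hH ρ hρ) (hEs H' hH' ρ hρ)
        (hqs H' hc' hH' ρ hρ)).2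
      rw [← sub_div, norm_div, Real.norm_eq_abs, Real.norm_eq_abs, abs_of_pos hρ0,
        div_le_iff₀ hρ0]
      have h2 : |ishE κ a H ρ - ishE κ a H' ρ| ≤ 3 * ρ ^ κ * δ := by
        have h3 : 0 < ρ ^ κ := Real.rpow_pos_of_pos hρ0 _
        have h4 : 0 ≤ ρ ^ κ * δ := by positivity
        nlinarith [ishE_lip (κ := κ) ha H H' hH hH' hρ0 hδ]
      have h3 : |ρ / 2 - ishJ κ H ρ - (ρ / 2 - ishJ κ H' ρ)| ≤ 8 * ρ * δ := by
        rw [show ρ / 2 - ishJ κ H ρ - (ρ / 2 - ishJ κ H' ρ) = -(ishJ κ H ρ - ishJ κ H' ρ) by ring,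
          abs_neg]
        exact ishJ_lip hκ H H' hc hc' hH hH' hρ0 hδ
      have h4 : ρ ^ (κ - 1) * ρ = ρ ^ κ := by
        rw [Real.rpow_sub_one hρ0.ne']; field_simp
      have h5 : |ishD m k c K κ a H ρ / 2 - κ - (ishD m k c K κ a H' ρ / 2 - κ)|
          = 1 / 2 * |ishD m k c K κ a H ρ - ishD m k c K κ a H' ρ| := by
        rw [show ishD m k c K κ a H ρ / 2 - κ - (ishD m k c K κ a H' ρ / 2 - κ)
          = 1 / 2 * (ishD m k c K κ a H ρ - ishD m k c K κ a H' ρ) by ring,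
          abs_mul, abs_of_pos (by norm_num : (0:ℝ) < 1 / 2)]
      rw [h5]
      have h6 : |ishD m k c K κ a H ρ - ishD m k c K κ a H' ρ|
          ≤ L * (3 * ρ ^ κ * δ + 8 * ρ * δ) :=
        h1.trans (mul_le_mul_of_nonneg_left (by linarith) hL.le)
      have h7 : δ * (L / 2 * (3 * ρ ^ (κ - 1) + 8)) * ρ = L / 2 * (3 * ρ ^ κ * δ + 8 * ρ * δ) := by
        rw [← h4]; ring
      rw [h7]
      linarith
    · simp
  have hDc : ∀ H : ℝ → ℝ, Continuous H → ContinuousOn (fun ρ => (ishD m k c K κ a H ρ / 2 - κ) / ρ)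
      (Ioi 0) := by
    intro H hc
    have h1 := (ishE_cont (a := a) hκ H hc).continuousOn (s := Ioi 0)
    have h2 := ishJ_cont hκ H hc
    unfold ishD ishQ
    apply ContinuousOn.div _ continuousOn_id (fun x hx => (ne_of_gt hx))
    fun_prop
  have hfi : ∀ H : ℝ → ℝ, Continuous H → (∀ x, |H x| ≤ 1) →
      Integrable (ishf m k c K κ a R0 H) := by
    intro H hc hH
    refine hgI.mono' ?_ (Eventually.of_forall (hfb H hc hH))
    unfold ishf
    rw [aestronglyMeasurable_indicator_iff measurableSet_Ioc]
    exact ((hDc H hc).mono (fun x hx => hx.1)).aestronglyMeasurable measurableSet_Ioc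
  -- the space
  let X := {H : BoundedContinuousFunction ℝ ℝ // H ∈ Metric.closedBall (0 : BoundedContinuousFunction ℝ ℝ) 1}
  haveI : CompleteSpace X := (Metric.isClosed_closedBall).completeSpace_coe
  haveI : Nonempty X := ⟨⟨0, by simp⟩⟩
  have hXb : ∀ H : X, ∀ x, |H.1 x| ≤ 1 := by
    intro H x
    have h1 := H.2
    rw [mem_closedBall_zero_iff] at h1
    exact (H.1.norm_coe_le_norm x).trans h1
  have hTb : ∀ H : X, ∀ x, ‖∫ ρ in (0:ℝ)..x, ishf m k c K κ a R0 H.1 ρ‖ ≤ 1 := by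
    intro H x
    refine intervalIntegral.norm_integral_le_integral_norm_uIoc.trans ?_
    have h1 : ∫ ρ in uIoc 0 x, ‖ishf m k c K κ a R0 H.1 ρ‖ ≤ ∫ ρ, ‖ishf m k c K κ a R0 H.1 ρ‖ :=
      setIntegral_le_integral (hfi H.1 H.1.continuous (hXb H)).norm
        (Eventually.of_forall (fun _ => norm_nonneg _))
    have h2 : ∫ ρ, ‖ishf m k c K κ a R0 H.1 ρ‖ ≤ ∫ ρ, g ρ :=
      integral_mono (hfi H.1 H.1.continuous (hXb H)).norm hgI
        (hfb H.1 H.1.continuous (hXb H))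
    linarith
  let T : X → X := fun H => ⟨BoundedContinuousFunction.ofNormedAddCommGroup
    (fun x => ∫ ρ in (0:ℝ)..x, ishf m k c K κ a R0 H.1 ρ)
    (intervalIntegral.continuous_primitive
      (fun _ _ => (hfi H.1 H.1.continuous (hXb H)).intervalIntegrable) 0) 1 (hTb H), by
      rw [mem_closedBall_zero_iff]
      exact BoundedContinuousFunction.norm_ofNormedAddCommGroup_le _ zero_le_one _⟩
  have hT : ContractingWith (1 / 2) T := by
    refine ⟨by rw [← NNReal.coe_lt_coe]; norm_num, LipschitzWith.of_dist_le_mul ?_⟩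
    intro H H'
    rw [Subtype.dist_eq, Subtype.dist_eq, BoundedContinuousFunction.dist_le (by positivity)]
    intro x
    have hδ : ∀ x, |H.1 x - H'.1 x| ≤ dist H.1 H'.1 := by
      intro x
      have := BoundedContinuousFunction.dist_coe_le_dist (f := H.1) (g := H'.1) x
      rwa [Real.dist_eq] at this
    have i1 := hfi H.1 H.1.continuous (hXb H)
    have i2 := hfi H'.1 H'.1.continuous (hXb H')
    show dist (∫ ρ in (0:ℝ)..x, ishf m k c K κ a R0 H.1 ρ)
      (∫ ρ in (0:ℝ)..x, ishf m k c K κ a R0 H'.1 ρ) ≤ _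
    rw [Real.dist_eq, ← intervalIntegral.integral_sub i1.intervalIntegrable i2.intervalIntegrable,
      ← Real.norm_eq_abs]
    refine intervalIntegral.norm_integral_le_integral_norm_uIoc.trans ?_
    have h1 : ∫ ρ in uIoc 0 x, ‖ishf m k c K κ a R0 H.1 ρ - ishf m k c K κ a R0 H'.1 ρ‖ ≤
        ∫ ρ, ‖ishf m k c K κ a R0 H.1 ρ - ishf m k c K κ a R0 H'.1 ρ‖ :=
      setIntegral_le_integral (i1.sub i2).norm (Eventually.of_forall (fun _ => norm_nonneg _))
    have h2 : ∫ ρ, ‖ishf m k c K κ a R0 H.1 ρ - ishf m k c K κ a R0 H'.1 ρ‖ ≤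
        ∫ ρ, dist H.1 H'.1 * g ρ :=
      integral_mono (i1.sub i2).norm (hgI.const_mul _)
        (hfd H.1 H'.1 H.1.continuous H'.1.continuous (hXb H) (hXb H') _ hδ)
    rw [integral_const_mul] at h2
    have h3 : dist H.1 H'.1 * ∫ ρ, g ρ ≤ dist H.1 H'.1 * (1 / 2) :=
      mul_le_mul_of_nonneg_left hgval dist_nonneg
    have h4 : ((1 / 2 : NNReal) : ℝ) = 1 / 2 := by norm_num
    rw [h4]
    linarith
  let H : X := ContractingWith.fixedPoint T hT
  have hfix : T H = H := ContractingWith.fixedPoint_isFixedPt hT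
  have hHeq : ∀ x, H.1 x = ∫ ρ in (0:ℝ)..x, ishf m k c K κ a R0 H.1 ρ := by
    intro x
    conv_lhs => rw [← hfix]
    rfl
  refine ⟨H.1, H.1.continuous, hXb H, ?_⟩
  intro R hR
  refine ⟨(hphi _ _ 0 0 (hEs H.1 (hXb H) R ⟨hR.1, hR.2.le⟩)
    (hqs H.1 H.1.continuous (hXb H) R ⟨hR.1, hR.2.le⟩) (by simpa using hε)
        (by simpa using hε)).1, ?_⟩
  have hev : ishf m k c K κ a R0 H.1 =ᶠ[nhds R] (fun ρ => (ishD m k c K κ a H.1 ρ / 2 - κ) / ρ) := by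
    filter_upwards [Ioo_mem_nhds hR.1 hR.2] with ρ hρ
    exact indicator_of_mem (show ρ ∈ Ioc 0 R0 from ⟨hρ.1, hρ.2.le⟩) _
  have hcont : ContinuousAt (ishf m k c K κ a R0 H.1) R := by
    refine ContinuousAt.congr ?_ hev.symm
    exact (hDc H.1 H.1.continuous).continuousAt (Ioi_mem_nhds hR.1)
  have hfI := hfi H.1 H.1.continuous (hXb H)
  have hder := intervalIntegral.integral_hasDerivAt_right (a := 0) (b := R)
    hfI.intervalIntegrable (hfI.aestronglyMeasurable.stronglyMeasurableAtFilter) hcont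
  rw [hev.eq_of_nhds] at hder
  have : (H.1 : ℝ → ℝ) = fun x => ∫ ρ in (0:ℝ)..x, ishf m k c K κ a R0 H.1 ρ := funext hHeq
  exact hder.congr_of_eventuallyEq (Eventually.of_forall hHeq)

theorem ish_local (m k c K κ : ℝ) (hκ : 0 < κ) (hK : 4 * K = 4 * κ ^ 2 + c ^ 2) :
    ∃ R0 > (0:ℝ), ∀ a : ℝ, 0 < a → a ≤ 1 → ∃ E q d : ℝ → ℝ, ∀ R ∈ Ioo 0 R0,
      HasDerivAt E (E R * d R / (2 * R)) R ∧
      HasDerivAt q (d R * (R / 2 - q R) / (2 * R)) R ∧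
      HasDerivAt d (ishP m k c K R (E R) (q R) / (2 * R)) R ∧
      d R ^ 2 = ishQ m k c K (E R) (q R) ∧ 0 < E R ∧ E R ≤ 3 * a * R ^ κ ∧ q R < R / 2 := by
  obtain ⟨R0, hR0, h⟩ := ish_fixed m k c K κ hκ hK
  refine ⟨R0, hR0, fun a ha ha1 => ?_⟩
  obtain ⟨H, hc, hH, hd⟩ := h a ha ha1
  refine ⟨ishE κ a H, fun R => R / 2 - ishJ κ H R, ishD m k c K κ a H, ?_⟩
  intro R hR
  have hRp := hR.1
  obtain ⟨hQ, hder⟩ := hd R hR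
  set D := ishD m k c K κ a H R with hD
  have hDp : 0 < D := Real.sqrt_pos.2 hQ
  have hrp : HasDerivAt (fun x : ℝ => x ^ κ) (κ * R ^ (κ - 1)) R :=
    Real.hasDerivAt_rpow_const (Or.inl hRp.ne')
  have hpp : 0 < R ^ κ := by positivity
  have hep := Real.exp_pos (H R)
  have hEd : HasDerivAt (ishE κ a H) (ishE κ a H R * D / (2 * R)) R := by
    have := ((hrp.const_mul a).mul hder.exp)
    refine this.congr_deriv ?_
    unfold ishE
    rw [Real.rpow_sub_one hRp.ne']
    field_simp
    ring
  have hJd : HasDerivAt (ishJ κ H) (1 / 2 - ishJ κ H R * D / (2 * R)) R := by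
    have hn : HasDerivAt (fun R => ∫ ρ in (0:ℝ)..R, ρ ^ κ * Real.exp (H ρ))
        (R ^ κ * Real.exp (H R)) R :=
      (ishJ_int hκ H hc).integral_hasStrictDerivAt 0 R |>.hasDerivAt
    have hden := (hrp.mul hder.exp).const_mul 2
    have := hn.div hden (by show 2 * (R ^ κ * Real.exp (H R)) ≠ 0; positivity)
    refine this.congr_deriv ?_
    unfold ishJ
    simp only [Pi.mul_apply]
    rw [Real.rpow_sub_one hRp.ne']
    field_simp
    ring
  have hqd : HasDerivAt (fun R => R / 2 - ishJ κ H R)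
      (D * (R / 2 - (R / 2 - ishJ κ H R)) / (2 * R)) R := by
    refine (((hasDerivAt_id R).div_const 2).sub hJd).congr_deriv ?_
    field_simp
    ring
  refine ⟨hEd, hqd, ?_, ?_, ishE_pos ha H hRp, ishE_le ha H hH hRp, ?_⟩
  · have hQd : HasDerivAt (fun R => ishQ m k c K (ishE κ a H R) (R / 2 - ishJ κ H R))
        (D * (ishP m k c K R (ishE κ a H R) (R / 2 - ishJ κ H R)) / R) R := by
      unfold ishQ
      have := (((hEd.const_sub 2).mul (((hqd.const_mul (4 * m)).add_const (2 * K)).add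
        (hEd.const_mul (3 * k ^ 2)))).sub ((hqd.sub_const c).pow 2))
      refine this.congr_deriv ?_
      unfold ishP
      simp only [Pi.add_apply]
      field_simp
      ring
    have := hQd.sqrt hQ.ne'
    refine this.congr_deriv ?_
    have hs : Real.sqrt (ishQ m k c K (ishE κ a H R) (R / 2 - ishJ κ H R)) = D := rfl
    rw [hs]
    field_simp
  · exact Real.sq_sqrt hQ.le
  · have := ishJ_pos hκ H hc hRp
    simp only
    linarith

theorem ish_C0 (m k c K : ℝ) : ∃ C0 : ℝ, 1 ≤ C0 ∧ ∀ E q d : ℝ, 0 ≤ E → E ≤ 1 →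
    d ^ 2 = ishQ m k c K E q → |q| ≤ C0 ∧ |d| ≤ C0 := by
  set X0 : ℝ := 8 * |m| + (8 * |m * c| + 4 * |K| + 6 * k ^ 2) + 1 with hX0
  set D0 : ℝ := 8 * |m| * X0 + (8 * |m * c| + 4 * |K| + 6 * k ^ 2) + 1 with hD0
  have hm := abs_nonneg m
  have hmc := abs_nonneg (m * c)
  have hK := abs_nonneg K
  have hX1 : 1 ≤ X0 := by rw [hX0]; nlinarith [sq_nonneg k]
  have hD1 : 1 ≤ D0 := by rw [hD0]; nlinarith [sq_nonneg k]
  refine ⟨X0 + |c| + D0, by linarith [abs_nonneg c], ?_⟩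
  intro E q d hE0 hE1 hd
  unfold ishQ at hd
  have hA : (2 - E) * (4 * m * q + 2 * K + 3 * k ^ 2 * E) ≤
      8 * |m| * |q - c| + (8 * |m * c| + 4 * |K| + 6 * k ^ 2) := by
    have h1 : m * (q - c) ≤ |m| * |q - c| := by rw [← abs_mul]; exact le_abs_self _
    have h2 := le_abs_self (m * c)
    have h3 := le_abs_self K
    have h4 : 0 ≤ |m| * |q - c| := by positivity
    have e1 : (2 - E) * (m * (q - c)) ≤ 2 * (|m| * |q - c|) := by nlinarith
    have e2 : (2 - E) * (m * c) ≤ 2 * |m * c| := by nlinarith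
    have e3 : (2 - E) * K ≤ 2 * |K| := by nlinarith
    have e4 : (2 - E) * (k ^ 2 * E) ≤ 2 * k ^ 2 := by
      have : k ^ 2 * E ≤ k ^ 2 := by nlinarith [sq_nonneg k]
      have : 0 ≤ k ^ 2 * E := by positivity
      nlinarith
    nlinarith
  have hq : |q - c| ≤ X0 := by
    by_contra hcon
    push Not at hcon
    have h1 : |q - c| ^ 2 = (q - c) ^ 2 := sq_abs _
    have h2 : (q - c) ^ 2 ≤ 8 * |m| * |q - c| + (8 * |m * c| + 4 * |K| + 6 * k ^ 2) := by
      nlinarith [sq_nonneg d]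
    have h3 : (8 * |m * c| + 4 * |K| + 6 * k ^ 2) ≤
        (8 * |m * c| + 4 * |K| + 6 * k ^ 2) * |q - c| := by
      have : 0 ≤ (8 * |m * c| + 4 * |K| + 6 * k ^ 2) := by positivity
      nlinarith
    nlinarith
  have hdd : d ^ 2 ≤ D0 := by
    have : |m| * |q - c| ≤ |m| * X0 := by gcongr
    nlinarith [sq_nonneg (q - c)]
  constructor
  · have : |q| ≤ |q - c| + |c| := by simpa using abs_add_le (q - c) c
    linarith
  · have : |d| ≤ D0 := abs_le_of_sq_le_sq (by nlinarith) (by linarith)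
    linarith [abs_nonneg c]

theorem ish_fst {A B : Type*} [NormedAddCommGroup A] [NormedSpace ℝ A] [NormedAddCommGroup B]
    [NormedSpace ℝ B] {f : ℝ → A × B} {f' : A × B} {x : ℝ} (h : HasDerivAt f f' x) :
    HasDerivAt (fun t => (f t).1) f'.1 x :=
  (ContinuousLinearMap.fst ℝ A B).hasFDerivAt.comp_hasDerivAt x h

theorem ish_snd {A B : Type*} [NormedAddCommGroup A] [NormedSpace ℝ A] [NormedAddCommGroup B]
    [NormedSpace ℝ B] {f : ℝ → A × B} {f' : A × B} {x : ℝ} (h : HasDerivAt f f' x) :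
    HasDerivAt (fun t => (f t).2) f'.2 x :=
  (ContinuousLinearMap.snd ℝ A B).hasFDerivAt.comp_hasDerivAt x h

theorem ish_ext (m k c K C1 Rs E0 q0 d0 : ℝ) (hRs : 0 < Rs) (hC1 : 0 < C1) :
    ∃ E q d : ℝ → ℝ, E Rs = E0 ∧ q Rs = q0 ∧ d Rs = d0 ∧ Continuous E ∧ Continuous q ∧
      Continuous d ∧ ∀ R ≥ Rs, |E R| ≤ C1 → |q R| ≤ C1 → |d R| ≤ C1 →
        HasDerivAt E (E R * d R / (2 * R)) R ∧ HasDerivAt q (d R * (R / 2 - q R) / (2 * R)) R ∧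
        HasDerivAt d (ishP m k c K R (E R) (q R) / (2 * R)) R := by
  let χ : ContDiffBump (0 : ℝ × ℝ × ℝ) := ⟨C1, C1 + 1, hC1, by linarith⟩
  let F0 : ℝ × ℝ × ℝ → ℝ × ℝ × ℝ := fun y => χ y • (y.1 * y.2.2 / 2, -y.2.2 * y.2.1 / 2,
    ((y.2.1 - c) * y.2.1 - 1 / 2 * y.1 * (4 * m * y.2.1 + 2 * K + 3 * k ^ 2 * y.1)
      + 1 / 2 * (2 - y.1) * (- 4 * m * y.2.1 + 3 * k ^ 2 * y.1)) / 2)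
  let F1 : ℝ × ℝ × ℝ → ℝ × ℝ × ℝ := fun y => χ y • (0, y.2.2 / 4,
    (-(y.2.1 - c) / 2 + (2 - y.1) * m) / 2)
  have hs0 : HasCompactSupport F0 := χ.hasCompactSupport.smul_right
  have hs1 : HasCompactSupport F1 := χ.hasCompactSupport.smul_right
  have hd0 : ContDiff ℝ 1 F0 := by
    apply ContDiff.smul χ.contDiff
    fun_prop
  have hd1 : ContDiff ℝ 1 F1 := by
    apply ContDiff.smul χ.contDiff
    fun_prop
  obtain ⟨K0, hK0⟩ := hd0.lipschitzWith_of_hasCompactSupport hs0 (by norm_num)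
  obtain ⟨K1, hK1⟩ := hd1.lipschitzWith_of_hasCompactSupport hs1 (by norm_num)
  obtain ⟨L0, hL0⟩ := hs0.exists_bound_of_continuous hd0.continuous
  obtain ⟨L1, hL1⟩ := hs1.exists_bound_of_continuous hd1.continuous
  have hL0p : 0 ≤ L0 := (norm_nonneg _).trans (hL0 0)
  have hL1p : 0 ≤ L1 := (norm_nonneg _).trans (hL1 0)
  have hinv : ∀ R : ℝ, 0 < (max R Rs) := fun R => lt_max_of_lt_right hRs
  have hinv2 : ∀ R : ℝ, (max R Rs)⁻¹ ≤ Rs⁻¹ := fun R =>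
    inv_anti₀ hRs (le_max_right _ _)
  obtain ⟨y, hy0, hy⟩ := ish_global_ode (fun R y => (max R Rs)⁻¹ • F0 y + F1 y)
    (Real.toNNReal Rs⁻¹ * K0 + K1) (Real.toNNReal (Rs⁻¹ * L0 + L1)) (by
      intro R
      apply LipschitzWith.add _ hK1
      apply LipschitzWith.of_dist_le_mul
      intro x z
      rw [dist_smul₀, NNReal.coe_mul, mul_assoc, Real.coe_toNNReal _ (by positivity)]
      have := hK0.dist_le_mul x z
      rw [Real.norm_of_nonneg (inv_nonneg.2 (hinv R).le)]
      exact mul_le_mul (hinv2 R) this dist_nonneg (by positivity))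
    (by
      intro x
      have : Continuous (fun t => (max t Rs)⁻¹) :=
        Continuous.inv₀ (by fun_prop) (fun t => (hinv t).ne')
      fun_prop)
    (by
      intro t x
      refine (norm_add_le _ _).trans ?_
      rw [Real.coe_toNNReal _ (by positivity)]
      rw [norm_smul, Real.norm_of_nonneg (inv_nonneg.2 (hinv t).le)]
      have := hL0 x
      have := hL1 x
      have := hinv2 t
      gcongr)
    Rs (E0, q0, d0)
  have hyc : Continuous y := continuous_iff_continuousAt.2 fun t => (hy t).continuousAt
  refine ⟨fun R => (y R).1, fun R => (y R).2.1, fun R => (y R).2.2, by simp [hy0], by simp [hy0],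
    by simp [hy0], by fun_prop, by fun_prop, by fun_prop, ?_⟩
  intro R hR h1 h2 h3
  have hRp : 0 < R := by linarith
  have hχ : χ (y R) = 1 := by
    apply χ.one_of_mem_closedBall
    rw [mem_closedBall_zero_iff, Prod.norm_def, Prod.norm_def]
    exact max_le h1 (max_le h2 h3)
  have hR' := hy R
  simp only [F0, F1, hχ, one_smul, max_eq_left hR] at hR'
  refine ⟨?_, ?_, ?_⟩
  · refine (ish_fst hR').congr_deriv ?_
    simp
    field_simp
  · refine (ish_fst (ish_snd hR')).congr_deriv ?_
    simp
    field_simp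
    ring
  · refine (ish_snd (ish_snd hR')).congr_deriv ?_
    simp [ishP]
    field_simp
    ring

theorem ish_mono {f f' : ℝ → ℝ} {a b : ℝ} (hab : a ≤ b) (hc : ContinuousOn f (Icc a b))
    (hd : ∀ x ∈ Ioo a b, HasDerivAt f (f' x) x) (h0 : ∀ x ∈ Ioo a b, 0 ≤ f' x) : f a ≤ f b := by
  have := monotoneOn_of_deriv_nonneg (convex_Icc a b) hc (by
    rw [interior_Icc]; exact fun x hx => (hd x hx).differentiableAt.differentiableWithinAt) (by
    rw [interior_Icc]; intro x hx; rw [(hd x hx).deriv]; exact h0 x hx)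
  exact this (left_mem_Icc.2 hab) (right_mem_Icc.2 hab) hab

theorem ish_anti {f f' : ℝ → ℝ} {a b : ℝ} (hab : a ≤ b) (hc : ContinuousOn f (Icc a b))
    (hd : ∀ x ∈ Ioo a b, HasDerivAt f (f' x) x) (h0 : ∀ x ∈ Ioo a b, f' x ≤ 0) : f b ≤ f a := by
  have := ish_mono (f := fun x => - f x) (f' := fun x => - f' x) hab hc.neg
    (fun x hx => (hd x hx).neg) (fun x hx => by linarith [h0 x hx])
  linarith

theorem ish_const {f f' : ℝ → ℝ} {a b : ℝ} (hab : a ≤ b) (hc : ContinuousOn f (Icc a b))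
    (hd : ∀ x ∈ Ioo a b, HasDerivAt f (f' x) x) (h0 : ∀ x ∈ Ioo a b, f' x = 0) : f b = f a :=
  le_antisymm (ish_anti hab hc hd fun x hx => (h0 x hx).le)
    (ish_mono hab hc hd fun x hx => (h0 x hx).ge)

/-- comparison of `N` with linear functions. -/
theorem ish_N_bound {E q : ℝ → ℝ} {C0 R1 R : ℝ} (hC0 : 1 ≤ C0) (hR1 : 4 * C0 ≤ R1) (hR : R1 ≤ R)
    (hEc : ContinuousOn E (Icc R1 R)) (hqc : ContinuousOn q (Icc R1 R))
    (hN : ∀ x ∈ Ioo R1 R, HasDerivAt (fun x => E x * (x / 2 - q x)) (E x / 2) x)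
    (hE : ∀ x ∈ Icc R1 R, 0 < E x) (hq : ∀ x ∈ Icc R1 R, |q x| ≤ C0) :
    E R * (R / 2 - q R) / (R - 2 * C0) ≤ E R1 * (R1 / 2 - q R1) / (R1 - 2 * C0) ∧
    E R1 * (R1 / 2 - q R1) / (R1 + 2 * C0) ≤ E R * (R / 2 - q R) / (R + 2 * C0) := by
  constructor
  · apply ish_anti (f := fun x => E x * (x / 2 - q x) / (x - 2 * C0)) hR
    · apply ContinuousOn.div (by fun_prop) (by fun_prop)
      intro x hx
      have := hx.1
      intro h; linarith
    · intro x hx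
      exact (hN x hx).div ((hasDerivAt_id x).sub_const (2 * C0)) (by
        have := hx.1
        intro h; linarith)
    · intro x hx
      have hx' := Ioo_subset_Icc_self hx
      have h1 := hE x hx'
      have h2 := abs_le.1 (hq x hx')
      apply div_nonpos_of_nonpos_of_nonneg _ (sq_nonneg _)
      nlinarith
  · apply ish_mono (f := fun x => E x * (x / 2 - q x) / (x + 2 * C0)) hR
    · apply ContinuousOn.div (by fun_prop) (by fun_prop)
      intro x hx
      have := hx.1
      intro h; linarith
    · intro x hx
      exact (hN x hx).div ((hasDerivAt_id x).add_const (2 * C0)) (by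
        have := hx.1
        intro h; linarith)
    · intro x hx
      have hx' := Ioo_subset_Icc_self hx
      have h1 := hE x hx'
      have h2 := abs_le.1 (hq x hx')
      apply div_nonneg _ (sq_nonneg _)
      nlinarith

theorem ish_N_der {E q d : ℝ → ℝ} {R : ℝ} (hR : 0 < R) (h1 : HasDerivAt E (E R * d R / (2 * R)) R)
    (h2 : HasDerivAt q (d R * (R / 2 - q R) / (2 * R)) R) :
    HasDerivAt (fun x => E x * (x / 2 - q x)) (E R / 2) R := by
  refine (h1.mul (((hasDerivAt_id R).div_const 2).sub h2)).congr_deriv ?_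
  simp only [id]
  field_simp
  simp
  ring

theorem ish_constraint_der {m k c K : ℝ} {E q d : ℝ → ℝ} {R : ℝ} (hR : 0 < R)
    (h1 : HasDerivAt E (E R * d R / (2 * R)) R)
    (h2 : HasDerivAt q (d R * (R / 2 - q R) / (2 * R)) R)
    (h3 : HasDerivAt d (ishP m k c K R (E R) (q R) / (2 * R)) R) :
    HasDerivAt (fun x => d x ^ 2 - ishQ m k c K (E x) (q x)) 0 R := by
  unfold ishQ
  have := (h3.pow 2).sub (((h1.const_sub 2).mul
    (((h2.const_mul (4 * m)).add_const (2 * K)).add (h1.const_mul (3 * k ^ 2)))).sub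
    ((h2.sub_const c).pow 2))
  refine this.congr_deriv ?_
  simp only [ishP]
  field_simp
  simp
  ring

theorem ish_apriori {m k c K C0 Rs b : ℝ} {E q d : ℝ → ℝ} (hRs : 0 < Rs) (hb : Rs ≤ b)
    (hC0 : 1 ≤ C0) (hC : ∀ E q d : ℝ, 0 ≤ E → E ≤ 1 →
      d ^ 2 = ishQ m k c K E q → |q| ≤ C0 ∧ |d| ≤ C0)
    (hEc : Continuous E) (hqc : Continuous q) (hdc : Continuous d)
    (h1 : ∀ R ∈ Ico Rs b, HasDerivAt E (E R * d R / (2 * R)) R)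
    (h2 : ∀ R ∈ Ico Rs b, HasDerivAt q (d R * (R / 2 - q R) / (2 * R)) R)
    (h3 : ∀ R ∈ Ico Rs b, HasDerivAt d (ishP m k c K R (E R) (q R) / (2 * R)) R)
    (hE1 : ∀ R ∈ Icc Rs b, E R ≤ 1)
    (hc0 : d Rs ^ 2 = ishQ m k c K (E Rs) (q Rs)) (hE0 : 0 < E Rs)
    (hsm : 3 * (E Rs * Real.exp (C0 / (2 * Rs) * (4 * C0))) ≤ 1 / 2) :
    ∀ R ∈ Icc Rs b, d R ^ 2 = ishQ m k c K (E R) (q R) ∧ 0 < E R ∧ E R ≤ 1 / 2 ∧ |q R| ≤ C0 ∧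
      |d R| ≤ C0 := by
  have hcons : ∀ R ∈ Icc Rs b, d R ^ 2 = ishQ m k c K (E R) (q R) := by
    intro R hR
    have := ish_const (f := fun x => d x ^ 2 - ishQ m k c K (E x) (q x)) (f' := fun _ => 0) hR.1
      (by unfold ishQ; fun_prop) (by
        intro x hx
        have hx' : x ∈ Ico Rs b := ⟨hx.1.le, hx.2.trans_le hR.2⟩
        exact ish_constraint_der (by linarith [hx.1]) (h1 x hx') (h2 x hx') (h3 x hx'))
      (fun _ _ => rfl)
    linarith
  have hpos : ∀ R ∈ Icc Rs b, 0 < E R := by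
    intro R hR
    have hgc : Continuous (fun x => d x / (2 * max x Rs)) :=
      hdc.div (by fun_prop) (fun x => by
        have : 0 < max x Rs := lt_max_of_lt_right hRs
        positivity)
    have hG : ∀ x, HasDerivAt (fun x => ∫ ρ in Rs..x, d ρ / (2 * max ρ Rs))
        (d x / (2 * max x Rs)) x := fun x =>
      (hgc.integral_hasStrictDerivAt Rs x).hasDerivAt
    have hGc : Continuous (fun x => ∫ ρ in Rs..x, d ρ / (2 * max ρ Rs)) :=
      continuous_iff_continuousAt.2 fun x => (hG x).continuousAt
    have := ish_const (f := fun x => E x * Real.exp (-∫ ρ in Rs..x, d ρ / (2 * max ρ Rs)))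
      hR.1 (by fun_prop)
      (fun x hx => by
        have hx' : x ∈ Ico Rs b := ⟨hx.1.le, hx.2.trans_le hR.2⟩
        exact (h1 x hx').mul (hG x).neg.exp) (by
        intro x hx
        have : 0 < x := by linarith [hx.1]
        simp only [max_eq_left hx.1.le]
        field_simp
        simp)
    simp only [intervalIntegral.integral_same, neg_zero, Real.exp_zero, mul_one] at this
    have h5 := Real.exp_pos (-∫ ρ in Rs..R, d ρ / (2 * max ρ Rs))
    exact pos_of_mul_pos_left (this ▸ hE0) h5.le
  have hqd : ∀ R ∈ Icc Rs b, |q R| ≤ C0 ∧ |d R| ≤ C0 := fun R hR =>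
    hC _ _ _ (hpos R hR).le (hE1 R hR) (hcons R hR)
  set G := C0 / (2 * Rs) with hGdef
  have hG0 : 0 < G := by positivity
  have hexp : ∀ R ∈ Icc Rs b, E R ≤ E Rs * Real.exp (G * (R - Rs)) := by
    intro R hR
    have := ish_anti (f := fun x => E x * Real.exp (-(G * (x - Rs)))) hR.1 (by fun_prop)
      (fun x hx => by
        have hx' : x ∈ Ico Rs b := ⟨hx.1.le, hx.2.trans_le hR.2⟩
        exact (h1 x hx').mul ((((hasDerivAt_id x).sub_const Rs).const_mul G).neg.exp)) (by
        intro x hx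
        have hx0 : 0 < x := by linarith [hx.1]
        have hx' : x ∈ Icc Rs b := ⟨hx.1.le, hx.2.le.trans hR.2⟩
        simp only [mul_one, Pi.neg_apply, id_eq]
        have hdx := (abs_le.1 (hqd x hx').2).2
        have : d x / (2 * x) ≤ G := by
          rw [hGdef]
          have := hx.1.le
          gcongr
        have hp := hpos x hx'
        have he := Real.exp_pos (-(G * (x - Rs)))
        have e : E x * d x / (2 * x) = E x * (d x / (2 * x)) := by ring
        rw [e]
        have : E x * (d x / (2 * x)) ≤ E x * G := by gcongr
        nlinarith)
    simp only [sub_self, mul_zero, neg_zero, Real.exp_zero, mul_one] at this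
    rw [Real.exp_neg] at this
    have he := Real.exp_pos (G * (R - Rs))
    rwa [← div_eq_mul_inv, div_le_iff₀ he] at this
  have hhalf : ∀ R ∈ Icc Rs b, E R ≤ 1 / 2 := by
    intro R hR
    set R1 := max (4 * C0) Rs with hR1
    have hle : ∀ x ∈ Icc Rs b, x ≤ R1 → E x ≤ E Rs * Real.exp (G * (4 * C0)) := by
      intro x hx hx1
      refine (hexp x hx).trans ?_
      have : x - Rs ≤ 4 * C0 := by
        rcases max_choice (4 * C0) Rs with h | h <;> rw [← hR1] at h <;> linarith
      gcongr
    have hEG : 0 < E Rs * Real.exp (G * (4 * C0)) := by positivity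
    rcases le_total R R1 with h | h
    · linarith [hle R hR h]
    · have hR1m : R1 ∈ Icc Rs b := ⟨le_max_right _ _, h.trans hR.2⟩
      have h4 : 4 * C0 ≤ R1 := le_max_left _ _
      have hb := (ish_N_bound hC0 h4 h hEc.continuousOn hqc.continuousOn (fun x hx => by
        have hx' : x ∈ Ico Rs b := ⟨hR1m.1.trans hx.1.le, hx.2.trans_le hR.2⟩
        exact ish_N_der (by linarith [hx'.1]) (h1 x hx') (h2 x hx'))
        (fun x hx => hpos x ⟨hR1m.1.trans hx.1, hx.2.trans hR.2⟩)
        (fun x hx => (hqd x ⟨hR1m.1.trans hx.1, hx.2.trans hR.2⟩).1)).1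
      have e1 := hle R1 hR1m le_rfl
      have q1 := abs_le.1 (hqd R1 hR1m).1
      have q2 := abs_le.1 (hqd R hR).1
      have p1 := hpos R1 hR1m
      have p2 := hpos R hR
      have b1 : E R / 2 ≤ E R * (R / 2 - q R) / (R - 2 * C0) := by
        rw [le_div_iff₀ (by linarith)]
        nlinarith
      have b2 : E R1 * (R1 / 2 - q R1) / (R1 - 2 * C0) ≤ 3 / 2 * E R1 := by
        rw [div_le_iff₀ (by linarith)]
        nlinarith
      linarith
  intro R hR
  exact ⟨hcons R hR, hpos R hR, hhalf R hR, hqd R hR⟩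

theorem ish_glue {f g : ℝ → ℝ} {a x v : ℝ} (hfg : f a = g a) (h1 : x ≤ a → HasDerivAt f v x)
    (h2 : a ≤ x → HasDerivAt g v x) : HasDerivAt (fun t => if t ≤ a then f t else g t) v x := by
  rcases lt_trichotomy x a with h | h | h
  · refine (h1 h.le).congr_of_eventuallyEq ?_
    filter_upwards [Iio_mem_nhds h] with t ht
    rw [if_pos (le_of_lt ht)]
  · subst h
    have e1 : HasDerivWithinAt (fun t => if t ≤ x then f t else g t) v (Iic x) x :=
      (h1 le_rfl).hasDerivWithinAt.congr (fun t ht => if_pos ht) (if_pos le_rfl)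
    have e2 : HasDerivWithinAt (fun t => if t ≤ x then f t else g t) v (Ici x) x := by
      refine (h2 le_rfl).hasDerivWithinAt.congr (fun t ht => ?_) ?_
      · rcases eq_or_lt_of_le (mem_Ici.1 ht) with h | h
        · subst h; simp [hfg]
        · rw [if_neg (not_le.2 h)]
      · simp [hfg]
    have := e1.union e2
    rw [Iic_union_Ici] at this
    exact this.hasDerivAt univ_mem
  · refine (h2 h.le).congr_of_eventuallyEq ?_
    filter_upwards [Ioi_mem_nhds h] with t ht
    rw [if_neg (not_le.2 ht)]

/-- a global radial profile in the variable `R = r ^ 2`. -/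
structure IshProf (m k c K κ : ℝ) (E q d B : ℝ → ℝ) : Prop where
  hE : ∀ R > 0, HasDerivAt E (E R * d R / (2 * R)) R
  hq : ∀ R > 0, HasDerivAt q (d R * (R / 2 - q R) / (2 * R)) R
  hd : ∀ R > 0, HasDerivAt d (ishP m k c K R (E R) (q R) / (2 * R)) R
  hB : ∀ R > 0, HasDerivAt B ((q R - c) / (2 * R * (2 - E R))) R
  cons : ∀ R > 0, d R ^ 2 = ishQ m k c K (E R) (q R)
  pos : ∀ R > 0, 0 < E R
  half : ∀ R > 0, E R ≤ 1 / 2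
  bdd : ∃ C : ℝ, 1 ≤ C ∧ ∀ R > 0, |q R| ≤ C ∧ |d R| ≤ C
  decay : ∃ A : ℝ, 0 < A ∧ ∀ R > 0, E R ≤ A * R ^ κ
  lim : ∃ l C R1 : ℝ, 0 < l ∧ l ≤ 1 / 2 ∧ 0 < R1 ∧ ∀ R ≥ R1, |E R - l| ≤ C / R

theorem ish_lim {E q d : ℝ → ℝ} {C0 : ℝ} (hC0 : 1 ≤ C0)
    (hE : ∀ R > 0, HasDerivAt E (E R * d R / (2 * R)) R)
    (hq : ∀ R > 0, HasDerivAt q (d R * (R / 2 - q R) / (2 * R)) R)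
    (hpos : ∀ R > 0, 0 < E R) (half : ∀ R > 0, E R ≤ 1 / 2) (hqb : ∀ R > 0, |q R| ≤ C0) :
    ∃ l C R1 : ℝ, 0 < l ∧ l ≤ 1 / 2 ∧ 0 < R1 ∧ ∀ R ≥ R1, |E R - l| ≤ C / R := by
  set N : ℝ → ℝ := fun R => E R * (R / 2 - q R) with hN
  have hb : ∀ R1 R2, 4 * C0 ≤ R1 → R1 ≤ R2 → N R2 / (R2 - 2 * C0) ≤ N R1 / (R1 - 2 * C0) ∧
      N R1 / (R1 + 2 * C0) ≤ N R2 / (R2 + 2 * C0) := by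
    intro R1 R2 h1 h2
    apply ish_N_bound hC0 h1 h2
    · exact fun x hx => (hE x (by linarith [hx.1])).continuousAt.continuousWithinAt
    · exact fun x hx => (hq x (by linarith [hx.1])).continuousAt.continuousWithinAt
    · exact fun x hx => ish_N_der (by linarith [hx.1]) (hE x (by linarith [hx.1]))
        (hq x (by linarith [hx.1]))
    · exact fun x hx => hpos x (by linarith [hx.1])
    · exact fun x hx => hqb x (by linarith [hx.1])
  have hNp : ∀ R, 4 * C0 ≤ R → 0 < N R := by
    intro R hR
    have := hpos R (by linarith)
    have h2 := abs_le.1 (hqb R (by linarith))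
    exact mul_pos this (by linarith)
  set S : Set ℝ := (fun R => N R / (R + 2 * C0)) '' Ici (4 * C0) with hS
  have hlow : ∀ R ≥ 4 * C0, ∀ s ∈ S, s ≤ N R / (R - 2 * C0) := by
    rintro R hR s ⟨R', hR', rfl⟩
    simp only [mem_Ici] at hR'
    have hM1 : R ≤ max R R' := le_max_left _ _
    have hM2 : R' ≤ max R R' := le_max_right _ _
    have a1 := (hb R (max R R') hR hM1).1
    have a2 := (hb R' (max R R') hR' hM2).2
    have hp := hNp (max R R') (hR.le.trans hM1)
    have a3 : N (max R R') / (max R R' + 2 * C0) ≤ N (max R R') / (max R R' - 2 * C0) := by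
      apply div_le_div_of_nonneg_left hp.le <;> linarith
    exact a2.trans (a3.trans a1)
  have hSb : BddAbove S := ⟨_, hlow (4 * C0) le_rfl⟩
  have hSn : S.Nonempty := ⟨_, 4 * C0, by simp, rfl⟩
  set l := sSup S with hl
  have hl1 : ∀ R ≥ 4 * C0, l ≤ N R / (R - 2 * C0) := fun R hR => csSup_le hSn (hlow R hR)
  have hl2 : ∀ R ≥ 4 * C0, N R / (R + 2 * C0) ≤ l := fun R hR => le_csSup hSb ⟨R, hR, rfl⟩
  have hlp : 0 < l := by
    refine lt_of_lt_of_le ?_ (hl2 (4 * C0) le_rfl)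
    have := hNp (4 * C0) le_rfl
    positivity
  have hest : ∀ R ≥ 4 * C0, |E R - 2 * l| ≤ 16 * l * C0 / R := by
    intro R hR
    have a1 := hl1 R hR
    have a2 := hl2 R hR
    rw [le_div_iff₀ (by linarith)] at a1
    rw [div_le_iff₀ (by linarith)] at a2
    have h2 := abs_le.1 (hqb R (by linarith))
    have hp := hpos R (by linarith)
    have hR0 : 0 < R := by linarith
    rw [abs_le, neg_le, le_div_iff₀ hR0, le_div_iff₀ hR0]
    simp only [hN] at a1 a2
    have hlC : 0 < l * C0 := by positivity
    constructor
    · have h3 : 2 * l * (R - 2 * C0) ≤ E R * (R + 2 * C0) := by nlinarith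
      -- (2l - E)(R+2C0) ≤ 8 l C0
      have h4 : (2 * l - E R) * (R + 2 * C0) ≤ 8 * l * C0 := by nlinarith
      by_contra hcon
      push Not at hcon
      have : 0 < 2 * l - E R := by
        by_contra h; push Not at h
        nlinarith
      nlinarith
    · have h3 : E R * (R - 2 * C0) ≤ 2 * l * (R + 2 * C0) := by nlinarith
      have h4 : (E R - 2 * l) * (R - 2 * C0) ≤ 8 * l * C0 := by nlinarith
      by_contra hcon
      push Not at hcon
      have : 0 < E R - 2 * l := by
        by_contra h; push Not at h
        nlinarith
      nlinarith
  refine ⟨2 * l, 16 * l * C0, 4 * C0, by linarith, ?_, by linarith, hest⟩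
  by_contra hcon
  push Not at hcon
  set R := 4 * C0 + 16 * l * C0 / (2 * l - 1 / 2) + 1 with hR
  have hpos' : 0 < 16 * l * C0 / (2 * l - 1 / 2) := by
    have : 0 < 2 * l - 1 / 2 := by linarith
    positivity
  have h1 := hest R (by linarith)
  have h2 := half R (by linarith)
  have h3 := (abs_le.1 h1).1
  have h4 : 16 * l * C0 / R < 2 * l - 1 / 2 := by
    rw [div_lt_iff₀ (by linarith)]
    have : 16 * l * C0 = (2 * l - 1 / 2) * (16 * l * C0 / (2 * l - 1 / 2)) := by
      have : 2 * l - 1 / 2 ≠ 0 := by linarith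
      rw [mul_div_cancel₀ _ this]
    nlinarith
  linarith

theorem ish_global (m k c K κ : ℝ) (hκ : 0 < κ) (hK : 4 * K = 4 * κ ^ 2 + c ^ 2) :
    ∃ E q d B : ℝ → ℝ, IshProf m k c K κ E q d B := by
  obtain ⟨C0, hC0, hC⟩ := ish_C0 m k c K
  obtain ⟨R0, hR0, hloc⟩ := ish_local m k c K κ hκ hK
  set Rs := R0 / 2 with hRs
  have hRsp : 0 < Rs := by positivity
  set Λ := Real.exp (C0 / (2 * Rs) * (4 * C0)) with hΛ
  have hΛp : 0 < Λ := Real.exp_pos _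
  have hΛ1 : 1 ≤ Λ := by
    rw [hΛ]; exact Real.one_le_exp (by positivity)
  have hRk : 0 < R0 ^ κ := by positivity
  set a := min 1 ((18 * R0 ^ κ * Λ)⁻¹) with ha
  have hap : 0 < a := by rw [ha]; exact lt_min one_pos (by positivity)
  have ha2 : a * (18 * R0 ^ κ * Λ) ≤ 1 := by
    have : a ≤ (18 * R0 ^ κ * Λ)⁻¹ := min_le_right _ _
    calc _ ≤ (18 * R0 ^ κ * Λ)⁻¹ * (18 * R0 ^ κ * Λ) := by gcongr
      _ = 1 := inv_mul_cancel₀ (by positivity)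
  obtain ⟨El, ql, dl, hl⟩ := hloc a hap (min_le_left _ _)
  have hRsm : Rs ∈ Ioo 0 R0 := ⟨hRsp, by rw [hRs]; linarith⟩
  have hElb : ∀ R ∈ Ioo 0 R0, 9 * El R * Λ ≤ 3 / 2 := by
    intro R hR
    have h1 := (hl R hR).2.2.2.2.2.1
    have h2 : R ^ κ ≤ R0 ^ κ := Real.rpow_le_rpow hR.1.le hR.2.le hκ.le
    have h3 : El R ≤ 3 * a * R0 ^ κ := h1.trans (by gcongr)
    have h4 : El R * Λ ≤ 3 * a * R0 ^ κ * Λ := by gcongr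
    nlinarith
  have hElh : ∀ R ∈ Ioo 0 R0, El R ≤ 1 / 2 := by
    intro R hR
    have := hElb R hR
    have := (hl R hR).2.2.2.2.1
    nlinarith
  obtain ⟨E2, q2, d2, hE2, hq2, hd2, cE, cq, cd, hode⟩ :=
    ish_ext m k c K (C0 + 1) Rs (El Rs) (ql Rs) (dl Rs) hRsp (by linarith)
  have hinit := hl Rs hRsm
  have hW : ∀ R ≥ Rs, |E2 R| < C0 + 1 ∧ |q2 R| < C0 + 1 ∧ |d2 R| < C0 + 1 ∧ E2 R < 1 := by
    apply ish_cont_method (fun R => |E2 R| < C0 + 1 ∧ |q2 R| < C0 + 1 ∧ |d2 R| < C0 + 1 ∧ E2 R < 1)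
    intro b hb hW
    have hE1 : ∀ R ∈ Icc Rs b, E2 R ≤ 1 := by
      rcases eq_or_lt_of_le hb with h | h
      · subst h
        intro R hR
        have : R = Rs := le_antisymm hR.2 hR.1
        rw [this, hE2]
        linarith [hElh Rs hRsm]
      · rw [← closure_Ico h.ne]
        apply le_on_closure (fun R hR => (hW R hR).2.2.2.le) cE.continuousOn continuousOn_const
    have hb' := ish_apriori hRsp hb hC0 hC cE cq cd
      (fun R hR => (hode R hR.1 (hW R hR).1.le (hW R hR).2.1.le (hW R hR).2.2.1.le).1)
      (fun R hR => (hode R hR.1 (hW R hR).1.le (hW R hR).2.1.le (hW R hR).2.2.1.le).2.1)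
      (fun R hR => (hode R hR.1 (hW R hR).1.le (hW R hR).2.1.le (hW R hR).2.2.1.le).2.2)
      hE1 (by rw [hE2, hq2, hd2]; exact hinit.2.2.2.1) (by rw [hE2]; exact hinit.2.2.2.2.1)
      (by rw [hE2]; linarith [hElb Rs hRsm]) b ⟨hb, le_rfl⟩
    obtain ⟨-, p1, p2, p3, p4⟩ := hb'
    have e1 : |E2 b| < C0 + 1 := by rw [abs_of_pos p1]; linarith
    filter_upwards [cE.abs.continuousAt.eventually (gt_mem_nhds e1),
      cq.abs.continuousAt.eventually (gt_mem_nhds (by linarith : |q2 b| < C0 + 1)),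
      cd.abs.continuousAt.eventually (gt_mem_nhds (by linarith : |d2 b| < C0 + 1)),
      cE.continuousAt.eventually (gt_mem_nhds (by linarith : E2 b < 1))] with R u1 u2 u3 u4
    exact ⟨u1, u2, u3, u4⟩
  have hode' : ∀ R ≥ Rs, HasDerivAt E2 (E2 R * d2 R / (2 * R)) R ∧
      HasDerivAt q2 (d2 R * (R / 2 - q2 R) / (2 * R)) R ∧
      HasDerivAt d2 (ishP m k c K R (E2 R) (q2 R) / (2 * R)) R := fun R hR =>
    hode R hR (hW R hR).1.le (hW R hR).2.1.le (hW R hR).2.2.1.le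
  have hfin : ∀ R ≥ Rs, d2 R ^ 2 = ishQ m k c K (E2 R) (q2 R) ∧ 0 < E2 R ∧ E2 R ≤ 1 / 2 ∧
      |q2 R| ≤ C0 ∧ |d2 R| ≤ C0 := by
    intro R hR
    exact ish_apriori hRsp hR hC0 hC cE cq cd
      (fun x hx => (hode' x hx.1).1) (fun x hx => (hode' x hx.1).2.1)
      (fun x hx => (hode' x hx.1).2.2) (fun x hx => (hW x hx.1).2.2.2.le)
      (by rw [hE2, hq2, hd2]; exact hinit.2.2.2.1) (by rw [hE2]; exact hinit.2.2.2.2.1)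
      (by rw [hE2]; linarith [hElb Rs hRsm]) R ⟨hR, le_rfl⟩
  set E : ℝ → ℝ := fun R => if R ≤ Rs then El R else E2 R with hEdef
  set q : ℝ → ℝ := fun R => if R ≤ Rs then ql R else q2 R with hqdef
  set d : ℝ → ℝ := fun R => if R ≤ Rs then dl R else d2 R with hddef
  have hlt : ∀ R, R ≤ Rs → E R = El R ∧ q R = ql R ∧ d R = dl R := fun R hR =>
    ⟨if_pos hR, if_pos hR, if_pos hR⟩
  have hgt : ∀ R, Rs ≤ R → E R = E2 R ∧ q R = q2 R ∧ d R = d2 R := by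
    intro R hR
    rcases eq_or_lt_of_le hR with h | h
    · subst h; simp [hEdef, hqdef, hddef, hE2, hq2, hd2]
    · exact ⟨if_neg (not_le.2 h), if_neg (not_le.2 h), if_neg (not_le.2 h)⟩
  have hmem : ∀ R > 0, R ≤ Rs → R ∈ Ioo 0 R0 := fun R h h' => ⟨h, h'.trans_lt hRsm.2⟩
  have hE' : ∀ R > 0, HasDerivAt E (E R * d R / (2 * R)) R := by
    intro R hR
    apply ish_glue hE2.symm
    · intro h; rw [(hlt R h).1, (hlt R h).2.2]; exact (hl R (hmem R hR h)).1
    · intro h; rw [(hgt R h).1, (hgt R h).2.2]; exact (hode' R h).1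
  have hq' : ∀ R > 0, HasDerivAt q (d R * (R / 2 - q R) / (2 * R)) R := by
    intro R hR
    apply ish_glue hq2.symm
    · intro h; rw [(hlt R h).2.1, (hlt R h).2.2]; exact (hl R (hmem R hR h)).2.1
    · intro h; rw [(hgt R h).2.1, (hgt R h).2.2]; exact (hode' R h).2.1
  have hd' : ∀ R > 0, HasDerivAt d (ishP m k c K R (E R) (q R) / (2 * R)) R := by
    intro R hR
    apply ish_glue hd2.symm
    · intro h; rw [(hlt R h).1, (hlt R h).2.1]; exact (hl R (hmem R hR h)).2.2.1
    · intro h; rw [(hgt R h).1, (hgt R h).2.1]; exact (hode' R h).2.2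
  have hcons : ∀ R > 0, d R ^ 2 = ishQ m k c K (E R) (q R) := by
    intro R hR
    rcases le_total R Rs with h | h
    · rw [(hlt R h).1, (hlt R h).2.1, (hlt R h).2.2]; exact (hl R (hmem R hR h)).2.2.2.1
    · rw [(hgt R h).1, (hgt R h).2.1, (hgt R h).2.2]; exact (hfin R h).1
  have hpos : ∀ R > 0, 0 < E R := by
    intro R hR
    rcases le_total R Rs with h | h
    · rw [(hlt R h).1]; exact (hl R (hmem R hR h)).2.2.2.2.1
    · rw [(hgt R h).1]; exact (hfin R h).2.1
  have hhalf : ∀ R > 0, E R ≤ 1 / 2 := by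
    intro R hR
    rcases le_total R Rs with h | h
    · rw [(hlt R h).1]; exact hElh R (hmem R hR h)
    · rw [(hgt R h).1]; exact (hfin R h).2.2.1
  have hbd : ∀ R > 0, |q R| ≤ C0 ∧ |d R| ≤ C0 := fun R hR =>
    hC _ _ _ (hpos R hR).le (by linarith [hhalf R hR]) (hcons R hR)
  refine ⟨E, q, d, fun R => ∫ x in (1:ℝ)..R, (q x - c) / (2 * x * (2 - E x)),
    hE', hq', hd', ?_, hcons, hpos, hhalf, ⟨C0, hC0, hbd⟩, ?_,
    ish_lim hC0 hE' hq' hpos hhalf (fun R hR => (hbd R hR).1)⟩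
  · intro R hR
    have hco : ContinuousOn (fun x => (q x - c) / (2 * x * (2 - E x))) (Ioi 0) := by
      have c1 : ContinuousOn E (Ioi 0) := fun x hx => (hE' x hx).continuousAt.continuousWithinAt
      have c2 : ContinuousOn q (Ioi 0) := fun x hx => (hq' x hx).continuousAt.continuousWithinAt
      apply ContinuousOn.div (by fun_prop) (by fun_prop)
      intro x hx
      have := hhalf x hx
      have hx' : 0 < x := hx
      have : 0 < 2 - E x := by linarith
      positivity
    apply intervalIntegral.integral_hasDerivAt_right
    · apply ContinuousOn.intervalIntegrable
      apply hco.mono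
      intro x hx
      rw [mem_uIcc] at hx
      simp only [mem_Ioi]
      rcases hx with h | h <;> linarith [h.1]
    · exact hco.stronglyMeasurableAtFilter isOpen_Ioi _ hR
    · exact hco.continuousAt (Ioi_mem_nhds hR)
  · refine ⟨3 * a + Rs ^ (-κ), by positivity, ?_⟩
    intro R hR
    have hRκ : 0 < R ^ κ := by positivity
    have hRκ2 : 0 < Rs ^ (-κ) := by positivity
    rcases le_total R Rs with h | h
    · rw [(hlt R h).1]
      have := (hl R (hmem R hR h)).2.2.2.2.2.1
      nlinarith
    · have h1 := hhalf R hR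
      have h2 : Rs ^ κ ≤ R ^ κ := Real.rpow_le_rpow hRsp.le h hκ.le
      have h3 : Rs ^ (-κ) * Rs ^ κ = 1 := by
        rw [← Real.rpow_add hRsp]; simp
      have h4 : Rs ^ (-κ) * Rs ^ κ ≤ Rs ^ (-κ) * R ^ κ := by gcongr
      have : 0 < 3 * a * R ^ κ := by positivity
      nlinarith

theorem ish_contDiffOn_of_deriv {f g : ℝ → ℝ} {n : ℕ} (h : ∀ R > 0, HasDerivAt f (g R) R)
    (hg : ContDiffOn ℝ n g (Ioi 0)) : ContDiffOn ℝ (n + 1 : ℕ) f (Ioi 0) := by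
  push_cast
  rw [contDiffOn_succ_iff_deriv_of_isOpen isOpen_Ioi]
  refine ⟨fun x hx => (h x hx).differentiableAt.differentiableWithinAt, by simp, ?_⟩
  exact hg.congr fun x hx => (h x hx).deriv

theorem IshProf.smooth {m k c K κ : ℝ} {E q d B : ℝ → ℝ} (h : IshProf m k c K κ E q d B) :
    ContDiffOn ℝ (⊤ : ℕ∞) E (Ioi 0) ∧ ContDiffOn ℝ (⊤ : ℕ∞) q (Ioi 0) ∧
    ContDiffOn ℝ (⊤ : ℕ∞) d (Ioi 0) ∧ ContDiffOn ℝ (⊤ : ℕ∞) B (Ioi 0) := by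
  have key : ∀ n : ℕ, ContDiffOn ℝ n E (Ioi 0) ∧ ContDiffOn ℝ n q (Ioi 0) ∧
      ContDiffOn ℝ n d (Ioi 0) := by
    intro n
    induction n with
    | zero =>
      simp only [Nat.cast_zero, contDiffOn_zero]
      exact ⟨fun x hx => (h.hE x hx).continuousAt.continuousWithinAt,
        fun x hx => (h.hq x hx).continuousAt.continuousWithinAt,
        fun x hx => (h.hd x hx).continuousAt.continuousWithinAt⟩
    | succ n ih =>
      obtain ⟨i1, i2, i3⟩ := ih
      have hne : ∀ x ∈ Ioi (0:ℝ), 2 * x ≠ 0 := fun x hx => by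
        have : 0 < x := hx
        positivity
      refine ⟨ish_contDiffOn_of_deriv h.hE ?_, ish_contDiffOn_of_deriv h.hq ?_,
        ish_contDiffOn_of_deriv h.hd ?_⟩
      · exact ContDiffOn.div (by fun_prop) (by fun_prop) hne
      · exact ContDiffOn.div (by fun_prop) (by fun_prop) hne
      · unfold ishP
        exact ContDiffOn.div (by fun_prop) (by fun_prop) hne
  have kB : ∀ n : ℕ, ContDiffOn ℝ (n + 1 : ℕ) B (Ioi 0) := by
    intro n
    obtain ⟨i1, i2, i3⟩ := key n
    apply ish_contDiffOn_of_deriv h.hB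
    apply ContDiffOn.div (by fun_prop) (by fun_prop)
    intro x hx
    have h1 : 0 < x := hx
    have := h.half x hx
    have : 0 < 2 - E x := by linarith
    positivity
  refine ⟨contDiffOn_infty.2 fun n => (key n).1, contDiffOn_infty.2 fun n => (key n).2.1,
    contDiffOn_infty.2 fun n => (key n).2.2, contDiffOn_infty.2 fun n => ?_⟩
  exact (kB n).of_le (by exact_mod_cast Nat.le_succ n)

noncomputable def ishS (E : ℝ → ℝ) (r : ℝ) : ℝ := Real.arccos (1 - E (r ^ 2))

section
variable {m k c K κ : ℝ} {E q d B : ℝ → ℝ}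

theorem IshProf.cos (h : IshProf m k c K κ E q d B) {r : ℝ} (hr : 0 < r) :
    Real.cos (ishS E r) = 1 - E (r ^ 2) := by
  have h1 := h.pos (r ^ 2) (by positivity)
  have h2 := h.half (r ^ 2) (by positivity)
  exact Real.cos_arccos (by linarith) (by linarith)

theorem IshProf.sin (h : IshProf m k c K κ E q d B) {r : ℝ} (hr : 0 < r) :
    Real.sin (ishS E r) = √(E (r ^ 2) * (2 - E (r ^ 2))) := by
  unfold ishS
  rw [Real.sin_arccos]
  congr 1; ring

theorem IshProf.s_smooth (h : IshProf m k c K κ E q d B) :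
    ContDiffOn ℝ (⊤ : ℕ∞) (ishS E) (Ioi 0) := by
  intro r hr
  have hr' : 0 < r := hr
  have h1 := h.pos (r ^ 2) (by positivity)
  have h2 := h.half (r ^ 2) (by positivity)
  apply ContDiffAt.contDiffWithinAt
  unfold ishS
  have hE : ContDiffAt ℝ (⊤ : ℕ∞) E (r ^ 2) :=
    h.smooth.1.contDiffAt (Ioi_mem_nhds (by positivity))
  have : ContDiffAt ℝ (⊤ : ℕ∞) Real.arccos (1 - E (r ^ 2)) :=
    Real.contDiffAt_arccos (by linarith) (by linarith)
  exact this.comp (f := fun r => 1 - E (r ^ 2)) r (contDiffAt_const.sub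
    (ContDiffAt.comp (f := fun r : ℝ => r ^ 2) r hE (contDiffAt_id.pow 2)))

theorem IshProf.B_smooth (h : IshProf m k c K κ E q d B) (σ : ℝ) :
    ContDiffOn ℝ (⊤ : ℕ∞) (fun r => σ * B (r ^ 2)) (Ioi 0) := by
  intro r hr
  have hr' : 0 < r := hr
  apply ContDiffAt.contDiffWithinAt
  have hE : ContDiffAt ℝ (⊤ : ℕ∞) B (r ^ 2) :=
    h.smooth.2.2.2.contDiffAt (Ioi_mem_nhds (by positivity))
  exact contDiffAt_const.mul (ContDiffAt.comp (f := fun r : ℝ => r ^ 2) r hE (contDiffAt_id.pow 2))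

theorem IshProf.s_pos (h : IshProf m k c K κ E q d B) {r : ℝ} (hr : 0 < r) : 0 < ishS E r := by
  have h1 := h.pos (r ^ 2) (by positivity)
  exact Real.arccos_pos.2 (by linarith)

theorem IshProf.s_bound (h : IshProf m k c K κ E q d B) :
    ∃ C : ℝ, 0 < C ∧ ∀ r > 0, ‖ishS E r‖ ≤ C * r ^ κ := by
  obtain ⟨A, hA, hb⟩ := h.decay
  refine ⟨Real.pi / 2 * √(2 * A), by positivity, ?_⟩
  intro r hr
  have h1 := h.pos (r ^ 2) (by positivity)
  have h2 := h.half (r ^ 2) (by positivity)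
  have hp := h.s_pos hr
  rw [Real.norm_of_nonneg hp.le]
  have hle : ishS E r ≤ Real.pi / 2 := Real.arccos_le_pi_div_two.2 (by linarith)
  have h3 := Real.mul_le_sin hp.le hle
  rw [h.sin hr] at h3
  have h4 : √(E (r ^ 2) * (2 - E (r ^ 2))) ≤ √(2 * A) * r ^ κ := by
    have h5 := hb (r ^ 2) (by positivity)
    have h6 : (r ^ 2 : ℝ) ^ κ = (r ^ κ) ^ 2 := by
      rw [← Real.rpow_natCast, ← Real.rpow_natCast, ← Real.rpow_mul hr.le, ← Real.rpow_mul hr.le,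
        mul_comm]
    rw [h6] at h5
    have h7 : √(2 * A) * r ^ κ = √(2 * A * (r ^ κ) ^ 2) := by
      rw [Real.sqrt_mul (by positivity) ((r ^ κ) ^ 2), Real.sqrt_sq (by positivity)]
    rw [h7]
    apply Real.sqrt_le_sqrt
    nlinarith
  have hpi := Real.pi_pos
  calc ishS E r = Real.pi / 2 * (2 / Real.pi * ishS E r) := by field_simp
    _ ≤ Real.pi / 2 * (√(2 * A) * r ^ κ) := mul_le_mul_of_nonneg_left (h3.trans h4) (by positivity)
    _ = _ := by ring

theorem IshProf.s_bigO (h : IshProf m k c K κ E q d B) :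
    ishS E =O[nhdsWithin 0 (Ioi 0)] (fun r : ℝ => r ^ κ) := by
  obtain ⟨C, hC, hb⟩ := h.s_bound
  apply IsBigO.of_bound C
  filter_upwards [self_mem_nhdsWithin] with r hr
  have hr' : 0 < r := hr
  rw [Real.norm_of_nonneg (by positivity : 0 ≤ r ^ κ)]
  exact hb r hr

theorem IshProf.s_tendsto (h : IshProf m k c K κ E q d B) (hκ : 0 < κ) :
    Tendsto (ishS E) (nhdsWithin 0 (Ioi 0)) (nhds 0) := by
  have : Tendsto (fun r : ℝ => r ^ κ) (nhdsWithin 0 (Ioi 0)) (nhds 0) := by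
    have := (Real.continuous_rpow_const hκ.le).tendsto 0
    rw [Real.zero_rpow hκ.ne'] at this
    exact this.mono_left nhdsWithin_le_nhds
  exact h.s_bigO.trans_tendsto this

theorem IshProf.s_infty (h : IshProf m k c K κ E q d B) : ∃ sstar > (0:ℝ),
    Tendsto (ishS E) atTop (nhds sstar) ∧
    (fun r => ishS E r - sstar) =O[atTop] (fun r : ℝ => (r ^ 2)⁻¹) ∧
    (deriv (ishS E)) =O[atTop] (fun r : ℝ => r⁻¹) := by
  obtain ⟨l, C, R1, hl, hl2, hR1, hb⟩ := h.lim
  have hsq : Tendsto (fun r : ℝ => r ^ 2) atTop atTop := tendsto_pow_atTop (by norm_num)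
  have hO : (fun r : ℝ => E (r ^ 2) - l) =O[atTop] (fun r : ℝ => (r ^ 2)⁻¹) := by
    apply IsBigO.of_bound C
    filter_upwards [hsq.eventually_ge_atTop R1] with r hr
    have := hb _ hr
    rw [norm_inv, Real.norm_of_nonneg (sq_nonneg r), Real.norm_eq_abs]
    rwa [← div_eq_mul_inv]
  have h0 : Tendsto (fun r : ℝ => (r ^ 2)⁻¹) atTop (nhds 0) := tendsto_inv_atTop_zero.comp hsq
  have hT : Tendsto (fun r : ℝ => 1 - E (r ^ 2)) atTop (nhds (1 - l)) := by
    have := hO.trans_tendsto h0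
    have := (this.const_sub (1 - l))
    simpa using this
  have hdif : DifferentiableAt ℝ Real.arccos (1 - l) :=
    (Real.hasDerivAt_arccos (by linarith) (by linarith)).differentiableAt
  refine ⟨Real.arccos (1 - l), Real.arccos_pos.2 (by linarith),
    hdif.continuousAt.tendsto.comp hT, ?_, ?_⟩
  · have := (hdif.isBigO_sub).comp_tendsto hT
    refine this.trans ?_
    refine IsBigO.trans ?_ hO
    apply IsBigO.of_bound 1
    filter_upwards with r
    simp only [Function.comp, Real.norm_eq_abs, one_mul]
    rw [show 1 - E (r ^ 2) - (1 - l) = -(E (r ^ 2) - l) by ring, abs_neg]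
  · obtain ⟨C, hC1, hC⟩ := h.bdd
    apply IsBigO.of_bound C
    filter_upwards [eventually_gt_atTop 0] with r hr
    have hr2 : 0 < r ^ 2 := by positivity
    have h1 := h.pos (r ^ 2) (by positivity)
    have h2 := h.half (r ^ 2) (by positivity)
    have hd1 : HasDerivAt (fun r => 1 - E (r ^ 2))
        (-(E (r ^ 2) * d (r ^ 2) / (2 * r ^ 2) * (2 * r))) r := by
      have := HasDerivAt.comp (h := fun r : ℝ => r ^ 2) r (h.hE (r ^ 2) hr2) (hasDerivAt_pow 2 r)
      refine (this.const_sub 1).congr_deriv ?_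
      simp
    have hd2 := (Real.hasDerivAt_arccos (x := 1 - E (r ^ 2)) (by linarith)
      (by linarith)).comp r hd1
    have hd3 : deriv (ishS E) r = _ := hd2.deriv
    rw [hd3]
    have hs : √(1 - (1 - E (r ^ 2)) ^ 2) ≥ E (r ^ 2) := by
      apply Real.le_sqrt_of_sq_le
      nlinarith
    have hs0 : 0 < √(1 - (1 - E (r ^ 2)) ^ 2) := lt_of_lt_of_le h1 hs
    have hdd := (hC (r ^ 2) hr2).2
    have e : -(1 / √(1 - (1 - E (r ^ 2)) ^ 2)) *
        -(E (r ^ 2) * d (r ^ 2) / (2 * r ^ 2) * (2 * r))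
        = (E (r ^ 2) / √(1 - (1 - E (r ^ 2)) ^ 2)) * (d (r ^ 2) * r⁻¹) := by
      field_simp
    rw [e, norm_mul, norm_mul, ← mul_assoc]
    gcongr
    rw [Real.norm_of_nonneg (by positivity), Real.norm_eq_abs]
    have : E (r ^ 2) / √(1 - (1 - E (r ^ 2)) ^ 2) ≤ 1 := by
      rw [div_le_one hs0]; exact hs
    calc _ ≤ 1 * |d (r ^ 2)| := by gcongr
      _ ≤ C := by linarith

theorem IshProf.decay' (h : IshProf m k c K κ E q d B) {δ : ℝ} (hδ : 0 < δ) (hδκ : δ ≤ κ) :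
    ∃ A : ℝ, 0 < A ∧ ∀ R > 0, E R ≤ A * R ^ δ := by
  obtain ⟨A, hA, hb⟩ := h.decay
  refine ⟨A + 1, by linarith, fun R hR => ?_⟩
  have hp : 0 < R ^ δ := by positivity
  rcases le_total R 1 with h1 | h1
  · have h2 : R ^ κ ≤ R ^ δ := Real.rpow_le_rpow_of_exponent_ge hR h1 hδκ
    have h3 := hb R hR
    nlinarith
  · have h2 : 1 ≤ R ^ δ := Real.one_le_rpow h1 hδ.le
    have := h.half R hR
    nlinarith

noncomputable def ishG (k : ℝ) (E : ℝ → ℝ) (R : ℝ) : ℝ :=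
  ∫ r' in (0:ℝ)..√R, 2 * k / r' * (1 - Real.cos (ishS E r'))

theorem IshProf.G_bound0 (h : IshProf m k c K κ E q d B) {A δ : ℝ}
    (hA : ∀ R > 0, E R ≤ A * R ^ δ) {r : ℝ} (hr : 0 < r) :
    ‖2 * k / r * (1 - Real.cos (ishS E r))‖ ≤ 2 * |k| * A * r ^ (2 * δ - 1) := by
  rw [h.cos hr, norm_mul, norm_div, norm_mul, Real.norm_of_nonneg hr.le]
  have h1 := h.pos (r ^ 2) (by positivity)
  have h2 := hA (r ^ 2) (by positivity)
  have e : (1:ℝ) - (1 - E (r ^ 2)) = E (r ^ 2) := by ring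
  rw [e, Real.norm_of_nonneg h1.le, Real.norm_eq_abs, Real.norm_eq_abs, abs_two]
  have e2 : (r ^ 2 : ℝ) ^ δ = r ^ (2 * δ - 1) * r := by
    rw [← Real.rpow_natCast, ← Real.rpow_mul hr.le, Real.rpow_sub_one hr.ne']
    push_cast
    field_simp
  rw [e2] at h2
  calc 2 * |k| / r * E (r ^ 2) ≤ 2 * |k| / r * (A * (r ^ (2 * δ - 1) * r)) := by gcongr
    _ = _ := by field_simp

theorem IshProf.G_meas (h : IshProf m k c K κ E q d B) :
    ContinuousOn (fun r => 2 * k / r * (1 - Real.cos (ishS E r))) (Ioi 0) := by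
  apply ContinuousOn.mul
  · exact ContinuousOn.div (by fun_prop) (by fun_prop) (fun x hx => ne_of_gt hx)
  · have := h.s_smooth.continuousOn
    fun_prop

theorem IshProf.G_int (h : IshProf m k c K κ E q d B) (hκ : 0 < κ) {r : ℝ} (hr : 0 < r) :
    IntervalIntegrable (fun r => 2 * k / r * (1 - Real.cos (ishS E r))) volume 0 r := by
  obtain ⟨A, hA, hb⟩ := h.decay
  have hI : IntervalIntegrable (fun r : ℝ => 2 * |k| * A * r ^ (2 * κ - 1)) volume 0 r :=
    (intervalIntegral.intervalIntegrable_rpow' (by linarith)).const_mul _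
  rw [intervalIntegrable_iff_integrableOn_Ioc_of_le hr.le] at hI ⊢
  refine Integrable.mono' hI ?_ ?_
  · apply ContinuousOn.aestronglyMeasurable _ measurableSet_Ioc
    exact h.G_meas.mono fun x hx => hx.1
  · filter_upwards [ae_restrict_mem measurableSet_Ioc] with x hx
    exact h.G_bound0 hb hx.1

theorem IshProf.G_bound (h : IshProf m k c K κ E q d B) {δ : ℝ} (hδ : 0 < δ)
    (hδκ : δ ≤ κ) : ∃ A : ℝ, 0 < A ∧ ∀ R > 0, |ishG k E R| ≤ A * R ^ δ := by
  obtain ⟨A, hA, hb⟩ := h.decay' hδ hδκ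
  refine ⟨2 * |k| * A / (2 * δ) + 1, by positivity, fun R hR => ?_⟩
  have hs : 0 < √R := Real.sqrt_pos.2 hR
  have h1 : ‖ishG k E R‖ ≤ ∫ r in (0:ℝ)..√R, 2 * |k| * A * r ^ (2 * δ - 1) := by
    apply intervalIntegral.norm_integral_le_of_norm_le hs.le
    · filter_upwards with r hr
      exact h.G_bound0 hb hr.1
    · exact (intervalIntegral.intervalIntegrable_rpow' (by linarith)).const_mul _
  rw [intervalIntegral.integral_const_mul, integral_rpow (Or.inl (by linarith)), sub_add_cancel,
    Real.zero_rpow (by positivity), sub_zero] at h1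
  have e : √R ^ (2 * δ) = R ^ δ := by
    rw [Real.sqrt_eq_rpow, ← Real.rpow_mul hR.le]
    congr 1; ring
  rw [e] at h1
  have hp : 0 < R ^ δ := by positivity
  calc _ ≤ _ := h1
    _ = 2 * |k| * A / (2 * δ) * R ^ δ := by ring
    _ ≤ _ := by nlinarith

theorem IshProf.G_der (h : IshProf m k c K κ E q d B) (hκ : 0 < κ) {R : ℝ} (hR : 0 < R) :
    HasDerivAt (ishG k E) (k * E R / R) R := by
  have hs : 0 < √R := Real.sqrt_pos.2 hR
  have h1 : HasDerivAt (fun s => ∫ r' in (0:ℝ)..s, 2 * k / r' * (1 - Real.cos (ishS E r')))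
      (2 * k / √R * (1 - Real.cos (ishS E √R))) (√R) := by
    apply intervalIntegral.integral_hasDerivAt_right (h.G_int hκ hs)
    · exact h.G_meas.stronglyMeasurableAtFilter isOpen_Ioi _ hs
    · exact h.G_meas.continuousAt (Ioi_mem_nhds hs)
  refine (h1.comp R (Real.hasDerivAt_sqrt hR.ne')).congr_deriv ?_
  rw [h.cos hs, Real.sq_sqrt hR.le]
  field_simp
  rw [Real.sq_sqrt hR.le]
  ring

theorem IshProf.G_smooth (h : IshProf m k c K κ E q d B) (hκ : 0 < κ) :
    ContDiffOn ℝ (⊤ : ℕ∞) (ishG k E) (Ioi 0) := by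
  rw [contDiffOn_infty]
  intro n
  refine (ish_contDiffOn_of_deriv (n := n) (fun R hR => h.G_der hκ hR) ?_).of_le
    (by exact_mod_cast Nat.le_succ n)
  have := (contDiffOn_infty.1 h.smooth.1 n)
  exact ContDiffOn.div (by fun_prop) (by fun_prop) (fun x hx => ne_of_gt hx)
end

section
variable {F : Type*} [NormedAddCommGroup F] [NormedSpace ℝ F]

/-- directional derivative with general target. -/
noncomputable def ishd (v : ℝ × ℝ × ℝ) (f : ℝ × ℝ × ℝ → F) (p : ℝ × ℝ × ℝ) : F := fderiv ℝ f p v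

theorem ishd_smooth {v : ℝ × ℝ × ℝ} {f : ℝ × ℝ × ℝ → F} {p : ℝ × ℝ × ℝ}
    (h : ContDiffAt ℝ (⊤ : ℕ∞) f p) : ContDiffAt ℝ (⊤ : ℕ∞) (ishd v f) p := by
  have h1 : ContDiffAt ℝ (⊤ : ℕ∞) (fderiv ℝ f) p := h.fderiv_right (by norm_cast)
  exact h1.clm_apply contDiffAt_const

theorem ish_diffAt {f : ℝ × ℝ × ℝ → F} {p : ℝ × ℝ × ℝ}
    (h : ContDiffAt ℝ (⊤ : ℕ∞) f p) : DifferentiableAt ℝ f p := h.differentiableAt (by simp)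

theorem ishd_y {f : ℝ × ℝ × ℝ → F} {t ξ η : ℝ} (h : ContDiffAt ℝ (⊤ : ℕ∞) f (t, ξ, η)) :
    HasDerivAt (fun z => f (t, ξ, z)) (ishd ey f (t, ξ, η)) η := by
  have h1 : HasDerivAt (fun z : ℝ => ((t, ξ, z) : ℝ × ℝ × ℝ)) ey η := by
    have := (hasDerivAt_const η t).prodMk ((hasDerivAt_const η ξ).prodMk (hasDerivAt_id η))
    exact this
  exact (ish_diffAt h).hasFDerivAt.comp_hasDerivAt η h1

theorem ishd_x {f : ℝ × ℝ × ℝ → F} {t ξ η : ℝ} (h : ContDiffAt ℝ (⊤ : ℕ∞) f (t, ξ, η)) :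
    HasDerivAt (fun z => f (t, z, η)) (ishd ex f (t, ξ, η)) ξ := by
  have h1 : HasDerivAt (fun z : ℝ => ((t, z, η) : ℝ × ℝ × ℝ)) ex ξ := by
    have := (hasDerivAt_const ξ t).prodMk ((hasDerivAt_id ξ).prodMk (hasDerivAt_const ξ η))
    exact this
  exact (ish_diffAt h).hasFDerivAt.comp_hasDerivAt ξ h1

theorem ishd_t {f : ℝ × ℝ × ℝ → F} {t ξ η : ℝ} (h : ContDiffAt ℝ (⊤ : ℕ∞) f (t, ξ, η)) :
    HasDerivAt (fun z => f (z, ξ, η)) (ishd et f (t, ξ, η)) t := by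
  have h1 : HasDerivAt (fun z : ℝ => ((z, ξ, η) : ℝ × ℝ × ℝ)) et t := by
    have := (hasDerivAt_id t).prodMk ((hasDerivAt_const t ξ).prodMk (hasDerivAt_const t η))
    exact this
  exact (ish_diffAt h).hasFDerivAt.comp_hasDerivAt t h1

theorem ishd_symm {v w : ℝ × ℝ × ℝ} {f : ℝ × ℝ × ℝ → F} {p : ℝ × ℝ × ℝ}
    (h : ContDiffAt ℝ (⊤ : ℕ∞) f p) : ishd v (ishd w f) p = ishd w (ishd v f) p := by
  have h1 : ContDiffAt ℝ (⊤ : ℕ∞) (fderiv ℝ f) p := h.fderiv_right (by norm_cast)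
  have h2 : DifferentiableAt ℝ (fderiv ℝ f) p := h1.differentiableAt (by simp)
  have key : ∀ v w, ishd v (ishd w f) p = fderiv ℝ (fderiv ℝ f) p v w := by
    intro v w
    have : HasFDerivAt (ishd w f) _ p := h2.hasFDerivAt.clm_apply (hasFDerivAt_const w p)
    unfold ishd at this ⊢
    rw [this.fderiv]
    simp
  rw [key, key]
  have hs : IsSymmSndFDerivAt ℝ f p := h.isSymmSndFDerivAt (by rw [minSmoothness_of_isRCLikeNormedField]; exact (WithTop.coe_le_coe (b := (2:ℕ∞)) (a := (⊤:ℕ∞))).2 le_top)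
  exact hs v w

theorem ishd_add {v : ℝ × ℝ × ℝ} {f g : ℝ × ℝ × ℝ → F} {p : ℝ × ℝ × ℝ}
    (h : ContDiffAt ℝ (⊤ : ℕ∞) f p) (h' : ContDiffAt ℝ (⊤ : ℕ∞) g p) :
    ishd v (fun p => f p + g p) p = ishd v f p + ishd v g p := by
  unfold ishd
  rw [fderiv_fun_add (ish_diffAt h) (ish_diffAt h')]; rfl

theorem ishd_sub {v : ℝ × ℝ × ℝ} {f g : ℝ × ℝ × ℝ → F} {p : ℝ × ℝ × ℝ}
    (h : ContDiffAt ℝ (⊤ : ℕ∞) f p) (h' : ContDiffAt ℝ (⊤ : ℕ∞) g p) :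
    ishd v (fun p => f p - g p) p = ishd v f p - ishd v g p := by
  unfold ishd
  rw [fderiv_fun_sub (ish_diffAt h) (ish_diffAt h')]; rfl

theorem ishd_congr {v : ℝ × ℝ × ℝ} {f g : ℝ × ℝ × ℝ → F} {p : ℝ × ℝ × ℝ}
    (h : f =ᶠ[nhds p] g) : ishd v f p = ishd v g p := by
  unfold ishd; rw [h.fderiv_eq]

/-- null coordinates `(t,x,y) ↦ (t,x+y,x-y)`. -/
noncomputable def ishN : (ℝ × ℝ × ℝ) ≃L[ℝ] (ℝ × ℝ × ℝ) :=
  LinearEquiv.toContinuousLinearEquiv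
  { toFun := fun p => (p.1, p.2.1 + p.2.2, p.2.1 - p.2.2)
    invFun := fun p => (p.1, (p.2.1 + p.2.2) / 2, (p.2.1 - p.2.2) / 2)
    map_add' := by intro x y; ext <;> simp <;> ring
    map_smul' := by intro a x; ext <;> simp <;> ring
    left_inv := by intro x; ext <;> simp
    right_inv := by intro x; ext <;> simp <;> ring }

theorem ishN_apply (t x y : ℝ) : ishN (t, x, y) = (t, x + y, x - y) := rfl
theorem ishN_apply' (p : ℝ × ℝ × ℝ) : ishN p = (p.1, p.2.1 + p.2.2, p.2.1 - p.2.2) := rfl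
theorem ishN_symm_apply (p : ℝ × ℝ × ℝ) :
    ishN.symm p = (p.1, (p.2.1 + p.2.2) / 2, (p.2.1 - p.2.2) / 2) := rfl

theorem ishd_N (v : ℝ × ℝ × ℝ) (f : ℝ × ℝ × ℝ → F) (p : ℝ × ℝ × ℝ) :
    ishd v (fun p => f (ishN p)) p = ishd (ishN v) f (ishN p) := by
  unfold ishd
  have := ishN.comp_right_fderiv (f := f) (x := p)
  have h2 : fderiv ℝ (fun p => f (ishN p)) p = _ := this
  rw [h2]; rfl

theorem ishd_lin (f : ℝ × ℝ × ℝ → F) (p : ℝ × ℝ × ℝ) (v w : ℝ × ℝ × ℝ) :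
    ishd (v + w) f p = ishd v f p + ishd w f p := by
  unfold ishd; simp

theorem ishd_lin' (f : ℝ × ℝ × ℝ → F) (p : ℝ × ℝ × ℝ) (v w : ℝ × ℝ × ℝ) :
    ishd (v - w) f p = ishd v f p - ishd w f p := by
  unfold ishd; simp

theorem ishd_Nx (f : ℝ × ℝ × ℝ → F) : ishd ex (fun p => f (ishN p)) =
    fun p => ishd ex f (ishN p) + ishd ey f (ishN p) := by
  funext p
  rw [ishd_N, ← ishd_lin]
  congr 1
  simp [ishN_apply', ex, ey]

theorem ishd_Ny (f : ℝ × ℝ × ℝ → F) : ishd ey (fun p => f (ishN p)) =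
    fun p => ishd ex f (ishN p) - ishd ey f (ishN p) := by
  funext p
  rw [ishd_N, ← ishd_lin']
  congr 1
  simp [ishN_apply', ex, ey]

theorem ishd_Nt (f : ℝ × ℝ × ℝ → F) : ishd et (fun p => f (ishN p)) =
    fun p => ishd et f (ishN p) := by
  funext p
  rw [ishd_N]
  congr 1
  simp [ishN_apply', et]

theorem ishd_box {f : ℝ × ℝ × ℝ → F} {p : ℝ × ℝ × ℝ} (h : ContDiffAt ℝ (⊤ : ℕ∞) f (ishN p)) :
    ishd ex (ishd ex (fun p => f (ishN p))) p - ishd ey (ishd ey (fun p => f (ishN p))) p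
      = (4:ℝ) • ishd ey (ishd ex f) (ishN p) := by
  rw [ishd_Nx, ishd_Ny,
    ishd_N ex (fun p => ishd ex f p + ishd ey f p) p,
    ishd_N ey (fun p => ishd ex f p - ishd ey f p) p,
    ishd_add (ishd_smooth h) (ishd_smooth h), ishd_sub (ishd_smooth h) (ishd_smooth h)]
  have e1 : ishN ex = ex + ey := by simp [ishN_apply', ex, ey]
  have e2 : ishN ey = ex - ey := by simp [ishN_apply', ex, ey]
  rw [e1, e2, ishd_lin, ishd_lin, ishd_lin', ishd_lin', ishd_symm (v := ex) (w := ey) h]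
  module
end

noncomputable def ishvec (x p w θ : ℝ) : Fin 3 → ℝ :=
  ![x, p * Real.cos θ - w * Real.sin θ, p * Real.sin θ + w * Real.cos θ]

theorem ishvec_der {X p w θ : ℝ → ℝ} {X' p' w' θ' z : ℝ} (h1 : HasDerivAt X X' z)
    (h2 : HasDerivAt p p' z) (h3 : HasDerivAt w w' z) (h4 : HasDerivAt θ θ' z) :
    HasDerivAt (fun z => ishvec (X z) (p z) (w z) (θ z))
      (ishvec X' (p' - w z * θ') (w' + p z * θ') (θ z)) z := by
  rw [hasDerivAt_pi]
  intro i
  fin_cases i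
  · simpa [ishvec] using h1
  · simp only [ishvec]
    refine ((h2.mul h4.cos).sub (h3.mul h4.sin)).congr_deriv ?_
    simp; ring
  · simp only [ishvec]
    refine ((h2.mul h4.sin).add (h3.mul h4.cos)).congr_deriv ?_
    simp; ring

theorem ishvec_cross (x p w y p2 w2 θ : ℝ) : cross3 (ishvec x p w θ) (ishvec y p2 w2 θ) =
    ishvec (p * w2 - w * p2) (w * y - x * w2) (x * p2 - p * y) θ := by
  have h := Real.sin_sq_add_cos_sq θ
  funext i
  fin_cases i
  · simp [ishvec, cross3]
    linear_combination (p * w2 - w * p2) * h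
  · simp [ishvec, cross3]; ring
  · simp [ishvec, cross3]; ring

theorem ishvec_dot (x p w y p2 w2 θ : ℝ) : dot3 (ishvec x p w θ) (ishvec y p2 w2 θ) =
    x * y + p * p2 + w * w2 := by
  have h := Real.sin_sq_add_cos_sq θ
  simp [ishvec, dot3]
  linear_combination (p * p2 + w * w2) * h

theorem ishvec_smul (a x p w θ : ℝ) : a • ishvec x p w θ = ishvec (a * x) (a * p) (a * w) θ := by
  funext i
  fin_cases i <;> simp [ishvec] <;> ring

theorem ishvec_add (x p w y p2 w2 θ : ℝ) : ishvec x p w θ + ishvec y p2 w2 θ =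
    ishvec (x + y) (p + p2) (w + w2) θ := by
  funext i
  fin_cases i <;> simp [ishvec] <;> ring

theorem ishvec_sub (x p w y p2 w2 θ : ℝ) : ishvec x p w θ - ishvec y p2 w2 θ =
    ishvec (x - y) (p - p2) (w - w2) θ := by
  funext i
  fin_cases i <;> simp [ishvec] <;> ring

theorem ishvec_norm (x p w θ : ℝ) (i : Fin 3) : |ishvec x p w θ i| ≤ |x| + |p| + |w| := by
  have hc := Real.abs_cos_le_one θ
  have hs := Real.abs_sin_le_one θ
  have h1 := abs_nonneg x
  have h2 := abs_nonneg p
  have h3 := abs_nonneg w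
  fin_cases i
  · simp [ishvec]; linarith
  · simp [ishvec]
    refine (abs_sub _ _).trans ?_
    rw [abs_mul, abs_mul]
    nlinarith
  · simp [ishvec]
    refine (abs_add_le _ _).trans ?_
    rw [abs_mul, abs_mul]
    nlinarith

noncomputable def ishRad (σ : ℝ) (p : ℝ × ℝ × ℝ) : ℝ := σ * p.2.1 * p.2.2 / p.1
noncomputable def ishSq (E : ℝ → ℝ) (R : ℝ) : ℝ := √(E R * (2 - E R))
noncomputable def ishTh (σ μ k : ℝ) (B : ℝ → ℝ) (p : ℝ × ℝ × ℝ) : ℝ :=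
  σ * B (ishRad σ p) + k / 2 * (Real.log p.2.1 - Real.log p.2.2) + μ * Real.log p.1
noncomputable def ishU (σ μ k : ℝ) (E B : ℝ → ℝ) (p : ℝ × ℝ × ℝ) : Fin 3 → ℝ :=
  ishvec (1 - E (ishRad σ p)) (ishSq E (ishRad σ p)) 0 (ishTh σ μ k B p)
noncomputable def ishGn (σ k : ℝ) (E : ℝ → ℝ) (p : ℝ × ℝ × ℝ) : ℝ := ishG k E (ishRad σ p)
noncomputable def ishPhi (σ k c b : ℝ) (E : ℝ → ℝ) (p : ℝ × ℝ × ℝ) : ℝ :=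
  c / 2 * (Real.log p.2.1 - Real.log p.2.2)
    + b / 2 * (Real.log p.2.1 + Real.log p.2.2 - Real.log p.1) - ishGn σ k E p
def ishV (σ : ℝ) : Set (ℝ × ℝ × ℝ) := {p | 0 < p.1 ∧ 0 < σ * p.2.1 * p.2.2}

theorem ishV_open (σ : ℝ) : IsOpen (ishV σ) := by
  have h1 : Continuous (fun p : ℝ × ℝ × ℝ => σ * p.2.1 * p.2.2) := by fun_prop
  exact (isOpen_lt continuous_const continuous_fst).inter (isOpen_lt continuous_const h1)

noncomputable def ishcA (E d : ℝ → ℝ) (R : ℝ) : ℝ := (1 - E R) * d R / (2 * (2 - E R))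
noncomputable def ishcB (c : ℝ) (E q : ℝ → ℝ) (R : ℝ) : ℝ := (q R - c) / (2 * (2 - E R))
noncomputable def ishDA (m k c K : ℝ) (E q d : ℝ → ℝ) (R : ℝ) : ℝ :=
  (-(E R * d R / 2) * d R + (1 - E R) * (ishP m k c K R (E R) (q R) / 2)) / (2 * (2 - E R))
    + (1 - E R) * d R * (E R * d R / 2) / (2 * (2 - E R) ^ 2)
noncomputable def ishDB (c : ℝ) (E q d : ℝ → ℝ) (R : ℝ) : ℝ :=
  (d R * (R / 2 - q R) / 2) / (2 * (2 - E R)) + (q R - c) * (E R * d R / 2) / (2 * (2 - E R) ^ 2)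

section
variable {m k c K κ : ℝ} {E q d B : ℝ → ℝ} (h : IshProf m k c K κ E q d B)
include h

theorem IshProf.two (R : ℝ) (hR : 0 < R) : 0 < 2 - E R := by linarith [h.half R hR]

theorem IshProf.Ssq (R : ℝ) (hR : 0 < R) : ishSq E R ^ 2 = E R * (2 - E R) :=
  Real.sq_sqrt (mul_nonneg (h.pos R hR).le (h.two R hR).le)

theorem IshProf.Spos (R : ℝ) (hR : 0 < R) : 0 < ishSq E R :=
  Real.sqrt_pos.2 (mul_pos (h.pos R hR) (h.two R hR))

theorem IshProf.dE (R : ℝ) (hR : 0 < R) : HasDerivAt E ((E R * d R / 2) / R) R :=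
  (h.hE R hR).congr_deriv (by field_simp)

theorem IshProf.dB (R : ℝ) (hR : 0 < R) : HasDerivAt B (ishcB c E q R / R) R :=
  (h.hB R hR).congr_deriv (by
    have := h.two R hR
    unfold ishcB; field_simp)

theorem IshProf.dS (R : ℝ) (hR : 0 < R) :
    HasDerivAt (ishSq E) ((ishSq E R * ishcA E d R) / R) R := by
  have h2 := h.two R hR
  have hE := h.dE R hR
  have hs := h.Spos R hR
  have hsq := h.Ssq R hR
  have hp := h.pos R hR
  have := (hE.mul (hE.const_sub 2)).sqrt (mul_pos (h.pos R hR) h2).ne'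
  refine this.congr_deriv ?_
  have e : √((E * fun x => 2 - E x) R) = ishSq E R := rfl
  rw [e]
  unfold ishcA
  field_simp
  rw [hsq]
  ring

theorem IshProf.dcA (R : ℝ) (hR : 0 < R) :
    HasDerivAt (ishcA E d) (ishDA m k c K E q d R / R) R := by
  have h2 := h.two R hR
  have hE := h.dE R hR
  have := ((hE.const_sub 1).mul (h.hd R hR)).div ((hE.const_sub 2).const_mul 2)
    (by positivity)
  refine this.congr_deriv ?_
  simp only [Pi.mul_apply, ishDA]
  field_simp
  ring

theorem IshProf.dcB (R : ℝ) (hR : 0 < R) :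
    HasDerivAt (ishcB c E q) (ishDB c E q d R / R) R := by
  have h2 := h.two R hR
  have hE := h.dE R hR
  have := ((h.hq R hR).sub_const c).div ((hE.const_sub 2).const_mul 2)
    (by positivity)
  refine this.congr_deriv ?_
  simp only [ishDB]
  field_simp
  ring

theorem IshProf.dEd (R : ℝ) (hR : 0 < R) :
    HasDerivAt (fun R => E R * d R / 2)
      ((E R * d R / 2 * d R / 2 + E R * (ishP m k c K R (E R) (q R) / 2) / 2) / R) R := by
  refine (((h.dE R hR).mul (h.hd R hR)).div_const 2).congr_deriv ?_
  field_simp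

end

/-- algebra of the evolution equation. -/
theorem ish_alg {m k c K b : ℝ} {E q d B : ℝ → ℝ} {κ : ℝ} (h : IshProf m k c K κ E q d B)
    (hK : K = -(k ^ 2 + b * k)) (R : ℝ) (hR : 0 < R) :
    R * (E R * d R / 2) = 4 * (ishSq E R * (ishSq E R * (2 * ishcA E d R * ishcB c E q R
      + ishDB c E q d R))) + 2 * c * (E R * d R / 2) ∧
    R * (-(ishSq E R * ishcA E d R)) = -4 * (1 - E R) * (ishSq E R * (2 * ishcA E d R *
      ishcB c E q R + ishDB c E q d R)) - 2 * c * (ishSq E R * ishcA E d R) ∧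
    R * (ishSq E R * (-ishcB c E q R + m)) =
      4 * ((1 - E R) * (ishSq E R * (ishcA E d R ^ 2 + ishDA m k c K E q d R
        - ishcB c E q R ^ 2 + k ^ 2 / 4)) + ishSq E R *
        (E R * d R / 2 * d R / 2 + E R * (ishP m k c K R (E R) (q R) / 2) / 2))
      - 2 * c * (ishSq E R * ishcB c E q R) + (b - 2 * k * E R) * k * ishSq E R := by
  have h2 := h.two R hR
  have hsq := h.Ssq R hR
  have hcons := h.cons R hR
  refine ⟨?_, ?_, ?_⟩
  · have e : ishSq E R * (ishSq E R * (2 * ishcA E d R * ishcB c E q R + ishDB c E q d R))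
      = E R * (2 - E R) * (2 * ishcA E d R * ishcB c E q R + ishDB c E q d R) := by
      rw [← hsq]; ring
    rw [e]
    unfold ishcA ishcB ishDB
    field_simp
    ring
  · unfold ishcA ishcB ishDB
    field_simp
    ring
  · unfold ishcA ishcB ishDA ishP
    unfold ishQ at hcons
    subst hK
    field_simp
    generalize E R = e at *
    generalize q R = Q at *
    generalize d R = D at *
    linear_combination (-(ishSq E R) * ((1 - e) * 4 * (4 * (1 - e) ^ 2 - 4 * e * (2 - e) + 4 * e * (1 - e)) + 16 * e * (2 - e) ^ 2)) * hcons

section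
variable {σ t ξ η : ℝ}

theorem ishV_pos (hp : ((t, ξ, η) : ℝ × ℝ × ℝ) ∈ ishV σ) :
    0 < t ∧ ξ ≠ 0 ∧ η ≠ 0 ∧ 0 < ishRad σ (t, ξ, η) := by
  obtain ⟨h1, h2⟩ := hp
  simp only at h1 h2
  refine ⟨h1, ?_, ?_, div_pos h2 h1⟩
  · rintro rfl; simp at h2
  · rintro rfl; simp at h2

theorem ish_slice_y {F : ℝ → ℝ} {D : ℝ} (hp : ((t, ξ, η) : ℝ × ℝ × ℝ) ∈ ishV σ)
    (h : HasDerivAt F (D / ishRad σ (t, ξ, η)) (ishRad σ (t, ξ, η))) :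
    HasDerivAt (fun z => F (ishRad σ (t, ξ, z))) (D / η) η := by
  obtain ⟨h1, h2, h3, h4⟩ := ishV_pos hp
  have hr : HasDerivAt (fun z => ishRad σ (t, ξ, z)) (σ * ξ / t) η := by
    have := ((hasDerivAt_id η).const_mul (σ * ξ)).div_const t
    simpa [ishRad] using this
  refine (HasDerivAt.comp η h hr).congr_deriv ?_
  have h5 := h4.ne'
  have : ishRad σ (t, ξ, η) = σ * ξ / t * η := by simp only [ishRad]; ring
  rw [this] at h5 ⊢
  have h6 : σ * ξ / t ≠ 0 := left_ne_zero_of_mul h5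
  generalize σ * ξ / t = w at *
  field_simp

theorem ish_slice_x {F : ℝ → ℝ} {D : ℝ} (hp : ((t, ξ, η) : ℝ × ℝ × ℝ) ∈ ishV σ)
    (h : HasDerivAt F (D / ishRad σ (t, ξ, η)) (ishRad σ (t, ξ, η))) :
    HasDerivAt (fun z => F (ishRad σ (t, z, η))) (D / ξ) ξ := by
  obtain ⟨h1, h2, h3, h4⟩ := ishV_pos hp
  have hr : HasDerivAt (fun z => ishRad σ (t, z, η)) (σ * η / t) ξ := by
    have := (((hasDerivAt_id ξ).const_mul σ).mul_const η).div_const t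
    simpa [ishRad] using this
  refine (HasDerivAt.comp ξ h hr).congr_deriv ?_
  have h5 := h4.ne'
  have : ishRad σ (t, ξ, η) = σ * η / t * ξ := by simp only [ishRad]; ring
  rw [this] at h5 ⊢
  have h6 : σ * η / t ≠ 0 := left_ne_zero_of_mul h5
  generalize σ * η / t = w at *
  field_simp

theorem ish_slice_t {F : ℝ → ℝ} {D : ℝ} (hp : ((t, ξ, η) : ℝ × ℝ × ℝ) ∈ ishV σ)
    (h : HasDerivAt F (D / ishRad σ (t, ξ, η)) (ishRad σ (t, ξ, η))) :
    HasDerivAt (fun z => F (ishRad σ (z, ξ, η))) (-D / t) t := by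
  obtain ⟨h1, h2, h3, h4⟩ := ishV_pos hp
  have hr : HasDerivAt (fun z => ishRad σ (z, ξ, η)) (-(σ * ξ * η) / t ^ 2) t := by
    have := (hasDerivAt_inv h1.ne').const_mul (σ * ξ * η)
    refine (this.congr_deriv ?_)
    field_simp
  refine (HasDerivAt.comp t h hr).congr_deriv ?_
  have h5 := h4.ne'
  have : ishRad σ (t, ξ, η) = (σ * ξ * η) / t := by simp only [ishRad]
  rw [this] at h5 ⊢
  have h6 : σ * ξ * η ≠ 0 := fun h => h5 (by rw [h]; simp)
  generalize σ * ξ * η = w at *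
  field_simp

theorem ishRad_smooth (hp : ((t, ξ, η) : ℝ × ℝ × ℝ) ∈ ishV σ) :
    ContDiffAt ℝ (⊤ : ℕ∞) (ishRad σ) (t, ξ, η) := by
  obtain ⟨h1, h2, h3, h4⟩ := ishV_pos hp
  unfold ishRad
  refine ContDiffAt.div ?_ ?_ h1.ne' <;> fun_prop

theorem ish_comp_smooth {F : ℝ → ℝ} (hp : ((t, ξ, η) : ℝ × ℝ × ℝ) ∈ ishV σ)
    (h : ContDiffOn ℝ (⊤ : ℕ∞) F (Ioi 0)) :
    ContDiffAt ℝ (⊤ : ℕ∞) (fun p => F (ishRad σ p)) (t, ξ, η) := by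
  obtain ⟨h1, h2, h3, h4⟩ := ishV_pos hp
  exact (h.contDiffAt (Ioi_mem_nhds h4)).comp (t, ξ, η) (ishRad_smooth hp)

theorem ish_vec_smooth {X p w θ : ℝ × ℝ × ℝ → ℝ} {z : ℝ × ℝ × ℝ}
    (h1 : ContDiffAt ℝ (⊤ : ℕ∞) X z) (h2 : ContDiffAt ℝ (⊤ : ℕ∞) p z)
    (h3 : ContDiffAt ℝ (⊤ : ℕ∞) w z) (h4 : ContDiffAt ℝ (⊤ : ℕ∞) θ z) :
    ContDiffAt ℝ (⊤ : ℕ∞) (fun z => ishvec (X z) (p z) (w z) (θ z)) z := by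
  rw [contDiffAt_pi]
  intro i
  fin_cases i
  · simpa [ishvec] using h1
  · simp [ishvec]; exact (h2.mul h4.cos).sub (h3.mul h4.sin)
  · simp [ishvec]; exact (h2.mul h4.sin).add (h3.mul h4.cos)

theorem ish_log_smooth (hp : ((t, ξ, η) : ℝ × ℝ × ℝ) ∈ ishV σ) :
    ContDiffAt ℝ (⊤ : ℕ∞) (fun p : ℝ × ℝ × ℝ => Real.log p.1) (t, ξ, η) ∧
    ContDiffAt ℝ (⊤ : ℕ∞) (fun p : ℝ × ℝ × ℝ => Real.log p.2.1) (t, ξ, η) ∧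
    ContDiffAt ℝ (⊤ : ℕ∞) (fun p : ℝ × ℝ × ℝ => Real.log p.2.2) (t, ξ, η) := by
  obtain ⟨h1, h2, h3, h4⟩ := ishV_pos hp
  exact ⟨ContDiffAt.log (by fun_prop) h1.ne', ContDiffAt.log (by fun_prop) h2,
    ContDiffAt.log (by fun_prop) h3⟩

variable {μ m k c c' b K κ : ℝ} {E q d B : ℝ → ℝ} (h : IshProf m k c' K κ E q d B)
include h

theorem IshProf.Sq_smooth : ContDiffOn ℝ (⊤ : ℕ∞) (ishSq E) (Ioi 0) := by
  have := h.smooth.1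
  refine ContDiffOn.sqrt (by fun_prop) ?_
  exact fun x hx => (mul_pos (h.pos x hx) (h.two x hx)).ne'

theorem IshProf.U_smooth (hp : ((t, ξ, η) : ℝ × ℝ × ℝ) ∈ ishV σ) :
    ContDiffAt ℝ (⊤ : ℕ∞) (ishU σ μ k E B) (t, ξ, η) := by
  obtain ⟨l1, l2, l3⟩ := ish_log_smooth hp
  have hE := ish_comp_smooth hp h.smooth.1
  have hB := ish_comp_smooth hp h.smooth.2.2.2
  have hS := ish_comp_smooth hp h.Sq_smooth
  unfold ishU ishTh
  apply ish_vec_smooth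
  · exact contDiffAt_const.sub hE
  · exact hS
  · exact contDiffAt_const
  · exact ((contDiffAt_const.mul hB).add (contDiffAt_const.mul (l2.sub l3))).add
      (contDiffAt_const.mul l1)

theorem IshProf.Gn_smooth (hκ : 0 < κ) (hp : ((t, ξ, η) : ℝ × ℝ × ℝ) ∈ ishV σ) :
    ContDiffAt ℝ (⊤ : ℕ∞) (ishGn σ k E) (t, ξ, η) := 
  ish_comp_smooth hp (h.G_smooth hκ)

theorem IshProf.Phi_smooth (hκ : 0 < κ) (hp : ((t, ξ, η) : ℝ × ℝ × ℝ) ∈ ishV σ) :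
    ContDiffAt ℝ (⊤ : ℕ∞) (ishPhi σ k c b E) (t, ξ, η) := by
  obtain ⟨l1, l2, l3⟩ := ish_log_smooth hp
  have hG := h.Gn_smooth hκ hp
  unfold ishPhi
  fun_prop

/-- frame expression of the first derivatives. -/
theorem IshProf.U_y (hp : ((t, ξ, η) : ℝ × ℝ × ℝ) ∈ ishV σ) :
    ishd ey (ishU σ μ k E B) (t, ξ, η) = η⁻¹ • ishvec (-(E (ishRad σ (t, ξ, η)) *
      d (ishRad σ (t, ξ, η)) / 2)) (ishSq E (ishRad σ (t, ξ, η)) * ishcA E d (ishRad σ (t, ξ, η)))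
      (ishSq E (ishRad σ (t, ξ, η)) * (σ * ishcB c' E q (ishRad σ (t, ξ, η)) - k / 2))
      (ishTh σ μ k B (t, ξ, η)) := by
  obtain ⟨h1, h2, h3, h4⟩ := ishV_pos hp
  refine (ishd_y (h.U_smooth hp)).unique ?_
  have hE := ish_slice_y hp (h.dE _ h4)
  have hS := ish_slice_y hp (h.dS _ h4)
  have hB := ish_slice_y hp (h.dB _ h4)
  have hT : HasDerivAt (fun z => ishTh σ μ k B (t, ξ, z))
    ((σ * ishcB c' E q (ishRad σ (t, ξ, η)) - k / 2) / η) η := by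
    refine (((hB.const_mul σ).add (((Real.hasDerivAt_log h3).const_sub (Real.log ξ)).const_mul
      (k / 2))).add_const (μ * Real.log t)).congr_deriv ?_
    field_simp; ring
  refine (ishvec_der (hE.const_sub 1) hS (hasDerivAt_const η (0:ℝ)) hT).congr_deriv ?_
  rw [ishvec_smul]
  congr 1 <;> field_simp <;> ring

theorem IshProf.U_x (hp : ((t, ξ, η) : ℝ × ℝ × ℝ) ∈ ishV σ) :
    ishd ex (ishU σ μ k E B) (t, ξ, η) = ξ⁻¹ • ishvec (-(E (ishRad σ (t, ξ, η)) *
      d (ishRad σ (t, ξ, η)) / 2)) (ishSq E (ishRad σ (t, ξ, η)) * ishcA E d (ishRad σ (t, ξ, η)))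
      (ishSq E (ishRad σ (t, ξ, η)) * (σ * ishcB c' E q (ishRad σ (t, ξ, η)) + k / 2))
      (ishTh σ μ k B (t, ξ, η)) := by
  obtain ⟨h1, h2, h3, h4⟩ := ishV_pos hp
  refine (ishd_x (h.U_smooth hp)).unique ?_
  have hE := ish_slice_x hp (h.dE _ h4)
  have hS := ish_slice_x hp (h.dS _ h4)
  have hB := ish_slice_x hp (h.dB _ h4)
  have hT : HasDerivAt (fun z => ishTh σ μ k B (t, z, η))
    ((σ * ishcB c' E q (ishRad σ (t, ξ, η)) + k / 2) / ξ) ξ := by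
    refine (((hB.const_mul σ).add (((Real.hasDerivAt_log h2).sub_const (Real.log η)).const_mul
      (k / 2))).add_const (μ * Real.log t)).congr_deriv ?_
    field_simp
  refine (ishvec_der (hE.const_sub 1) hS (hasDerivAt_const ξ (0:ℝ)) hT).congr_deriv ?_
  rw [ishvec_smul]
  congr 1 <;> field_simp <;> ring

theorem IshProf.U_t (hp : ((t, ξ, η) : ℝ × ℝ × ℝ) ∈ ishV σ) :
    ishd et (ishU σ μ k E B) (t, ξ, η) = t⁻¹ • ishvec (E (ishRad σ (t, ξ, η)) *
      d (ishRad σ (t, ξ, η)) / 2) (-(ishSq E (ishRad σ (t, ξ, η)) *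
        ishcA E d (ishRad σ (t, ξ, η))))
      (ishSq E (ishRad σ (t, ξ, η)) * (-(σ * ishcB c' E q (ishRad σ (t, ξ, η))) + μ))
      (ishTh σ μ k B (t, ξ, η)) := by
  obtain ⟨h1, h2, h3, h4⟩ := ishV_pos hp
  refine (ishd_t (h.U_smooth hp)).unique ?_
  have hE := ish_slice_t hp (h.dE _ h4)
  have hS := ish_slice_t hp (h.dS _ h4)
  have hB := ish_slice_t hp (h.dB _ h4)
  have hT : HasDerivAt (fun z => ishTh σ μ k B (z, ξ, η))
    ((-(σ * ishcB c' E q (ishRad σ (t, ξ, η))) + μ) / t) t := by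
    refine (((hB.const_mul σ).add_const (k / 2 * (Real.log ξ - Real.log η))).add
      ((Real.hasDerivAt_log h1.ne').const_mul μ)).congr_deriv ?_
    field_simp
  refine (ishvec_der (hE.const_sub 1) hS (hasDerivAt_const t (0:ℝ)) hT).congr_deriv ?_
  rw [ishvec_smul]
  congr 1 <;> field_simp <;> ring

theorem IshProf.U_xy (hσ : σ * σ = 1) (hp : ((t, ξ, η) : ℝ × ℝ × ℝ) ∈ ishV σ) :
    ishd ey (ishd ex (ishU σ μ k E B)) (t, ξ, η) = (ξ * η)⁻¹ • ishvec
      (-(E (ishRad σ (t, ξ, η)) * d (ishRad σ (t, ξ, η)) / 2 * d (ishRad σ (t, ξ, η)) / 2 +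
        E (ishRad σ (t, ξ, η)) * (ishP m k c' K (ishRad σ (t, ξ, η)) (E (ishRad σ (t, ξ, η)))
          (q (ishRad σ (t, ξ, η))) / 2) / 2))
      (ishSq E (ishRad σ (t, ξ, η)) * (ishcA E d (ishRad σ (t, ξ, η)) ^ 2 +
        ishDA m k c' K E q d (ishRad σ (t, ξ, η)) - ishcB c' E q (ishRad σ (t, ξ, η)) ^ 2
          + k ^ 2 / 4))
      (σ * (ishSq E (ishRad σ (t, ξ, η)) * (2 * ishcA E d (ishRad σ (t, ξ, η)) *
        ishcB c' E q (ishRad σ (t, ξ, η)) + ishDB c' E q d (ishRad σ (t, ξ, η)))))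
      (ishTh σ μ k B (t, ξ, η)) := by
  obtain ⟨h1, h2, h3, h4⟩ := ishV_pos hp
  have hs := ishd_smooth (v := ex) (h.U_smooth (μ := μ) hp)
  refine (ishd_y hs).unique ?_
  have hE := ish_slice_y hp (h.dEd _ h4)
  have hS := ish_slice_y hp (h.dS _ h4)
  have hB := ish_slice_y hp (h.dB _ h4)
  have hcA := ish_slice_y hp (h.dcA _ h4)
  have hcB := ish_slice_y hp (h.dcB _ h4)
  have hT : HasDerivAt (fun z => ishTh σ μ k B (t, ξ, z))
    ((σ * ishcB c' E q (ishRad σ (t, ξ, η)) - k / 2) / η) η := by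
    refine (((hB.const_mul σ).add (((Real.hasDerivAt_log h3).const_sub (Real.log ξ)).const_mul
      (k / 2))).add_const (μ * Real.log t)).congr_deriv ?_
    field_simp; ring
  have key := (ishvec_der hE.neg (hS.mul hcA) (hS.mul ((hcB.const_mul σ).add_const (k / 2)))
    hT).const_smul ξ⁻¹
  have hev : (fun z => ishd ex (ishU σ μ k E B) (t, ξ, z)) =ᶠ[nhds η]
      (ξ⁻¹ • fun z => ishvec (-(E (ishRad σ (t, ξ, z)) * d (ishRad σ (t, ξ, z)) / 2))
        (ishSq E (ishRad σ (t, ξ, z)) * ishcA E d (ishRad σ (t, ξ, z)))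
        (ishSq E (ishRad σ (t, ξ, z)) * (σ * ishcB c' E q (ishRad σ (t, ξ, z)) + k / 2))
        (ishTh σ μ k B (t, ξ, z))) := by
    have hc : ContinuousAt (fun z : ℝ => ((t, ξ, z) : ℝ × ℝ × ℝ)) η := by fun_prop
    filter_upwards [hc.preimage_mem_nhds ((ishV_open σ).mem_nhds hp)] with z hz
    exact h.U_x hz
  refine (key.congr_of_eventuallyEq hev).congr_deriv ?_
  rw [ishvec_smul, ishvec_smul]
  simp only [Pi.mul_apply]
  congr 1
  · field_simp
  · field_simp
    linear_combination (-16 * ishSq E (ishRad σ (t, ξ, η)) * ishcB c' E q (ishRad σ (t, ξ, η)) ^ 2) * hσ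
  · field_simp
    ring

theorem IshProf.Gn_y (hκ : 0 < κ) (hp : ((t, ξ, η) : ℝ × ℝ × ℝ) ∈ ishV σ) :
    ishd ey (ishGn σ k E) (t, ξ, η) = k * E (ishRad σ (t, ξ, η)) / η := by
  obtain ⟨h1, h2, h3, h4⟩ := ishV_pos hp
  exact (ishd_y (h.Gn_smooth hκ hp)).unique (ish_slice_y hp (h.G_der hκ h4))

theorem IshProf.Gn_x (hκ : 0 < κ) (hp : ((t, ξ, η) : ℝ × ℝ × ℝ) ∈ ishV σ) :
    ishd ex (ishGn σ k E) (t, ξ, η) = k * E (ishRad σ (t, ξ, η)) / ξ := by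
  obtain ⟨h1, h2, h3, h4⟩ := ishV_pos hp
  exact (ishd_x (h.Gn_smooth hκ hp)).unique (ish_slice_x hp (h.G_der hκ h4))

theorem IshProf.Gn_xy (hκ : 0 < κ) (hp : ((t, ξ, η) : ℝ × ℝ × ℝ) ∈ ishV σ) :
    ishd ey (ishd ex (ishGn σ k E)) (t, ξ, η) =
      k * (E (ishRad σ (t, ξ, η)) * d (ishRad σ (t, ξ, η)) / 2) / (ξ * η) := by
  obtain ⟨h1, h2, h3, h4⟩ := ishV_pos hp
  refine (ishd_y (ishd_smooth (h.Gn_smooth hκ hp))).unique ?_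
  have hev : (fun z => ishd ex (ishGn σ k E) (t, ξ, z)) =ᶠ[nhds η] 
      fun z => k * E (ishRad σ (t, ξ, z)) / ξ := by
    have hc : ContinuousAt (fun z : ℝ => ((t, ξ, z) : ℝ × ℝ × ℝ)) η := by fun_prop
    filter_upwards [hc.preimage_mem_nhds ((ishV_open σ).mem_nhds hp)] with z hz
    exact h.Gn_x hκ hz
  refine ((((ish_slice_y hp (h.dE _ h4)).const_mul k).div_const ξ).congr_of_eventuallyEq 
    hev).congr_deriv ?_
  field_simp

theorem IshProf.Phi_x (hκ : 0 < κ) (hp : ((t, ξ, η) : ℝ × ℝ × ℝ) ∈ ishV σ) :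
    ishd ex (ishPhi σ k c b E) (t, ξ, η) = ((c + b) / 2 - k * E (ishRad σ (t, ξ, η))) / ξ := by
  obtain ⟨h1, h2, h3, h4⟩ := ishV_pos hp
  refine (ishd_x (h.Phi_smooth hκ hp)).unique ?_
  have hl := Real.hasDerivAt_log h2
  refine ((((hl.sub_const (Real.log η)).const_mul (c / 2)).add
    (((hl.add_const (Real.log η)).sub_const (Real.log t)).const_mul (b / 2))).sub
    (ish_slice_x hp (h.G_der hκ h4))).congr_deriv ?_
  field_simp

theorem IshProf.Phi_y (hκ : 0 < κ) (hp : ((t, ξ, η) : ℝ × ℝ × ℝ) ∈ ishV σ) :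
    ishd ey (ishPhi σ k c b E) (t, ξ, η) = ((b - c) / 2 - k * E (ishRad σ (t, ξ, η))) / η := by
  obtain ⟨h1, h2, h3, h4⟩ := ishV_pos hp
  refine (ishd_y (h.Phi_smooth hκ hp)).unique ?_
  have hl := Real.hasDerivAt_log h3
  refine ((((hl.const_sub (Real.log ξ)).const_mul (c / 2)).add
    (((hl.const_add (Real.log ξ)).sub_const (Real.log t)).const_mul (b / 2))).sub
    (ish_slice_y hp (h.G_der hκ h4))).congr_deriv ?_
  field_simp; ring

theorem IshProf.Phi_xy (hκ : 0 < κ) (hp : ((t, ξ, η) : ℝ × ℝ × ℝ) ∈ ishV σ) :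
    ishd ey (ishd ex (ishPhi σ k c b E)) (t, ξ, η) =
      -(k * (E (ishRad σ (t, ξ, η)) * d (ishRad σ (t, ξ, η)) / 2) / (ξ * η)) := by
  obtain ⟨h1, h2, h3, h4⟩ := ishV_pos hp
  refine (ishd_y (ishd_smooth (h.Phi_smooth hκ hp))).unique ?_
  have hev : (fun z => ishd ex (ishPhi σ k c b E) (t, ξ, z)) =ᶠ[nhds η] 
      fun z => ((c + b) / 2 - k * E (ishRad σ (t, ξ, z))) / ξ := by
    have hc : ContinuousAt (fun z : ℝ => ((t, ξ, z) : ℝ × ℝ × ℝ)) η := by fun_prop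
    filter_upwards [hc.preimage_mem_nhds ((ishV_open σ).mem_nhds hp)] with z hz
    exact h.Phi_x hκ hz
  refine (((((ish_slice_y hp (h.dE _ h4)).const_mul k).const_sub _).div_const ξ).congr_of_eventuallyEq 
    hev).congr_deriv ?_
  field_simp

/-- first equation in null coordinates. -/
theorem IshProf.pde1 (hκ : 0 < κ) (hσ : σ * σ = 1) (hm : m = σ * μ) (hc : c' = σ * c)
    (hK : K = -(k ^ 2 + b * k)) (hp : ((t, ξ, η) : ℝ × ℝ × ℝ) ∈ ishV σ) :
    ishd et (ishU σ μ k E B) (t, ξ, η) =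
      (4:ℝ) • cross3 (ishU σ μ k E B (t, ξ, η)) (ishd ey (ishd ex (ishU σ μ k E B)) (t, ξ, η))
      + (2 * ishd ey (ishPhi σ k c b E) (t, ξ, η)) • ishd ex (ishU σ μ k E B) (t, ξ, η)
      - (2 * ishd ex (ishPhi σ k c b E) (t, ξ, η)) • ishd ey (ishU σ μ k E B) (t, ξ, η) := by
  obtain ⟨h1, h2, h3, h4⟩ := ishV_pos hp
  obtain ⟨a1, a2, a3⟩ := ish_alg h hK _ h4
  rw [h.U_t hp, h.U_xy hσ hp, h.Phi_y hκ hp, h.Phi_x hκ hp, h.U_x hp, h.U_y hp]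
  have hR : t = σ * ξ * η / ishRad σ (t, ξ, η) := by
    have : σ * ξ * η / t = ishRad σ (t, ξ, η) := rfl
    rw [← this]
    have h6 : σ * ξ * η ≠ 0 := hp.2.ne'
    generalize σ * ξ * η = w at *
    field_simp
  have hti : t⁻¹ = (ξ * η)⁻¹ * (σ * ishRad σ (t, ξ, η)) := by
    have : σ * ξ * η / t = ishRad σ (t, ξ, η) := rfl
    rw [← this]
    field_simp
    linear_combination -hσ
  rw [hti]
  unfold ishU
  generalize ishTh σ μ k B (t, ξ, η) = θ
  generalize ishRad σ (t, ξ, η) = R at *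
  simp only [ishvec_smul, ishvec_cross, ishvec_add, ishvec_sub]
  subst hm hc
  congr 1
  · linear_combination (σ * (ξ * η)⁻¹) * a1 + (c * E R * d R * (ξ * η)⁻¹) * hσ
  · linear_combination (σ * (ξ * η)⁻¹) * a2 - (2 * c * ishSq E R * ishcA E d R * (ξ * η)⁻¹) * hσ
  · linear_combination (ξ * η)⁻¹ * a3 - (R * ishSq E R * ishcB (σ * c) E q R * (ξ * η)⁻¹) * hσ

theorem IshProf.pde2 (hp : ((t, ξ, η) : ℝ × ℝ × ℝ) ∈ ishV σ) :
    dot3 (ishU σ μ k E B (t, ξ, η)) (cross3 (ishd ex (ishU σ μ k E B) (t, ξ, η))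
      (ishd ey (ishU σ μ k E B) (t, ξ, η))) = 
      -(k * (E (ishRad σ (t, ξ, η)) * d (ishRad σ (t, ξ, η)) / 2) / (ξ * η)) := by
  obtain ⟨h1, h2, h3, h4⟩ := ishV_pos hp
  have hsq := h.Ssq _ h4
  have h2 := h.two _ h4
  rw [h.U_x hp, h.U_y hp]
  unfold ishU
  rw [ishvec_smul, ishvec_smul, ishvec_cross, ishvec_dot]
  have e : (ishSq E (ishRad σ (t, ξ, η))) ^ 2 * ((1 - E (ishRad σ (t, ξ, η))) *
      ishcA E d (ishRad σ (t, ξ, η)) + E (ishRad σ (t, ξ, η)) * d (ishRad σ (t, ξ, η)) / 2) =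
      E (ishRad σ (t, ξ, η)) * d (ishRad σ (t, ξ, η)) / 2 := by
    rw [hsq]
    unfold ishcA
    field_simp
    ring
  linear_combination (-k * (ξ * η)⁻¹) * e
end

theorem ish_int1 {W w : ℝ → ℝ} {l M : ℝ} (hM : 0 < M) (hl : Tendsto W (nhdsWithin 0 {0}ᶜ) (nhds l))
    (hd : ∀ x ≠ 0, HasDerivAt W (w x) x) (hW : ∀ x, M ≤ |x| → W x = 0) : ∫ x, w x = 0 := by
  by_cases hI : Integrable w
  swap
  · exact integral_undef hI
  have hw : ∀ x, M < |x| → w x = 0 := by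
    intro x hx
    have hx0 : x ≠ 0 := by rintro rfl; simp at hx; linarith
    refine (hd x hx0).unique ?_
    have : W =ᶠ[nhds x] fun _ => 0 := by
      filter_upwards [(isOpen_lt continuous_const continuous_abs).mem_nhds hx] with z hz
      exact hW z (le_of_lt hz)
    exact (hasDerivAt_const x (0:ℝ)).congr_of_eventuallyEq this
  set M' := M + 1
  have hs : ∫ x, w x = ∫ x in (-M')..M', w x := by
    rw [intervalIntegral.integral_of_le (by simp only [M']; linarith)]
    rw [setIntegral_eq_integral_of_forall_compl_eq_zero]
    intro x hx
    apply hw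
    by_contra hlt
    push Not at hlt
    have := abs_le.1 hlt
    exact hx ⟨by simp only [M']; linarith, by simp only [M']; linarith⟩
  rw [hs]
  have key := integral_eq_of_hasDerivAt_off_countable (a := -M') (b := M')
    (Function.update W 0 l) w (s := {0}) (countable_singleton 0) ?_ ?_ hI.intervalIntegrable
  · rw [key, Function.update_of_ne (by simp only [M']; linarith),
      Function.update_of_ne (by simp only [M']; linarith), hW, hW, sub_zero]
    · rw [abs_neg, abs_of_pos] <;> simp only [M'] <;> linarith
    · rw [abs_of_pos] <;> simp only [M'] <;> linarith
  · intro x hx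
    apply ContinuousAt.continuousWithinAt
    by_cases h0 : x = 0
    · subst h0
      exact continuousAt_update_same.2 hl
    · rw [continuousAt_update_of_ne h0]
      exact (hd x h0).continuousAt
  · intro x hx
    have h0 : x ≠ 0 := hx.2
    refine (hd x h0).congr_of_eventuallyEq ?_
    filter_upwards [isOpen_ne.mem_nhds h0] with z hz
    exact Function.update_of_ne hz _ _

/-- the complement of the cross in positive time. -/
def ishW : Set (ℝ × ℝ × ℝ) := {p | 0 < p.1 ∧ p.2.1 ≠ 0 ∧ p.2.2 ≠ 0}

theorem ishW_open : IsOpen ishW := by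
  have h1 : Continuous (fun p : ℝ × ℝ × ℝ => p.2.1) := by fun_prop
  have h2 : Continuous (fun p : ℝ × ℝ × ℝ => p.2.2) := by fun_prop
  exact (isOpen_lt continuous_const continuous_fst).inter
    ((isOpen_ne_fun h1 continuous_const).inter (isOpen_ne_fun h2 continuous_const))

theorem ish_ae_ne : ∀ᵐ x : ℝ, x ≠ 0 := by
  simp [ae_iff]

theorem ishW_ae : ∀ᵐ p : ℝ × ℝ × ℝ, p ∈ ishW ∨ p.1 < 0 := by
  have h1 : ∀ᵐ p : ℝ × ℝ × ℝ, p.1 ≠ 0 :=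
    Measure.quasiMeasurePreserving_fst.ae ish_ae_ne
  have h2 : ∀ᵐ p : ℝ × ℝ × ℝ, p.2.1 ≠ 0 :=
    (Measure.quasiMeasurePreserving_fst.comp Measure.quasiMeasurePreserving_snd).ae ish_ae_ne
  have h3 : ∀ᵐ p : ℝ × ℝ × ℝ, p.2.2 ≠ 0 :=
    (Measure.quasiMeasurePreserving_snd.comp Measure.quasiMeasurePreserving_snd).ae ish_ae_ne
  filter_upwards [h1, h2, h3] with p a1 a2 a3
  rcases lt_or_gt_of_ne a1 with h | h
  · exact Or.inr h
  · exact Or.inl ⟨h, a2, a3⟩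

theorem ish_div_y {f W : ℝ × ℝ × ℝ → ℝ} {M : ℝ} (hM : 0 < M) (hI : Integrable (ishW.indicator f))
    (h1 : ∀ t ξ η, (t, ξ, η) ∈ ishW → HasDerivAt (fun z => W (t, ξ, z)) (f (t, ξ, η)) η)
    (h2 : ∀ t ξ, 0 < t → ξ ≠ 0 → ∃ l, Tendsto (fun z => W (t, ξ, z)) (nhdsWithin 0 {0}ᶜ) (nhds l))
    (h3 : ∀ t ξ η, M ≤ |η| → W (t, ξ, η) = 0) : ∫ p, ishW.indicator f p = 0 := by
  rw [Measure.volume_eq_prod] at hI ⊢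
  rw [integral_prod _ hI]
  apply integral_eq_zero_of_ae
  filter_upwards [hI.prod_right_ae] with t ht
  show ∫ y, ishW.indicator f (t, y) = 0
  rw [Measure.volume_eq_prod] at ht ⊢
  rw [integral_prod _ ht]
  apply integral_eq_zero_of_ae
  filter_upwards [ish_ae_ne] with ξ hξ
  show ∫ y, ishW.indicator f (t, ξ, y) = 0
  by_cases htp : 0 < t
  · obtain ⟨l, hl⟩ := h2 t ξ htp hξ
    have : (fun y => ishW.indicator f (t, ξ, y)) =ᵐ[volume] fun y => f (t, ξ, y) := by
      filter_upwards [ish_ae_ne] with y hy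
      exact indicator_of_mem (show (t, ξ, y) ∈ ishW from ⟨htp, hξ, hy⟩) _
    rw [integral_congr_ae this]
    exact ish_int1 hM hl (fun x hx => h1 t ξ x ⟨htp, hξ, hx⟩) (fun x hx => h3 t ξ x hx)
  · have : (fun y => ishW.indicator f (t, ξ, y)) = fun y => 0 := by
      funext y
      exact indicator_of_notMem (fun h => htp h.1) _
    rw [this]; simp

theorem ish_div_x {f W : ℝ × ℝ × ℝ → ℝ} {M : ℝ} (hM : 0 < M) (hI : Integrable (ishW.indicator f))
    (h1 : ∀ t ξ η, (t, ξ, η) ∈ ishW → HasDerivAt (fun z => W (t, z, η)) (f (t, ξ, η)) ξ)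
    (h2 : ∀ t η, 0 < t → η ≠ 0 → ∃ l, Tendsto (fun z => W (t, z, η)) (nhdsWithin 0 {0}ᶜ) (nhds l))
    (h3 : ∀ t ξ η, M ≤ |ξ| → W (t, ξ, η) = 0) : ∫ p, ishW.indicator f p = 0 := by
  rw [Measure.volume_eq_prod] at hI ⊢
  rw [integral_prod _ hI]
  apply integral_eq_zero_of_ae
  filter_upwards [hI.prod_right_ae] with t ht
  show ∫ y, ishW.indicator f (t, y) = 0
  rw [Measure.volume_eq_prod] at ht ⊢
  rw [integral_prod_symm _ ht]
  apply integral_eq_zero_of_ae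
  filter_upwards [ish_ae_ne] with η hη
  show ∫ y, ishW.indicator f (t, y, η) = 0
  by_cases htp : 0 < t
  · obtain ⟨l, hl⟩ := h2 t η htp hη
    have : (fun y => ishW.indicator f (t, y, η)) =ᵐ[volume] fun y => f (t, y, η) := by
      filter_upwards [ish_ae_ne] with y hy
      exact indicator_of_mem (show (t, y, η) ∈ ishW from ⟨htp, hy, hη⟩) _
    rw [integral_congr_ae this]
    exact ish_int1 hM hl (fun x hx => h1 t x η ⟨htp, hx, hη⟩) (fun x hx => h3 t x η hx)
  · have : (fun y => ishW.indicator f (t, y, η)) = fun y => 0 := by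
      funext y
      exact indicator_of_notMem (fun h => htp h.1) _
    rw [this]; simp

theorem ish_div_t {f W : ℝ × ℝ × ℝ → ℝ} {M : ℝ} (hM : 0 < M) (hI : Integrable (ishW.indicator f))
    (h1 : ∀ t ξ η, (t, ξ, η) ∈ ishW → HasDerivAt (fun z => W (z, ξ, η)) (f (t, ξ, η)) t)
    (h2 : ∀ ξ η, ξ ≠ 0 → η ≠ 0 → Tendsto (fun z => W (z, ξ, η)) (nhdsWithin 0 (Ioi 0)) (nhds 0))
    (h3 : ∀ t ξ η, M ≤ |t| → W (t, ξ, η) = 0) : ∫ p, ishW.indicator f p = 0 := by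
  rw [Measure.volume_eq_prod] at hI ⊢
  rw [integral_prod_symm _ hI]
  apply integral_eq_zero_of_ae
  have a2 : ∀ᵐ p : ℝ × ℝ, p.1 ≠ 0 := Measure.quasiMeasurePreserving_fst.ae ish_ae_ne
  have a3 : ∀ᵐ p : ℝ × ℝ, p.2 ≠ 0 := Measure.quasiMeasurePreserving_snd.ae ish_ae_ne
  filter_upwards [a2, a3] with p hξ hη
  obtain ⟨ξ, η⟩ := p
  show ∫ t, ishW.indicator f (t, ξ, η) = 0
  simp only at hξ hη
  refine ish_int1 (W := (Ioi 0).indicator fun z => W (z, ξ, η)) (l := 0) hM ?_ ?_ ?_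
  · rw [← Set.Iio_union_Ioi, nhdsWithin_union]
    refine Tendsto.sup ?_ ?_
    · refine Tendsto.congr' ?_ tendsto_const_nhds
      filter_upwards [self_mem_nhdsWithin] with z hz
      have hz' : z < 0 := hz
      exact (indicator_of_notMem (show z ∉ Ioi (0:ℝ) by simpa using hz'.le)
        (fun z => W (z, ξ, η))).symm
    · refine Tendsto.congr' ?_ (h2 ξ η hξ hη)
      filter_upwards [self_mem_nhdsWithin] with z hz
      exact (indicator_of_mem hz (fun z => W (z, ξ, η))).symm
  · intro t ht
    rcases lt_or_gt_of_ne ht with h | h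
    · rw [indicator_of_notMem (show (t, ξ, η) ∉ ishW from fun h' => absurd h'.1 (not_lt.2 h.le))]
      refine (hasDerivAt_const t (0:ℝ)).congr_of_eventuallyEq ?_
      filter_upwards [Iio_mem_nhds h] with z hz
      have hz' : z < 0 := hz
      exact indicator_of_notMem (by simpa using hz'.le) _
    · have hm : (t, ξ, η) ∈ ishW := ⟨h, hξ, hη⟩
      rw [indicator_of_mem hm]
      refine (h1 t ξ η hm).congr_of_eventuallyEq ?_
      filter_upwards [Ioi_mem_nhds h] with z hz
      exact indicator_of_mem hz _
  · intro t ht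
    by_cases h : t ∈ Ioi (0:ℝ)
    · rw [indicator_of_mem h]; exact h3 t ξ η ht
    · exact indicator_of_notMem h _

/-- integrable weight -/
noncomputable def ishOm (δ : ℝ) (p : ℝ × ℝ × ℝ) : ℝ :=
  |p.1| ^ (δ - 1) * (|p.2.1| ^ (δ - 1) * |p.2.2| ^ (δ - 1))

def ishBox (M : ℝ) : Set (ℝ × ℝ × ℝ) := {p | |p.1| ≤ M ∧ |p.2.1| ≤ M ∧ |p.2.2| ≤ M}

theorem ish_int_w {δ M : ℝ} (hδ : 0 < δ) (hM : 0 < M) :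
    Integrable ((Icc (-M) M).indicator fun x : ℝ => |x| ^ (δ - 1)) := by
  rw [integrable_indicator_iff measurableSet_Icc]
  have h1 : IntervalIntegrable (fun x : ℝ => |x| ^ (δ - 1)) volume 0 M := by
    refine (intervalIntegral.intervalIntegrable_rpow' (r := δ - 1) (by linarith)).congr ?_
    intro x hx
    rw [uIoc_of_le hM.le] at hx
    simp only
    rw [abs_of_pos hx.1]
  have h2 : IntervalIntegrable (fun x : ℝ => |x| ^ (δ - 1)) volume (-M) 0 := by
    have := (IntervalIntegrable.iff_comp_neg (by simp)).1 h1.symm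
    simpa using this
  have h3 := h2.trans h1
  rw [intervalIntegrable_iff_integrableOn_Icc_of_le (by linarith)] at h3
  exact h3

theorem ish_int_box {δ M : ℝ} (hδ : 0 < δ) (hM : 0 < M) :
    Integrable ((ishBox M).indicator (ishOm δ)) := by
  have h := ish_int_w hδ hM
  have := h.mul_prod (h.mul_prod h)
  rw [← Measure.volume_eq_prod, ← Measure.volume_eq_prod] at this
  refine this.congr (ae_of_all _ ?_)
  rintro ⟨t, ξ, η⟩
  by_cases a1 : |t| ≤ M
  swap
  · rw [indicator_of_notMem (s := ishBox M) (fun h => a1 h.1)]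
    simp only [indicator, mem_Icc, ← abs_le, if_neg a1, zero_mul]
  by_cases a2 : |ξ| ≤ M
  swap
  · rw [indicator_of_notMem (s := ishBox M) (fun h => a2 h.2.1)]
    simp only [indicator, mem_Icc, ← abs_le, if_neg a2, zero_mul, mul_zero]
  by_cases a3 : |η| ≤ M
  swap
  · rw [indicator_of_notMem (s := ishBox M) (fun h => a3 h.2.2)]
    simp only [indicator, mem_Icc, ← abs_le, if_neg a3, mul_zero]
  rw [indicator_of_mem (s := ishBox M) ⟨a1, a2, a3⟩]
  simp only [indicator, mem_Icc, ← abs_le, if_pos a1, if_pos a2, if_pos a3, ishOm]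

theorem ish_integrable {f : ℝ × ℝ × ℝ → ℝ} {δ M C : ℝ} (hδ : 0 < δ) (hM : 0 < M)
    (hf : ContinuousOn f ishW) (h0 : ∀ p, p ∉ ishBox M → f p = 0)
    (hb : ∀ p ∈ ishW, p ∈ ishBox M → |f p| ≤ C * ishOm δ p) : Integrable (ishW.indicator f) := by
  refine Integrable.mono' ((ish_int_box hδ hM).const_mul |C|) ?_ (ae_of_all _ ?_)
  · rw [aestronglyMeasurable_indicator_iff ishW_open.measurableSet]
    exact hf.aestronglyMeasurable ishW_open.measurableSet
  · intro p
    have hO : 0 ≤ ishOm δ p := by unfold ishOm; positivity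
    by_cases hp : p ∈ ishW
    · rw [indicator_of_mem hp]
      by_cases hq : p ∈ ishBox M
      · rw [indicator_of_mem hq, Real.norm_eq_abs]
        exact (hb p hp hq).trans (mul_le_mul_of_nonneg_right (le_abs_self _) hO)
      · rw [indicator_of_notMem hq, h0 p hq]; simp
    · rw [indicator_of_notMem hp]
      simp only [norm_zero]
      exact mul_nonneg (abs_nonneg _) (indicator_nonneg (fun x _ => by unfold ishOm; positivity) _)

def IshDom (δ M : ℝ) (f : ℝ × ℝ × ℝ → ℝ) : Prop :=
  ∃ C, ∀ p ∈ ishW, p ∈ ishBox M → |p.1 * f p| ≤ C * ishOm δ p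

theorem ishOm_nonneg (δ : ℝ) (p : ℝ × ℝ × ℝ) : 0 ≤ ishOm δ p := by unfold ishOm; positivity

theorem IshDom.add {δ M : ℝ} {f g : ℝ × ℝ × ℝ → ℝ} (hf : IshDom δ M f) (hg : IshDom δ M g) :
    IshDom δ M (fun p => f p + g p) := by
  obtain ⟨C, hC⟩ := hf
  obtain ⟨D, hD⟩ := hg
  refine ⟨C + D, fun p h1 h2 => ?_⟩
  rw [mul_add, add_mul]
  exact (abs_add_le _ _).trans (add_le_add (hC p h1 h2) (hD p h1 h2))

theorem IshDom.mul {δ M a : ℝ} {f g : ℝ × ℝ × ℝ → ℝ} (hf : IshDom δ M f)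
    (hg : ∀ p, |g p| ≤ a) : IshDom δ M (fun p => g p * f p) := by
  obtain ⟨C, hC⟩ := hf
  refine ⟨a * C, fun p h1 h2 => ?_⟩
  have e : p.1 * (g p * f p) = g p * (p.1 * f p) := by ring
  rw [e, abs_mul, mul_assoc]
  exact mul_le_mul (hg p) (hC p h1 h2) (abs_nonneg _) ((abs_nonneg _).trans (hg p))

theorem IshDom.const_mul {δ M a : ℝ} {f : ℝ × ℝ × ℝ → ℝ} (hf : IshDom δ M f) :
    IshDom δ M (fun p => a * f p) := hf.mul (fun _ => le_refl |a|)

theorem IshDom.congr {δ M : ℝ} {f g : ℝ × ℝ × ℝ → ℝ} (hf : IshDom δ M f)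
    (h : ∀ p ∈ ishW, g p = f p) : IshDom δ M g := by
  obtain ⟨C, hC⟩ := hf
  exact ⟨C, fun p h1 h2 => by rw [h p h1]; exact hC p h1 h2⟩

/-- scalar test functions on positive time. -/
structure IshTest (M : ℝ) (g : ℝ × ℝ × ℝ → ℝ) : Prop where
  sm : ContDiff ℝ (⊤ : ℕ∞) g
  box : ∀ p, p ∉ ishBox M → g p = 0
  neg : ∀ p : ℝ × ℝ × ℝ, p.1 ≤ 0 → g p = 0

theorem ishBox_closed (M : ℝ) : IsClosed (ishBox M) := by
  have h0 : Continuous (fun p : ℝ × ℝ × ℝ => |p.1|) := by fun_prop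
  have h1 : Continuous (fun p : ℝ × ℝ × ℝ => |p.2.1|) := by fun_prop
  have h2 : Continuous (fun p : ℝ × ℝ × ℝ => |p.2.2|) := by fun_prop
  exact (isClosed_le h0 continuous_const).inter
    ((isClosed_le h1 continuous_const).inter (isClosed_le h2 continuous_const))

theorem ishBox_compact (M : ℝ) : IsCompact (ishBox M) := by
  have : ishBox M = Icc (-M) M ×ˢ (Icc (-M) M ×ˢ Icc (-M) M) := by
    ext ⟨t, x, y⟩
    simp only [ishBox, mem_prod, mem_Icc, ← abs_le]
    rfl
  rw [this]
  exact isCompact_Icc.prod (isCompact_Icc.prod isCompact_Icc)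

theorem IshTest.ishd {M : ℝ} {g : ℝ × ℝ × ℝ → ℝ} (h : IshTest M g) (v : ℝ × ℝ × ℝ) :
    IshTest M (ishd v g) := by
  have hs : ContDiff ℝ (⊤ : ℕ∞) (_root_.ishd v g) :=
    contDiff_iff_contDiffAt.2 fun p => ishd_smooth h.sm.contDiffAt
  have h0 : ∀ p, g =ᶠ[nhds p] (fun _ => 0) → _root_.ishd v g p = 0 := by
    intro p hp
    rw [ishd_congr hp]
    simp [_root_.ishd]
  refine ⟨hs, fun p hp => h0 p ?_, ?_⟩
  · filter_upwards [(ishBox_closed M).isOpen_compl.mem_nhds hp] with z hz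
    exact h.box z hz
  · rintro ⟨t, x⟩ ht
    simp only at ht
    have hneg : ∀ t < 0, _root_.ishd v g (t, x) = 0 := by
      intro t ht
      apply h0
      filter_upwards [(isOpen_lt continuous_fst continuous_const).mem_nhds
        (show ((t, x) : ℝ × ℝ × ℝ).1 < 0 from ht)] with z hz
      exact h.neg z (le_of_lt hz)
    rcases ht.lt_or_eq with h1 | h1
    · exact hneg t h1
    · subst h1
      have hc : Continuous (fun s : ℝ => _root_.ishd v g (s, x)) :=
        hs.continuous.comp (by fun_prop)
      have t1 : Tendsto (fun s : ℝ => _root_.ishd v g (s, x)) (nhdsWithin 0 (Iio 0))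
          (nhds (_root_.ishd v g (0, x))) := (hc.tendsto 0).mono_left nhdsWithin_le_nhds
      refine tendsto_nhds_unique t1 (Tendsto.congr' ?_ tendsto_const_nhds)
      filter_upwards [self_mem_nhdsWithin] with z hz
      exact (hneg z hz).symm

theorem IshTest.bdd {M : ℝ} {g : ℝ × ℝ × ℝ → ℝ} (h : IshTest M g) : ∃ C, ∀ p, |g p| ≤ C := by
  obtain ⟨C, hC⟩ := (ishBox_compact M).exists_bound_of_continuousOn h.sm.continuous.continuousOn
  refine ⟨max C 0, fun p => ?_⟩
  by_cases hp : p ∈ ishBox M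
  · exact (hC p hp).trans (le_max_left _ _)
  · rw [h.box p hp]; simp

theorem IshTest.lin {M : ℝ} {g : ℝ × ℝ × ℝ → ℝ} (h : IshTest M g) :
    ∃ C, ∀ p : ℝ × ℝ × ℝ, 0 < p.1 → |g p| ≤ C * p.1 := by
  obtain ⟨C, hC⟩ := (h.ishd et).bdd
  refine ⟨C, ?_⟩
  rintro ⟨t, x, y⟩ ht
  simp only at ht ⊢
  have := (convex_univ (𝕜 := ℝ) (E := ℝ)).norm_image_sub_le_of_norm_hasDerivWithin_le
    (f := fun z => g (z, x, y)) (f' := fun z => _root_.ishd et g (z, x, y)) (C := C) (x := 0) (y := t)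
    (fun z _ => (ishd_t h.sm.contDiffAt).hasDerivWithinAt) (fun z _ => hC _) (mem_univ _) (mem_univ _)
  rw [h.neg (0, x, y) le_rfl] at this
  simpa [abs_of_pos ht] using this

theorem IshTest.integrable {δ M : ℝ} {g f : ℝ × ℝ × ℝ → ℝ} (hδ : 0 < δ) (hM : 0 < M)
    (h : IshTest M g) (hf : IshDom δ M f) (hc : ContinuousOn f ishW) :
    Integrable (ishW.indicator fun p => g p * f p) := by
  obtain ⟨C, hC⟩ := h.lin
  obtain ⟨D, hD⟩ := hf
  refine ish_integrable (C := |C| * D) hδ hM (h.sm.continuous.continuousOn.mul hc) ?_ ?_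
  · intro p hp; rw [h.box p hp, zero_mul]
  · intro p h1 h2
    have h3 := hD p h1 h2
    have h4 := hC p h1.1
    rw [abs_mul] at h3 ⊢
    rw [abs_of_pos h1.1] at h3
    calc |g p| * |f p| ≤ (|C| * p.1) * |f p| := by
          gcongr
          exact h4.trans (mul_le_mul_of_nonneg_right (le_abs_self _) h1.1.le)
      _ = |C| * (p.1 * |f p|) := by ring
      _ ≤ |C| * (D * ishOm δ p) := by gcongr
      _ = _ := by ring

theorem ish_cont_W {f : ℝ × ℝ × ℝ → ℝ} (h : ∀ p ∈ ishW, ContDiffAt ℝ (⊤ : ℕ∞) f p) :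
    ContinuousOn f ishW := fun p hp => (h p hp).continuousAt.continuousWithinAt

theorem ish_divT_y {δ M : ℝ} {g A : ℝ × ℝ × ℝ → ℝ} (hδ : 0 < δ) (hM : 0 < M) (h : IshTest M g)
    (hA : ∀ p ∈ ishW, ContDiffAt ℝ (⊤ : ℕ∞) A p) (h1 : IshDom δ M A) (h2 : IshDom δ M (ishd ey A))
    (h3 : ∀ t ξ, 0 < t → ξ ≠ 0 → ∃ l, Tendsto (fun z => A (t, ξ, z)) (nhdsWithin 0 {0}ᶜ) (nhds l)) :
    Integrable (ishW.indicator fun p => ishd ey g p * A p + g p * ishd ey A p) ∧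
    ∫ p, ishW.indicator (fun p => ishd ey g p * A p + g p * ishd ey A p) p = 0 := by
  have hI : Integrable (ishW.indicator fun p => ishd ey g p * A p + g p * ishd ey A p) := by
    have a1 := (h.ishd ey).integrable hδ hM h1 (ish_cont_W hA)
    have a2 := h.integrable hδ hM h2 (ish_cont_W fun p hp => ishd_smooth (hA p hp))
    have := a1.add a2
    rwa [← Set.indicator_add'] at this
  refine ⟨hI, ish_div_y (W := fun p => g p * A p) (M := M + 1) (by linarith) hI ?_ ?_ ?_⟩
  · intro t ξ η hp
    exact (ishd_y h.sm.contDiffAt).mul (ishd_y (hA _ hp))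
  · intro t ξ ht hξ
    obtain ⟨l, hl⟩ := h3 t ξ ht hξ
    refine ⟨g (t, ξ, 0) * l, Tendsto.mul ?_ hl⟩
    have hc : Continuous (fun z => g (t, ξ, z)) := h.sm.continuous.comp (by fun_prop)
    exact (hc.tendsto 0).mono_left nhdsWithin_le_nhds
  · intro t ξ η hη
    show g (t, ξ, η) * _ = 0
    rw [h.box _ (fun hh => ?_), zero_mul]
    have : |η| ≤ M := hh.2.2
    linarith

theorem ish_divT_x {δ M : ℝ} {g A : ℝ × ℝ × ℝ → ℝ} (hδ : 0 < δ) (hM : 0 < M) (h : IshTest M g)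
    (hA : ∀ p ∈ ishW, ContDiffAt ℝ (⊤ : ℕ∞) A p) (h1 : IshDom δ M A) (h2 : IshDom δ M (ishd ex A))
    (h3 : ∀ t η, 0 < t → η ≠ 0 → ∃ l, Tendsto (fun z => A (t, z, η)) (nhdsWithin 0 {0}ᶜ) (nhds l)) :
    Integrable (ishW.indicator fun p => ishd ex g p * A p + g p * ishd ex A p) ∧
    ∫ p, ishW.indicator (fun p => ishd ex g p * A p + g p * ishd ex A p) p = 0 := by
  have hI : Integrable (ishW.indicator fun p => ishd ex g p * A p + g p * ishd ex A p) := by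
    have a1 := (h.ishd ex).integrable hδ hM h1 (ish_cont_W hA)
    have a2 := h.integrable hδ hM h2 (ish_cont_W fun p hp => ishd_smooth (hA p hp))
    have := a1.add a2
    rwa [← Set.indicator_add'] at this
  refine ⟨hI, ish_div_x (W := fun p => g p * A p) (M := M + 1) (by linarith) hI ?_ ?_ ?_⟩
  · intro t ξ η hp
    exact (ishd_x h.sm.contDiffAt).mul (ishd_x (hA _ hp))
  · intro t η ht hη
    obtain ⟨l, hl⟩ := h3 t η ht hη
    refine ⟨g (t, 0, η) * l, Tendsto.mul ?_ hl⟩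
    have hc : Continuous (fun z => g (t, z, η)) := h.sm.continuous.comp (by fun_prop)
    exact (hc.tendsto 0).mono_left nhdsWithin_le_nhds
  · intro t ξ η hη
    show g (t, ξ, η) * _ = 0
    rw [h.box _ (fun hh => ?_), zero_mul]
    have : |ξ| ≤ M := hh.2.1
    linarith

theorem ish_divT_t {δ M a : ℝ} {g A : ℝ × ℝ × ℝ → ℝ} (hδ : 0 < δ) (hM : 0 < M) (h : IshTest M g)
    (hA : ∀ p ∈ ishW, ContDiffAt ℝ (⊤ : ℕ∞) A p) (h1 : IshDom δ M A) (h2 : IshDom δ M (ishd et A))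
    (h3 : ∀ p ∈ ishW, |A p| ≤ a) :
    Integrable (ishW.indicator fun p => ishd et g p * A p + g p * ishd et A p) ∧
    ∫ p, ishW.indicator (fun p => ishd et g p * A p + g p * ishd et A p) p = 0 := by
  have hI : Integrable (ishW.indicator fun p => ishd et g p * A p + g p * ishd et A p) := by
    have a1 := (h.ishd et).integrable hδ hM h1 (ish_cont_W hA)
    have a2 := h.integrable hδ hM h2 (ish_cont_W fun p hp => ishd_smooth (hA p hp))
    have := a1.add a2
    rwa [← Set.indicator_add'] at this
  refine ⟨hI, ish_div_t (W := fun p => g p * A p) (M := M + 1) (by linarith) hI ?_ ?_ ?_⟩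
  · intro t ξ η hp
    exact (ishd_t h.sm.contDiffAt).mul (ishd_t (hA _ hp))
  · intro ξ η hξ hη
    obtain ⟨C, hC⟩ := h.lin
    have hz : Tendsto (fun z : ℝ => C * z * a) (nhdsWithin 0 (Ioi 0)) (nhds 0) := by
      have : Continuous (fun z : ℝ => C * z * a) := by fun_prop
      have := this.tendsto 0
      simp only [mul_zero, zero_mul] at this
      exact this.mono_left nhdsWithin_le_nhds
    refine squeeze_zero_norm' ?_ hz
    filter_upwards [self_mem_nhdsWithin] with z hz
    rw [norm_mul]
    have b1 := hC (z, ξ, η) hz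
    exact mul_le_mul b1 (h3 _ ⟨hz, hξ, hη⟩) (norm_nonneg _) ((abs_nonneg _).trans b1)
  · intro t ξ η hη
    show g (t, ξ, η) * _ = 0
    rw [h.box _ (fun hh => ?_), zero_mul]
    have : |t| ≤ M := hh.1
    linarith

theorem ish_one {δ M x : ℝ} (hδ : 0 < δ) (hδ1 : δ ≤ 1 / 8) (hM : 1 ≤ M) (hx : 0 < x) (hxM : x ≤ M) :
    0 < x ^ δ ∧ x ^ δ ≤ M ∧ x ≤ M * (x ^ δ) ^ 8 ∧ |Real.log x| ≤ (M ^ 2 + 1 / δ) / x ^ δ := by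
  have h1 : 0 < x ^ δ := by positivity
  have h2 : x ^ δ ≤ M := by
    calc x ^ δ ≤ M ^ δ := by gcongr
      _ ≤ M ^ (1:ℝ) := Real.rpow_le_rpow_of_exponent_le hM (by linarith)
      _ = M := Real.rpow_one M
  refine ⟨h1, h2, ?_, ?_⟩
  · have e : x = x ^ (1 - 8 * δ) * (x ^ δ) ^ 8 := by
      rw [← Real.rpow_natCast (x ^ δ), ← Real.rpow_mul hx.le, ← Real.rpow_add hx]
      rw [show 1 - 8 * δ + δ * ((8:ℕ):ℝ) = 1 by push_cast; ring, Real.rpow_one]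
    have h3 : x ^ (1 - 8 * δ) ≤ M := by
      calc x ^ (1 - 8 * δ) ≤ M ^ (1 - 8 * δ) := Real.rpow_le_rpow hx.le hxM (by linarith)
        _ ≤ M ^ (1:ℝ) := Real.rpow_le_rpow_of_exponent_le hM (by linarith)
        _ = M := Real.rpow_one M
    calc x = x ^ (1 - 8 * δ) * (x ^ δ) ^ 8 := e
      _ ≤ _ := by gcongr
  · rw [le_div_iff₀ h1]
    have hd : 0 < 1 / δ := by positivity
    rcases le_total 1 x with h | h
    · rw [abs_of_nonneg (Real.log_nonneg h)]
      have h3 : Real.log x ≤ M := (Real.log_le_sub_one_of_pos hx).trans (by linarith)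
      calc Real.log x * x ^ δ ≤ M * M := by gcongr
        _ ≤ _ := by rw [← sq]; linarith
    · rw [abs_of_nonpos (Real.log_nonpos hx.le h), ← Real.log_inv]
      have h3 := Real.log_le_rpow_div (inv_nonneg.2 hx.le) hδ
      calc Real.log x⁻¹ * x ^ δ ≤ (x⁻¹ ^ δ / δ) * x ^ δ := by gcongr
        _ = 1 / δ := by
          rw [Real.inv_rpow hx.le]; field_simp
        _ ≤ _ := by nlinarith

def IshLe (S : Set (ℝ × ℝ × ℝ)) (D f : ℝ × ℝ × ℝ → ℝ) : Prop :=
  ∃ C, 0 ≤ C ∧ ∀ p ∈ S, |f p| ≤ C * D p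

noncomputable def ishX (δ : ℝ) (p : ℝ × ℝ × ℝ) : ℝ := |p.2.1| ^ δ
noncomputable def ishY (δ : ℝ) (p : ℝ × ℝ × ℝ) : ℝ := |p.2.2| ^ δ
noncomputable def ishZ (δ : ℝ) (p : ℝ × ℝ × ℝ) : ℝ := p.1 ^ δ
noncomputable def ishIx (p : ℝ × ℝ × ℝ) : ℝ := 1 / |p.2.1|
noncomputable def ishIy (p : ℝ × ℝ × ℝ) : ℝ := 1 / |p.2.2|
noncomputable def ishw (δ : ℝ) (p : ℝ × ℝ × ℝ) : ℝ := (ishX δ p * ishY δ p / ishZ δ p) ^ 2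
noncomputable def ishA (δ : ℝ) (p : ℝ × ℝ × ℝ) : ℝ := 1 / (ishX δ p * ishY δ p * ishZ δ p ^ 2)
noncomputable def ishB (δ : ℝ) (p : ℝ × ℝ × ℝ) : ℝ := ishX δ p * ishY δ p / ishZ δ p ^ 4
noncomputable def ishH (p : ℝ × ℝ × ℝ) : ℝ := (ishIx p + 1) * (ishIy p + 1) * (1 + 1 / p.1)

structure IshFacts (M δ : ℝ) (p : ℝ × ℝ × ℝ) : Prop where
  x0 : 0 < ishX δ p
  y0 : 0 < ishY δ p
  z0 : 0 < ishZ δ p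
  xM : ishX δ p ≤ M
  yM : ishY δ p ≤ M
  zM : ishZ δ p ≤ M
  x8 : |p.2.1| ≤ M * ishX δ p ^ 8
  y8 : |p.2.2| ≤ M * ishY δ p ^ 8
  z8 : p.1 ≤ M * ishZ δ p ^ 8
  lx : |Real.log p.2.1| ≤ (M ^ 2 + 1 / δ) / ishX δ p
  ly : |Real.log p.2.2| ≤ (M ^ 2 + 1 / δ) / ishY δ p
  lz : |Real.log p.1| ≤ (M ^ 2 + 1 / δ) / ishZ δ p

theorem ish_facts {δ M : ℝ} {p : ℝ × ℝ × ℝ} (hδ : 0 < δ) (hδ1 : δ ≤ 1 / 8) (hM : 1 ≤ M)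
    (hp : p ∈ ishW) (hb : p ∈ ishBox M) : IshFacts M δ p := by
  obtain ⟨h0, h1, h2⟩ := hp
  obtain ⟨b0, b1, b2⟩ := hb
  rw [abs_of_pos h0] at b0
  obtain ⟨u1, u2, u3, u4⟩ := ish_one hδ hδ1 hM h0 b0
  obtain ⟨v1, v2, v3, v4⟩ := ish_one hδ hδ1 hM (abs_pos.2 h1) b1
  obtain ⟨w1, w2, w3, w4⟩ := ish_one hδ hδ1 hM (abs_pos.2 h2) b2
  rw [Real.log_abs] at v4 w4
  exact ⟨v1, w1, u1, v2, w2, u2, v3, w3, u3, v4, w4, u4⟩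

theorem ishIx_pos {p : ℝ × ℝ × ℝ} (hp : p ∈ ishW) : 0 < ishIx p := by
  have := abs_pos.2 hp.2.1; unfold ishIx; positivity
theorem ishIy_pos {p : ℝ × ℝ × ℝ} (hp : p ∈ ishW) : 0 < ishIy p := by
  have := abs_pos.2 hp.2.2; unfold ishIy; positivity

theorem IshLe.mono {S T : Set (ℝ × ℝ × ℝ)} {D f : ℝ × ℝ × ℝ → ℝ} (h : IshLe S D f) (hT : T ⊆ S) :
    IshLe T D f := by
  obtain ⟨C, h0, hC⟩ := h
  exact ⟨C, h0, fun p hp => hC p (hT hp)⟩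

theorem IshLe.weak {S : Set (ℝ × ℝ × ℝ)} {D D' f : ℝ × ℝ × ℝ → ℝ} {a : ℝ} (h : IshLe S D f)
    (ha : 0 ≤ a) (hD : ∀ p ∈ S, D p ≤ a * D' p) : IshLe S D' f := by
  obtain ⟨C, h0, hC⟩ := h
  refine ⟨C * a, by positivity, fun p hp => (hC p hp).trans ?_⟩
  rw [mul_assoc]
  exact mul_le_mul_of_nonneg_left (hD p hp) h0

theorem IshLe.congr {S : Set (ℝ × ℝ × ℝ)} {D f g : ℝ × ℝ × ℝ → ℝ} (h : IshLe S D f)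
    (hg : ∀ p ∈ S, g p = f p) : IshLe S D g := by
  obtain ⟨C, h0, hC⟩ := h
  exact ⟨C, h0, fun p hp => by rw [hg p hp]; exact hC p hp⟩

theorem IshLe.add {S : Set (ℝ × ℝ × ℝ)} {D f g : ℝ × ℝ × ℝ → ℝ} (h : IshLe S D f)
    (hg : IshLe S D g) : IshLe S D (fun p => f p + g p) := by
  obtain ⟨C, h0, hC⟩ := h
  obtain ⟨C', h0', hC'⟩ := hg
  refine ⟨C + C', by positivity, fun p hp => (abs_add_le _ _).trans ?_⟩
  rw [add_mul]
  exact add_le_add (hC p hp) (hC' p hp)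

theorem IshLe.cmul {S : Set (ℝ × ℝ × ℝ)} {D f : ℝ × ℝ × ℝ → ℝ} (a : ℝ) (h : IshLe S D f) :
    IshLe S D (fun p => a * f p) := by
  obtain ⟨C, h0, hC⟩ := h
  refine ⟨|a| * C, by positivity, fun p hp => ?_⟩
  rw [abs_mul, mul_assoc]
  exact mul_le_mul_of_nonneg_left (hC p hp) (abs_nonneg _)

theorem IshLe.sub {S : Set (ℝ × ℝ × ℝ)} {D f g : ℝ × ℝ × ℝ → ℝ} (h : IshLe S D f)
    (hg : IshLe S D g) : IshLe S D (fun p => f p - g p) :=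
  (h.add (hg.cmul (-1))).congr (fun p _ => by ring)

theorem IshLe.mul {S : Set (ℝ × ℝ × ℝ)} {D D' f g : ℝ × ℝ × ℝ → ℝ} (h : IshLe S D f)
    (hg : IshLe S D' g) : IshLe S (fun p => D p * D' p) (fun p => f p * g p) := by
  obtain ⟨C, h0, hC⟩ := h
  obtain ⟨C', h0', hC'⟩ := hg
  refine ⟨C * C', by positivity, fun p hp => ?_⟩
  rw [abs_mul]
  calc |f p| * |g p| ≤ (C * D p) * (C' * D' p) :=
        mul_le_mul (hC p hp) (hC' p hp) (abs_nonneg _) ((abs_nonneg _).trans (hC p hp))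
    _ = _ := by ring

theorem ishOm_eq {δ : ℝ} {p : ℝ × ℝ × ℝ} (hp : p ∈ ishW) :
    ishOm δ p = ishX δ p * ishY δ p * ishZ δ p / (p.1 * |p.2.1| * |p.2.2|) := by
  have h1 := abs_pos.2 hp.2.1
  have h2 := abs_pos.2 hp.2.2
  have h0 : 0 < p.1 := hp.1
  unfold ishOm ishX ishY ishZ
  rw [abs_of_pos h0, Real.rpow_sub_one h0.ne', Real.rpow_sub_one h1.ne', Real.rpow_sub_one h2.ne']
  field_simp

theorem IshLe.domA {δ M : ℝ} {f : ℝ × ℝ × ℝ → ℝ} (hδ : 0 < δ) (hδ1 : δ ≤ 1 / 8) (hM : 1 ≤ M)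
    (h : IshLe (ishW ∩ ishBox M) (ishA δ) f) : IshDom δ M f := by
  obtain ⟨C, h0, hC⟩ := h
  refine ⟨C * (M ^ 4 * (M ^ 13 * M ^ 6 * M ^ 6)), fun p hp hb => ?_⟩
  have F := ish_facts hδ hδ1 hM hp hb
  have h1 := abs_pos.2 hp.2.1
  have h2 := abs_pos.2 hp.2.2
  have ht : 0 < p.1 := hp.1
  have hM0 : 0 < M := by linarith
  rw [abs_mul, abs_of_pos ht, ishOm_eq hp]
  have := hC p ⟨hp, hb⟩
  unfold ishA at this
  obtain ⟨x0, y0, z0, xM, yM, zM, x8, y8, z8, -, -, -⟩ := F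
  generalize ishX δ p = X at *
  generalize ishY δ p = Y at *
  generalize ishZ δ p = Z at *
  rw [mul_div_assoc', le_div_iff₀ (by positivity)]
  calc p.1 * |f p| * (p.1 * |p.2.1| * |p.2.2|)
      ≤ p.1 * (C * (1 / (X * Y * Z ^ 2))) * (p.1 * |p.2.1| * |p.2.2|) := by gcongr
    _ ≤ (M * Z ^ 8) * (C * (1 / (X * Y * Z ^ 2))) * ((M * Z ^ 8) * (M * X ^ 8) * (M * Y ^ 8)) := by
        gcongr
    _ = C * (M ^ 4 * (Z ^ 13 * X ^ 6 * Y ^ 6)) * (X * Y * Z) := by field_simp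
    _ ≤ _ := by gcongr

theorem IshLe.domB {δ M : ℝ} {f : ℝ × ℝ × ℝ → ℝ} (hδ : 0 < δ) (hδ1 : δ ≤ 1 / 8) (hM : 1 ≤ M)
    (h : IshLe (ishW ∩ ishBox M) (fun p => ishB δ p * ishH p) f) : IshDom δ M f := by
  obtain ⟨C, h0, hC⟩ := h
  refine ⟨C * ((1 + M) * (1 + M) * (1 + M) * (M * M ^ 3)), fun p hp hb => ?_⟩
  have F := ish_facts hδ hδ1 hM hp hb
  have h1 := abs_pos.2 hp.2.1
  have h2 := abs_pos.2 hp.2.2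
  have ht : 0 < p.1 := hp.1
  have hM0 : 0 < M := by linarith
  rw [abs_mul, abs_of_pos ht, ishOm_eq hp]
  have := hC p ⟨hp, hb⟩
  beta_reduce at this
  unfold ishB ishH ishIx ishIy at this
  obtain ⟨x0, y0, z0, xM, yM, zM, x8, y8, z8, -, -, -⟩ := F
  obtain ⟨b0, b1, b2⟩ := hb
  rw [abs_of_pos ht] at b0
  generalize ishX δ p = X at *
  generalize ishY δ p = Y at *
  generalize ishZ δ p = Z at *
  rw [mul_div_assoc', le_div_iff₀ (by positivity)]
  calc p.1 * |f p| * (p.1 * |p.2.1| * |p.2.2|)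
      ≤ p.1 * (C * (X * Y / Z ^ 4 * ((1 / |p.2.1| + 1) * (1 / |p.2.2| + 1) * (1 + 1 / p.1)))) * (p.1 * |p.2.1| * |p.2.2|) := by gcongr
    _ = C * ((1 + |p.2.1|) * (1 + |p.2.2|) * (1 + p.1) * (p.1 * (X * Y / Z ^ 4))) := by field_simp; ring
    _ ≤ C * ((1 + M) * (1 + M) * (1 + M) * ((M * Z ^ 8) * (X * Y / Z ^ 4))) := by gcongr
    _ = C * ((1 + M) * (1 + M) * (1 + M) * (M * Z ^ 3)) * (X * Y * Z) := by field_simp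
    _ ≤ _ := by gcongr

section
variable {δ M : ℝ} {f : ℝ × ℝ × ℝ → ℝ}

theorem ish_wB (hδ : 0 < δ) (hδ1 : δ ≤ 1 / 8) (hM : 1 ≤ M) {p : ℝ × ℝ × ℝ}
    (hp : p ∈ ishW ∩ ishBox M) : ishw δ p ≤ M ^ 4 * ishB δ p := by
  have F := ish_facts hδ hδ1 hM hp.1 hp.2
  obtain ⟨x0, y0, z0, xM, yM, zM, x8, y8, z8, -, -, -⟩ := F
  have hM0 : 0 < M := by linarith
  unfold ishw ishB
  generalize ishX δ p = X at *
  generalize ishY δ p = Y at *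
  generalize ishZ δ p = Z at *
  calc (X * Y / Z) ^ 2 = (X * Y * Z ^ 2) * (X * Y / Z ^ 4) := by field_simp
    _ ≤ (M * M * M ^ 2) * (X * Y / Z ^ 4) := by gcongr
    _ = _ := by ring

theorem ish_wA (hδ : 0 < δ) (hδ1 : δ ≤ 1 / 8) (hM : 1 ≤ M) {p : ℝ × ℝ × ℝ}
    (hp : p ∈ ishW ∩ ishBox M) : ishw δ p ≤ M ^ 6 * ishA δ p := by
  have F := ish_facts hδ hδ1 hM hp.1 hp.2
  obtain ⟨x0, y0, z0, xM, yM, zM, x8, y8, z8, -, -, -⟩ := F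
  have hM0 : 0 < M := by linarith
  unfold ishw ishA
  generalize ishX δ p = X at *
  generalize ishY δ p = Y at *
  generalize ishZ δ p = Z at *
  calc (X * Y / Z) ^ 2 = (X ^ 3 * Y ^ 3) * (1 / (X * Y * Z ^ 2)) := by field_simp
    _ ≤ (M ^ 3 * M ^ 3) * (1 / (X * Y * Z ^ 2)) := by gcongr
    _ = _ := by ring

theorem ish_1A (hδ : 0 < δ) (hδ1 : δ ≤ 1 / 8) (hM : 1 ≤ M) {p : ℝ × ℝ × ℝ}
    (hp : p ∈ ishW ∩ ishBox M) : 1 ≤ M ^ 4 * ishA δ p := by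
  have F := ish_facts hδ hδ1 hM hp.1 hp.2
  obtain ⟨x0, y0, z0, xM, yM, zM, x8, y8, z8, -, -, -⟩ := F
  have hM0 : 0 < M := by linarith
  unfold ishA
  generalize ishX δ p = X at *
  generalize ishY δ p = Y at *
  generalize ishZ δ p = Z at *
  rw [mul_one_div, le_div_iff₀ (by positivity), one_mul]
  calc X * Y * Z ^ 2 ≤ M * M * M ^ 2 := by gcongr
    _ = _ := by ring

theorem ish_AwB {p : ℝ × ℝ × ℝ} (hp : p ∈ ishW) : ishA δ p * ishw δ p = ishB δ p := by
  have h1 : 0 < ishX δ p := Real.rpow_pos_of_pos (abs_pos.2 hp.2.1) _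
  have h2 : 0 < ishY δ p := Real.rpow_pos_of_pos (abs_pos.2 hp.2.2) _
  have h3 : 0 < ishZ δ p := Real.rpow_pos_of_pos hp.1 _
  unfold ishA ishw ishB
  field_simp

theorem ishw_pos {p : ℝ × ℝ × ℝ} (hp : p ∈ ishW) : 0 < ishw δ p := by
  have h1 : 0 < ishX δ p := Real.rpow_pos_of_pos (abs_pos.2 hp.2.1) _
  have h2 : 0 < ishY δ p := Real.rpow_pos_of_pos (abs_pos.2 hp.2.2) _
  have h3 : 0 < ishZ δ p := Real.rpow_pos_of_pos hp.1 _
  unfold ishw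
  positivity

theorem ishB_pos {p : ℝ × ℝ × ℝ} (hp : p ∈ ishW) : 0 < ishB δ p := by
  have h1 : 0 < ishX δ p := Real.rpow_pos_of_pos (abs_pos.2 hp.2.1) _
  have h2 : 0 < ishY δ p := Real.rpow_pos_of_pos (abs_pos.2 hp.2.2) _
  have h3 : 0 < ishZ δ p := Real.rpow_pos_of_pos hp.1 _
  unfold ishB
  positivity

theorem ish_logA (hδ : 0 < δ) (hδ1 : δ ≤ 1 / 8) (hM : 1 ≤ M) :
    IshLe (ishW ∩ ishBox M) (ishA δ) (fun p => Real.log p.2.1) ∧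
    IshLe (ishW ∩ ishBox M) (ishA δ) (fun p => Real.log p.2.2) ∧
    IshLe (ishW ∩ ishBox M) (ishA δ) (fun p => Real.log p.1) := by
  have hM0 : 0 < M := by linarith
  have hC : 0 ≤ M ^ 2 + 1 / δ := by positivity
  refine ⟨⟨(M ^ 2 + 1 / δ) * M ^ 3, by positivity, fun p hp => ?_⟩,
    ⟨(M ^ 2 + 1 / δ) * M ^ 3, by positivity, fun p hp => ?_⟩,
    ⟨(M ^ 2 + 1 / δ) * M ^ 3, by positivity, fun p hp => ?_⟩⟩
  all_goals
    have F := ish_facts hδ hδ1 hM hp.1 hp.2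
    obtain ⟨x0, y0, z0, xM, yM, zM, -, -, -, lx, ly, lz⟩ := F
    unfold ishA
    generalize ishX δ p = X at *
    generalize ishY δ p = Y at *
    generalize ishZ δ p = Z at *
    generalize M ^ 2 + 1 / δ = C at *
  · refine lx.trans ?_
    calc C / X = C * (Y * Z ^ 2) * (1 / (X * Y * Z ^ 2)) := by field_simp
      _ ≤ C * (M * M ^ 2) * (1 / (X * Y * Z ^ 2)) := by gcongr
      _ = _ := by ring
  · refine ly.trans ?_
    calc C / Y = C * (X * Z ^ 2) * (1 / (X * Y * Z ^ 2)) := by field_simp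
      _ ≤ C * (M * M ^ 2) * (1 / (X * Y * Z ^ 2)) := by gcongr
      _ = _ := by ring
  · refine lz.trans ?_
    calc C / Z = C * (X * Y * Z) * (1 / (X * Y * Z ^ 2)) := by field_simp
      _ ≤ C * (M * M * M) * (1 / (X * Y * Z ^ 2)) := by gcongr
      _ = _ := by ring

theorem ishH_ge {p : ℝ × ℝ × ℝ} (hp : p ∈ ishW) :
    1 ≤ ishH p ∧ ishIx p ≤ ishH p ∧ ishIy p ≤ ishH p ∧ 1 / p.1 ≤ ishH p ∧ ishIx p * ishIy p ≤ ishH p := by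
  have h1 := ishIx_pos hp
  have h2 := ishIy_pos hp
  have h3 : 0 < 1 / p.1 := by have : 0 < p.1 := hp.1; positivity
  unfold ishH
  generalize ishIx p = I at *
  generalize ishIy p = J at *
  generalize 1 / p.1 = K at *
  have : (I + 1) * (J + 1) * (1 + K) = I * J + I + J + 1 + I * J * K + I * K + J * K + K := by ring
  rw [this]
  have a1 : 0 < I * J := by positivity
  have a2 : 0 < I * J * K := by positivity
  have a3 : 0 < I * K := by positivity
  have a4 : 0 < J * K := by positivity
  refine ⟨?_, ?_, ?_, ?_, ?_⟩ <;> linarith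

/-- the slice limits. -/
theorem ish_slc_y (hδ : 0 < δ) {h : ℝ × ℝ × ℝ → ℝ} {h' : ℝ → ℝ → ℝ}
    (hh : ∀ p, h p = h' p.1 p.2.1)
    (hf : ∀ M ≥ 1, IshLe (ishW ∩ ishBox M) (fun p => ishB δ p * h p) f) (t ξ : ℝ) (ht : 0 < t)
    (hξ : ξ ≠ 0) : Tendsto (fun z => f (t, ξ, z)) (nhdsWithin 0 {0}ᶜ) (nhds 0) := by
  obtain ⟨C, h0, hC⟩ := hf (1 + t + |ξ|) (by have := abs_nonneg ξ; linarith)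
  have hl : Tendsto (fun z : ℝ => C * (|ξ| ^ δ * |z| ^ δ / (t ^ δ) ^ 4 * h' t ξ))
      (nhdsWithin 0 {0}ᶜ) (nhds 0) := by
    have hc : Continuous (fun z : ℝ => C * (|ξ| ^ δ * |z| ^ δ / (t ^ δ) ^ 4 * h' t ξ)) := by
      have : Continuous (fun z : ℝ => |z| ^ δ) := continuous_abs.rpow_const (fun _ => Or.inr hδ.le)
      fun_prop
    have := hc.tendsto 0
    simp only [abs_zero, Real.zero_rpow hδ.ne', mul_zero, zero_div, zero_mul] at this
    exact this.mono_left nhdsWithin_le_nhds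
  refine squeeze_zero_norm' ?_ hl
  filter_upwards [self_mem_nhdsWithin, nhdsWithin_le_nhds (Metric.ball_mem_nhds (0:ℝ) one_pos)] with z hz hz1
  have hz2 : |z| < 1 := by simpa [Metric.mem_ball, Real.dist_eq] using hz1
  have := hC (t, ξ, z) ⟨⟨ht, hξ, hz⟩, ?_⟩
  · beta_reduce at this
    rw [hh] at this
    exact this
  · refine ⟨?_, ?_, ?_⟩ <;> simp only
    · rw [abs_of_pos ht]; have := abs_nonneg ξ; linarith
    · linarith
    · have := abs_nonneg ξ; linarith

theorem ish_slc_x (hδ : 0 < δ) {h : ℝ × ℝ × ℝ → ℝ} {h' : ℝ → ℝ → ℝ}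
    (hh : ∀ p, h p = h' p.1 p.2.2)
    (hf : ∀ M ≥ 1, IshLe (ishW ∩ ishBox M) (fun p => ishB δ p * h p) f) (t ξ : ℝ) (ht : 0 < t)
    (hξ : ξ ≠ 0) : Tendsto (fun z => f (t, z, ξ)) (nhdsWithin 0 {0}ᶜ) (nhds 0) := by
  obtain ⟨C, h0, hC⟩ := hf (1 + t + |ξ|) (by have := abs_nonneg ξ; linarith)
  have hl : Tendsto (fun z : ℝ => C * (|z| ^ δ * |ξ| ^ δ / (t ^ δ) ^ 4 * h' t ξ))
      (nhdsWithin 0 {0}ᶜ) (nhds 0) := by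
    have hc : Continuous (fun z : ℝ => C * (|z| ^ δ * |ξ| ^ δ / (t ^ δ) ^ 4 * h' t ξ)) := by
      have : Continuous (fun z : ℝ => |z| ^ δ) := continuous_abs.rpow_const (fun _ => Or.inr hδ.le)
      fun_prop
    have := hc.tendsto 0
    simp only [abs_zero, Real.zero_rpow hδ.ne', mul_zero, zero_div, zero_mul] at this
    exact this.mono_left nhdsWithin_le_nhds
  refine squeeze_zero_norm' ?_ hl
  filter_upwards [self_mem_nhdsWithin, nhdsWithin_le_nhds (Metric.ball_mem_nhds (0:ℝ) one_pos)] with z hz hz1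
  have hz2 : |z| < 1 := by simpa [Metric.mem_ball, Real.dist_eq] using hz1
  have := hC (t, z, ξ) ⟨⟨ht, hz, hξ⟩, ?_⟩
  · beta_reduce at this
    rw [hh] at this
    exact this
  · refine ⟨?_, ?_, ?_⟩ <;> simp only
    · rw [abs_of_pos ht]; have := abs_nonneg ξ; linarith
    · have := abs_nonneg ξ; linarith
    · linarith
end

theorem ish_int3 {a b c : ℝ × ℝ × ℝ → ℝ} (i1 : Integrable a) (i2 : Integrable b) (i3 : Integrable c)
    (e1 : ∫ p, a p = 0) (e2 : ∫ p, b p = 0) (e3 : ∫ p, c p = 0) :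
    Integrable (fun p => a p + b p + c p) ∧ ∫ p, (fun p => a p + b p + c p) p = 0 := by
  have i12 : Integrable (fun p => a p + b p) := i1.add i2
  refine ⟨i12.add i3, ?_⟩
  beta_reduce
  rw [integral_add i12 i3, integral_add i1 i2, e1, e2, e3]
  simp

structure IshC (δ : ℝ) (f : ℝ × ℝ × ℝ → ℝ) : Prop where
  sm : ∀ p ∈ ishW, ContDiffAt ℝ (⊤ : ℕ∞) f p
  b0 : IshLe ishW (fun _ => 1) f
  bx : IshLe ishW ishIx (ishd ex f)
  by' : IshLe ishW ishIy (ishd ey f)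
  bxw : IshLe ishW (fun p => ishw δ p * ishIx p) (ishd ex f)
  byw : IshLe ishW (fun p => ishw δ p * ishIy p) (ishd ey f)
  bt : IshLe ishW (fun p => ishw δ p * (1 / p.1)) (ishd et f)
  bxy : IshLe ishW (fun p => ishw δ p * (ishIx p * ishIy p + 1 / p.1)) (ishd ey (ishd ex f))

structure IshP (δ : ℝ) (Φ : ℝ × ℝ × ℝ → ℝ) : Prop where
  sm : ∀ p ∈ ishW, ContDiffAt ℝ (⊤ : ℕ∞) Φ p
  b0 : ∀ M ≥ 1, IshLe (ishW ∩ ishBox M) (ishA δ) Φ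
  bx : IshLe ishW ishIx (ishd ex Φ)
  by' : IshLe ishW ishIy (ishd ey Φ)

section
variable {δ M : ℝ}

theorem IshLe.oneA (hδ : 0 < δ) (hδ1 : δ ≤ 1 / 8) (hM : 1 ≤ M) {f : ℝ × ℝ × ℝ → ℝ}
    (h : IshLe ishW (fun _ => 1) f) : IshLe (ishW ∩ ishBox M) (ishA δ) f :=
  (h.mono inter_subset_left).weak (a := M ^ 4) (by positivity) (fun _ hp => ish_1A hδ hδ1 hM hp)

theorem IshLe.AW {f g h : ℝ × ℝ × ℝ → ℝ} (h1 : IshLe (ishW ∩ ishBox M) (ishA δ) f)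
    (h2 : IshLe ishW (fun p => ishw δ p * h p) g) :
    IshLe (ishW ∩ ishBox M) (fun p => ishB δ p * h p) (fun p => f p * g p) := by
  refine (h1.mul (h2.mono inter_subset_left)).weak (a := 1) zero_le_one (fun p hp => ?_)
  rw [← ish_AwB hp.1]
  apply le_of_eq; ring

theorem IshLe.WB (hδ : 0 < δ) (hδ1 : δ ≤ 1 / 8) (hM : 1 ≤ M) {f h : ℝ × ℝ × ℝ → ℝ}
    (hh : ∀ p ∈ ishW, 0 ≤ h p)
    (h2 : IshLe ishW (fun p => ishw δ p * h p) f) :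
    IshLe (ishW ∩ ishBox M) (fun p => ishB δ p * h p) f := by
  refine (h2.mono inter_subset_left).weak (a := M ^ 4) (by positivity) (fun p hp => ?_)
  rw [← mul_assoc]
  exact mul_le_mul_of_nonneg_right (ish_wB hδ hδ1 hM hp) (hh p hp.1)

theorem IshLe.BH {f h : ℝ × ℝ × ℝ → ℝ} (hh : ∀ p ∈ ishW, h p ≤ 2 * ishH p)
    (h2 : IshLe (ishW ∩ ishBox M) (fun p => ishB δ p * h p) f) :
    IshLe (ishW ∩ ishBox M) (fun p => ishB δ p * ishH p) f := by
  refine h2.weak (a := 2) zero_le_two (fun p hp => ?_)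
  have := mul_le_mul_of_nonneg_left (hh p hp.1) (ishB_pos (δ := δ) hp.1).le
  linarith

theorem IshLe.XY (hδ : 0 < δ) (hδ1 : δ ≤ 1 / 8) (hM : 1 ≤ M) {f g : ℝ × ℝ × ℝ → ℝ}
    (h1 : IshLe ishW ishIy f) (h2 : IshLe ishW (fun p => ishw δ p * ishIx p) g) :
    IshLe (ishW ∩ ishBox M) (fun p => ishB δ p * ishH p) (fun p => f p * g p) := by
  have h3 : IshLe ishW (fun p => ishw δ p * (ishIx p * ishIy p)) (fun p => f p * g p) :=
    (h1.mul h2).weak (a := 1) zero_le_one (fun p hp => by apply le_of_eq; ring)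
  refine (h3.WB hδ hδ1 hM (fun p hp => (mul_pos (ishIx_pos hp) (ishIy_pos hp)).le)).BH (fun p hp => ?_)
  have := ishH_ge hp
  linarith [this.1, this.2.2.2.2]

theorem IshLe.YX (hδ : 0 < δ) (hδ1 : δ ≤ 1 / 8) (hM : 1 ≤ M) {f g : ℝ × ℝ × ℝ → ℝ}
    (h1 : IshLe ishW ishIx f) (h2 : IshLe ishW (fun p => ishw δ p * ishIy p) g) :
    IshLe (ishW ∩ ishBox M) (fun p => ishB δ p * ishH p) (fun p => f p * g p) := by
  have h3 : IshLe ishW (fun p => ishw δ p * (ishIx p * ishIy p)) (fun p => f p * g p) :=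
    (h1.mul h2).weak (a := 1) zero_le_one (fun p hp => by apply le_of_eq; ring)
  refine (h3.WB hδ hδ1 hM (fun p hp => (mul_pos (ishIx_pos hp) (ishIy_pos hp)).le)).BH (fun p hp => ?_)
  have := ishH_ge hp
  linarith [this.1, this.2.2.2.2]

variable {f0 f1 f2 Φ : ℝ × ℝ × ℝ → ℝ}

noncomputable def ishFx (f0 f1 f2 Φ : ℝ × ℝ × ℝ → ℝ) (p : ℝ × ℝ × ℝ) : ℝ :=
  -2 * (f1 p * ishd ex f2 p - f2 p * ishd ex f1 p) - 2 * (Φ p * ishd ex f0 p)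
noncomputable def ishFy (f0 f1 f2 Φ : ℝ × ℝ × ℝ → ℝ) (p : ℝ × ℝ × ℝ) : ℝ :=
  -2 * (f1 p * ishd ey f2 p - f2 p * ishd ey f1 p) + 2 * (Φ p * ishd ey f0 p)

theorem ishFx_sm (h0 : IshC δ f0) (h1 : IshC δ f1) (h2 : IshC δ f2) (hΦ : IshP δ Φ) :
    ∀ p ∈ ishW, ContDiffAt ℝ (⊤ : ℕ∞) (ishFx f0 f1 f2 Φ) p := by
  intro p hp
  have a0 := ishd_smooth (v := ex) (h0.sm p hp)
  have a1 := ishd_smooth (v := ex) (h1.sm p hp)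
  have a2 := ishd_smooth (v := ex) (h2.sm p hp)
  exact (contDiffAt_const.mul (((h1.sm p hp).mul a2).sub ((h2.sm p hp).mul a1))).sub
    (contDiffAt_const.mul ((hΦ.sm p hp).mul a0))

theorem ishFy_sm (h0 : IshC δ f0) (h1 : IshC δ f1) (h2 : IshC δ f2) (hΦ : IshP δ Φ) :
    ∀ p ∈ ishW, ContDiffAt ℝ (⊤ : ℕ∞) (ishFy f0 f1 f2 Φ) p := by
  intro p hp
  have a0 := ishd_smooth (v := ey) (h0.sm p hp)
  have a1 := ishd_smooth (v := ey) (h1.sm p hp)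
  have a2 := ishd_smooth (v := ey) (h2.sm p hp)
  exact (contDiffAt_const.mul (((h1.sm p hp).mul a2).sub ((h2.sm p hp).mul a1))).add
    (contDiffAt_const.mul ((hΦ.sm p hp).mul a0))

theorem ishFx_der (h0 : IshC δ f0) (h1 : IshC δ f1) (h2 : IshC δ f2) (hΦ : IshP δ Φ) :
    ∀ p ∈ ishW, ishd ey (ishFx f0 f1 f2 Φ) p =
      -2 * ((ishd ey f1 p * ishd ex f2 p + f1 p * ishd ey (ishd ex f2) p)
        - (ishd ey f2 p * ishd ex f1 p + f2 p * ishd ey (ishd ex f1) p))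
      - 2 * (ishd ey Φ p * ishd ex f0 p + Φ p * ishd ey (ishd ex f0) p) := by
  rintro ⟨t, ξ, η⟩ hp
  have a0 := ishd_y (ishd_smooth (v := ex) (h0.sm _ hp))
  have a1 := ishd_y (ishd_smooth (v := ex) (h1.sm _ hp))
  have a2 := ishd_y (ishd_smooth (v := ex) (h2.sm _ hp))
  have b1 := ishd_y (h1.sm _ hp)
  have b2 := ishd_y (h2.sm _ hp)
  have bΦ := ishd_y (hΦ.sm _ hp)
  exact (ishd_y (ishFx_sm h0 h1 h2 hΦ _ hp)).unique
    ((((b1.mul a2).sub (b2.mul a1)).const_mul (-2)).sub ((bΦ.mul a0).const_mul 2))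

theorem ishFy_der (h0 : IshC δ f0) (h1 : IshC δ f1) (h2 : IshC δ f2) (hΦ : IshP δ Φ) :
    ∀ p ∈ ishW, ishd ex (ishFy f0 f1 f2 Φ) p =
      -2 * ((ishd ex f1 p * ishd ey f2 p + f1 p * ishd ey (ishd ex f2) p)
        - (ishd ex f2 p * ishd ey f1 p + f2 p * ishd ey (ishd ex f1) p))
      + 2 * (ishd ex Φ p * ishd ey f0 p + Φ p * ishd ey (ishd ex f0) p) := by
  rintro ⟨t, ξ, η⟩ hp
  have a0 := ishd_x (ishd_smooth (v := ey) (h0.sm _ hp))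
  have a1 := ishd_x (ishd_smooth (v := ey) (h1.sm _ hp))
  have a2 := ishd_x (ishd_smooth (v := ey) (h2.sm _ hp))
  have b1 := ishd_x (h1.sm _ hp)
  have b2 := ishd_x (h2.sm _ hp)
  have bΦ := ishd_x (hΦ.sm _ hp)
  rw [ishd_symm (h0.sm _ hp)] at a0
  rw [ishd_symm (h1.sm _ hp)] at a1
  rw [ishd_symm (h2.sm _ hp)] at a2
  exact (ishd_x (ishFy_sm h0 h1 h2 hΦ _ hp)).unique
    ((((b1.mul a2).sub (b2.mul a1)).const_mul (-2)).add ((bΦ.mul a0).const_mul 2))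

theorem ishFx_B (hδ : 0 < δ) (hδ1 : δ ≤ 1 / 8) (h0 : IshC δ f0) (h1 : IshC δ f1) (h2 : IshC δ f2)
    (hΦ : IshP δ Φ) : ∀ M ≥ 1, IshLe (ishW ∩ ishBox M) (fun p => ishB δ p * ishIx p) (ishFx f0 f1 f2 Φ) := by
  intro M hM
  exact ((((h1.b0.oneA hδ hδ1 hM).AW h2.bxw).sub ((h2.b0.oneA hδ hδ1 hM).AW h1.bxw)).cmul (-2)).sub
    (((hΦ.b0 M hM).AW h0.bxw).cmul 2)

theorem ishFy_B (hδ : 0 < δ) (hδ1 : δ ≤ 1 / 8) (h0 : IshC δ f0) (h1 : IshC δ f1) (h2 : IshC δ f2)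
    (hΦ : IshP δ Φ) : ∀ M ≥ 1, IshLe (ishW ∩ ishBox M) (fun p => ishB δ p * ishIy p) (ishFy f0 f1 f2 Φ) := by
  intro M hM
  exact ((((h1.b0.oneA hδ hδ1 hM).AW h2.byw).sub ((h2.b0.oneA hδ hδ1 hM).AW h1.byw)).cmul (-2)).add
    (((hΦ.b0 M hM).AW h0.byw).cmul 2)

theorem ish_hx {p : ℝ × ℝ × ℝ} (hp : p ∈ ishW) : ishIx p ≤ 2 * ishH p := by
  have := ishH_ge hp
  linarith [this.1, this.2.1]
theorem ish_hy {p : ℝ × ℝ × ℝ} (hp : p ∈ ishW) : ishIy p ≤ 2 * ishH p := by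
  have := ishH_ge hp
  linarith [this.1, this.2.2.1]
theorem ish_ht {p : ℝ × ℝ × ℝ} (hp : p ∈ ishW) : 1 / p.1 ≤ 2 * ishH p := by
  have := ishH_ge hp
  linarith [this.1, this.2.2.2.1]
theorem ish_hxy {p : ℝ × ℝ × ℝ} (hp : p ∈ ishW) : ishIx p * ishIy p + 1 / p.1 ≤ 2 * ishH p := by
  have := ishH_ge hp
  linarith [this.2.2.2.1, this.2.2.2.2]

theorem ish_weak1 (hδ : 0 < δ) (hδ1 : δ ≤ 1 / 8) (hM : 1 ≤ M) (h0 : IshC δ f0) (h1 : IshC δ f1)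
    (h2 : IshC δ f2) (hΦ : IshP δ Φ)
    (pde : ∀ p ∈ ishW, ishd et f0 p = 4 * (f1 p * ishd ey (ishd ex f2) p - f2 p * ishd ey (ishd ex f1) p)
      + 2 * ishd ey Φ p * ishd ex f0 p - 2 * ishd ex Φ p * ishd ey f0 p) {g : ℝ × ℝ × ℝ → ℝ}
    (hg : IshTest M g) :
    Integrable (ishW.indicator fun p => ishd ey g p * ishFx f0 f1 f2 Φ p + ishd ex g p * ishFy f0 f1 f2 Φ p
      + ishd et g p * f0 p) ∧
    ∫ p, (ishW.indicator fun p => ishd ey g p * ishFx f0 f1 f2 Φ p + ishd ex g p * ishFy f0 f1 f2 Φ p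
      + ishd et g p * f0 p) p = 0 := by
  have hM0 : 0 < M := by linarith
  have A0 : ∀ {f}, IshC δ f → IshLe (ishW ∩ ishBox M) (ishA δ) f := fun h => h.b0.oneA hδ hδ1 hM
  have hxy : ∀ {u v}, IshLe (ishW ∩ ishBox M) (ishA δ) u → IshC δ v →
    IshLe (ishW ∩ ishBox M) (fun p => ishB δ p * ishH p) (fun p => u p * ishd ey (ishd ex v) p) :=
    fun hu hv => (hu.AW hv.bxy).BH (fun p hp => ish_hxy hp)
  have d1 : IshDom δ M (ishd ey (ishFx f0 f1 f2 Φ)) := by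
    apply IshLe.domB hδ hδ1 hM
    refine IshLe.congr ?_ (fun p hp => ishFx_der h0 h1 h2 hΦ p hp.1)
    exact (((((h1.by'.XY hδ hδ1 hM h2.bxw).add (hxy (A0 h1) h2)).sub
      ((h2.by'.XY hδ hδ1 hM h1.bxw).add (hxy (A0 h2) h1))).cmul (-2)).sub
      (((hΦ.by'.XY hδ hδ1 hM h0.bxw).add (hxy (hΦ.b0 M hM) h0)).cmul 2))
  have d2 : IshDom δ M (ishd ex (ishFy f0 f1 f2 Φ)) := by
    apply IshLe.domB hδ hδ1 hM
    refine IshLe.congr ?_ (fun p hp => ishFy_der h0 h1 h2 hΦ p hp.1)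
    exact (((((h1.bx.YX hδ hδ1 hM h2.byw).add (hxy (A0 h1) h2)).sub
      ((h2.bx.YX hδ hδ1 hM h1.byw).add (hxy (A0 h2) h1))).cmul (-2)).add
      (((hΦ.bx.YX hδ hδ1 hM h0.byw).add (hxy (hΦ.b0 M hM) h0)).cmul 2))
  have Bx := ishFx_B hδ hδ1 h0 h1 h2 hΦ
  have By := ishFy_B hδ hδ1 h0 h1 h2 hΦ
  obtain ⟨i1, e1⟩ := ish_divT_y hδ hM0 hg (ishFx_sm h0 h1 h2 hΦ)
    (((Bx M hM).BH (fun p hp => ish_hx hp)).domB hδ hδ1 hM) d1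
    (fun t ξ ht hξ => ⟨0, ish_slc_y hδ (h' := fun _ ξ => 1 / |ξ|) (fun _ => rfl) Bx t ξ ht hξ⟩)
  obtain ⟨i2, e2⟩ := ish_divT_x hδ hM0 hg (ishFy_sm h0 h1 h2 hΦ)
    (((By M hM).BH (fun p hp => ish_hy hp)).domB hδ hδ1 hM) d2
    (fun t ξ ht hξ => ⟨0, ish_slc_x hδ (h' := fun _ ξ => 1 / |ξ|) (fun _ => rfl) By t ξ ht hξ⟩)
  obtain ⟨C, hC0, hC⟩ := h0.b0
  obtain ⟨i3, e3⟩ := ish_divT_t (a := C) hδ hM0 hg h0.sm ((A0 h0).domA hδ hδ1 hM)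
    (((h0.bt.WB hδ hδ1 hM (fun p hp => by have : 0 < p.1 := hp.1; positivity)).BH
      (fun p hp => ish_ht hp)).domB hδ hδ1 hM) (fun p hp => by simpa using hC p hp)
  have key : (ishW.indicator fun p => ishd ey g p * ishFx f0 f1 f2 Φ p + ishd ex g p * ishFy f0 f1 f2 Φ p
      + ishd et g p * f0 p) = fun p =>
      (ishW.indicator fun p => ishd ey g p * ishFx f0 f1 f2 Φ p + g p * ishd ey (ishFx f0 f1 f2 Φ) p) p
      + (ishW.indicator fun p => ishd ex g p * ishFy f0 f1 f2 Φ p + g p * ishd ex (ishFy f0 f1 f2 Φ) p) p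
      + (ishW.indicator fun p => ishd et g p * f0 p + g p * ishd et f0 p) p := by
    funext p
    by_cases hp : p ∈ ishW
    · simp only [indicator_of_mem hp]
      rw [ishFx_der h0 h1 h2 hΦ p hp, ishFy_der h0 h1 h2 hΦ p hp, pde p hp]
      ring
    · simp only [indicator_of_notMem hp, add_zero]
  rw [key]
  exact ish_int3 i1 i2 i3 e1 e2 e3

structure IshG (δ : ℝ) (G : ℝ × ℝ × ℝ → ℝ) : Prop where
  sm : ∀ p ∈ ishW, ContDiffAt ℝ (⊤ : ℕ∞) G p
  b0 : IshLe ishW (ishw δ) G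
  by' : IshLe ishW (fun p => ishw δ p * ishIy p) (ishd ey G)
  bxy : IshLe ishW (fun p => ishw δ p * (ishIx p * ishIy p)) (ishd ey (ishd ex G))

theorem ish_weak2 (hδ : 0 < δ) (hδ1 : δ ≤ 1 / 8) (hM : 1 ≤ M) {G : ℝ × ℝ × ℝ → ℝ} (hG : IshG δ G)
    (P Q s : ℝ) (hΦG : ∀ p ∈ ishW, Φ p = P * Real.log p.2.1 + Q * Real.log p.2.2 + s * Real.log p.1 - G p)
    {g : ℝ × ℝ × ℝ → ℝ} (hg : IshTest M g) :
    Integrable (ishW.indicator fun p => ishd ey (ishd ex g) p * Φ p + g p * ishd ey (ishd ex G) p) ∧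
    ∫ p, (ishW.indicator fun p => ishd ey (ishd ex g) p * Φ p + g p * ishd ey (ishd ex G) p) p = 0 := by
  have hM0 : 0 < M := by linarith
  obtain ⟨lx, ly, lz⟩ := ish_logA hδ hδ1 hM
  have Gd1 : IshDom δ M G := by
    refine IshLe.domA hδ hδ1 hM ((hG.b0.mono inter_subset_left).weak (a := M ^ 6) (by positivity) ?_)
    exact fun p hp => ish_wA hδ hδ1 hM hp
  have Gyd : IshDom δ M (ishd ey G) :=
    ((hG.by'.WB hδ hδ1 hM (fun p hp => (ishIy_pos hp).le)).BH (fun p hp => ish_hy hp)).domB hδ hδ1 hM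
  have Gxyd : IshDom δ M (ishd ey (ishd ex G)) := by
    refine ((hG.bxy.WB hδ hδ1 hM (fun p hp => (mul_pos (ishIx_pos hp) (ishIy_pos hp)).le)).BH
      (fun p hp => ?_)).domB hδ hδ1 hM
    have := ishH_ge hp
    linarith [this.1, this.2.2.2.2]
  -- first flux
  have sm1 : ∀ p ∈ ishW, ContDiffAt ℝ (⊤ : ℕ∞)
      (fun p => P * Real.log p.2.1 + s * Real.log p.1 - G p) p := by
    intro p hp
    have a1 : ContDiffAt ℝ (⊤ : ℕ∞) (fun p : ℝ × ℝ × ℝ => Real.log p.2.1) p :=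
      ContDiffAt.log (by fun_prop) hp.2.1
    have a2 : ContDiffAt ℝ (⊤ : ℕ∞) (fun p : ℝ × ℝ × ℝ => Real.log p.1) p :=
      ContDiffAt.log (by fun_prop) (ne_of_gt hp.1)
    exact ((contDiffAt_const.mul a1).add (contDiffAt_const.mul a2)).sub (hG.sm p hp)
  have der1 : ∀ p ∈ ishW, ishd ey (fun p => P * Real.log p.2.1 + s * Real.log p.1 - G p) p
      = -ishd ey G p := by
    rintro ⟨t, ξ, η⟩ hp
    refine (ishd_y (sm1 _ hp)).unique ?_
    have := (hasDerivAt_const η (P * Real.log ξ + s * Real.log t)).sub (ishd_y (hG.sm _ hp))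
    rw [zero_sub] at this
    exact this
  obtain ⟨i1, e1⟩ := ish_divT_y hδ hM0 (hg.ishd ex) sm1
    (((((lx.cmul P).add (lz.cmul s)).domA hδ hδ1 hM).add (Gd1.const_mul (a := -1))).congr
      (fun p _ => by ring))
    ((Gyd.const_mul (a := -1)).congr (fun p hp => by rw [der1 p hp]; ring))
    (fun t ξ ht hξ => ⟨P * Real.log ξ + s * Real.log t - 0, by
      refine tendsto_const_nhds.sub (ish_slc_y hδ (h := fun _ => 1) (h' := fun _ _ => 1)
        (fun _ => rfl) (fun M hM => ?_) t ξ ht hξ)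
      exact (hG.b0.weak (D' := fun p => ishw δ p * 1) (a := 1) zero_le_one
        (fun p _ => by simp)).WB hδ hδ1 hM (fun _ _ => zero_le_one)⟩)
  -- second flux
  have sm2 : ∀ p ∈ ishW, ContDiffAt ℝ (⊤ : ℕ∞)
      (fun p : ℝ × ℝ × ℝ => Q * Real.log p.2.2) p := by
    intro p hp
    have a1 : ContDiffAt ℝ (⊤ : ℕ∞) (fun p : ℝ × ℝ × ℝ => Real.log p.2.2) p :=
      ContDiffAt.log (by fun_prop) hp.2.2
    exact contDiffAt_const.mul a1
  have der2 : ∀ p ∈ ishW, ishd ex (fun p : ℝ × ℝ × ℝ => Q * Real.log p.2.2) p = 0 := by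
    rintro ⟨t, ξ, η⟩ hp
    exact (ishd_x (sm2 _ hp)).unique (hasDerivAt_const ξ (Q * Real.log η))
  obtain ⟨i2, e2⟩ := ish_divT_x hδ hM0 (hg.ishd ey) sm2
    ((ly.cmul Q).domA hδ hδ1 hM) ⟨0, fun p hp _ => by rw [der2 p hp]; simp⟩
    (fun t η ht hη => ⟨Q * Real.log η, tendsto_const_nhds⟩)
  -- third flux
  obtain ⟨i3, e3⟩ := ish_divT_x hδ hM0 hg (fun p hp => ishd_smooth (v := ey) (hG.sm p hp)) Gyd
    (Gxyd.congr (fun p hp => ishd_symm (hG.sm p hp)))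
    (fun t η ht hη => ⟨0, ish_slc_x hδ (h := ishIy) (h' := fun _ ξ => 1 / |ξ|) (fun _ => rfl)
      (fun M hM => hG.by'.WB hδ hδ1 hM (fun p hp => (ishIy_pos hp).le)) t η ht hη⟩)
  have key : (ishW.indicator fun p => ishd ey (ishd ex g) p * Φ p + g p * ishd ey (ishd ex G) p) = fun p =>
      (ishW.indicator fun p => ishd ey (ishd ex g) p * (P * Real.log p.2.1 + s * Real.log p.1 - G p)
        + ishd ex g p * ishd ey (fun p => P * Real.log p.2.1 + s * Real.log p.1 - G p) p) p
      + (ishW.indicator fun p => ishd ex (ishd ey g) p * (Q * Real.log p.2.2)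
        + ishd ey g p * ishd ex (fun p : ℝ × ℝ × ℝ => Q * Real.log p.2.2) p) p
      + (ishW.indicator fun p => ishd ex g p * ishd ey G p + g p * ishd ex (ishd ey G) p) p := by
    funext p
    by_cases hp : p ∈ ishW
    · simp only [indicator_of_mem hp]
      rw [der1 p hp, der2 p hp, hΦG p hp, ishd_symm (v := ex) (w := ey) (hG.sm p hp),
        ishd_symm (v := ex) (w := ey) (hg.sm.contDiffAt)]
      ring
    · simp only [indicator_of_notMem hp, add_zero]
  rw [key]
  exact ish_int3 i1 i2 i3 e1 e2 e3
end

theorem ishN_map : ∃ a : ENNReal, a ≠ ⊤ ∧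
    Measure.map ishN (volume : Measure (ℝ × ℝ × ℝ)) = a • volume := by
  have i2 : (volume : Measure (ℝ × ℝ)).IsAddHaarMeasure :=
    Measure.prod.instIsAddHaarMeasure (volume : Measure ℝ) (volume : Measure ℝ)
  have i3 : (volume : Measure (ℝ × ℝ × ℝ)).IsAddHaarMeasure :=
    Measure.prod.instIsAddHaarMeasure (volume : Measure ℝ) (volume : Measure (ℝ × ℝ))
  have hd : LinearMap.det (ishN.toLinearEquiv : (ℝ × ℝ × ℝ) →ₗ[ℝ] (ℝ × ℝ × ℝ)) ≠ 0 :=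
    (LinearEquiv.isUnit_det' ishN.toLinearEquiv).ne_zero
  exact ⟨_, ENNReal.ofReal_ne_top, Measure.map_linearMap_addHaar_eq_smul_addHaar volume hd⟩

theorem ishN_integrable {f : ℝ × ℝ × ℝ → ℝ} (h : Integrable f) :
    Integrable (fun p => f (ishN p)) := by
  obtain ⟨a, ha, e⟩ := ishN_map
  have h1 : Integrable f (Measure.map ishN volume) := by
    rw [e]; exact h.smul_measure ha
  exact (integrable_map_equiv ishN.toHomeomorph.toMeasurableEquiv f).1 h1

theorem ishN_integral {f : ℝ × ℝ × ℝ → ℝ} (h : ∫ p, f p = 0) : ∫ p, f (ishN p) = 0 := by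
  obtain ⟨a, ha, e⟩ := ishN_map
  have h1 := integral_map_equiv (μ := volume) ishN.toHomeomorph.toMeasurableEquiv f
  have h2 : ∫ p, f p ∂(Measure.map ishN volume) = ∫ p, f (ishN p) := h1
  rw [← h2, e, integral_smul_measure, h, smul_zero]

theorem ishN_ae {P : ℝ × ℝ × ℝ → Prop} (h : ∀ᵐ p, P p) : ∀ᵐ p, P (ishN p) := by
  obtain ⟨a, ha, e⟩ := ishN_map
  have h1 : ∀ᵐ p ∂(Measure.map ishN (volume : Measure (ℝ × ℝ × ℝ))), P p := by
    rw [e]; exact Measure.ae_smul_measure h a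
  exact ae_of_ae_map ishN.continuous.measurable.aemeasurable h1

theorem ish_bump {q : ℝ × ℝ × ℝ} (hq : 0 < q.1) :
    ∃ M g, 1 ≤ M ∧ IshTest M g ∧ ∀ᶠ z in nhds q, g z = 1 := by
  let f : ContDiffBump q := ⟨q.1 / 4, q.1 / 2, by positivity, by linarith⟩
  refine ⟨1 + ‖q‖ + q.1, f, ?_, ⟨f.contDiff, ?_, ?_⟩, ?_⟩
  · have := norm_nonneg q; linarith
  · intro p hp
    apply f.zero_of_le_dist
    by_contra hlt
    push Not at hlt
    apply hp
    have h1 : ‖p‖ ≤ 1 + ‖q‖ + q.1 := by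
      have : ‖p‖ ≤ ‖p - q‖ + ‖q‖ := by simpa using norm_add_le (p - q) q
      rw [dist_eq_norm] at hlt
      have hl : ‖p - q‖ < q.1 / 2 := hlt
      linarith
    have h2 : ‖p.2‖ ≤ ‖p‖ := norm_snd_le p
    exact ⟨(norm_fst_le p).trans h1, (norm_fst_le p.2).trans (h2.trans h1),
      (norm_snd_le p.2).trans (h2.trans h1)⟩
  · intro p hp
    apply f.zero_of_le_dist
    rw [dist_eq_norm]
    show q.1 / 2 ≤ _
    have h1 : ‖(p - q).1‖ ≤ ‖p - q‖ := norm_fst_le _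
    have h2 : -(p.1 - q.1) ≤ |p.1 - q.1| := neg_le_abs _
    have h3 : ‖(p - q).1‖ = |p.1 - q.1| := rfl
    linarith
  · exact f.eventuallyEq_one

theorem ish_locint {δ : ℝ} {h : ℝ × ℝ × ℝ → ℝ} (hδ : 0 < δ) (hc : ContinuousOn h ishW)
    (hd : ∀ M ≥ 1, IshDom δ M h) {p : ℝ × ℝ × ℝ} (hp : 0 < p.1) :
    IntegrableAtFilter (fun p => h (ishN p)) (nhds p) volume := by
  obtain ⟨M, g, hM, hg, h1⟩ := ish_bump (q := ishN p) hp
  have hI := ishN_integrable (hg.integrable hδ (by linarith) (hd M hM) hc)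
  have h2 : ∀ᶠ z in nhds p, g (ishN z) = 1 := ishN.continuous.continuousAt.eventually h1
  have h3 : ∀ᶠ z : ℝ × ℝ × ℝ in nhds p, 0 < z.1 := (isOpen_lt continuous_const continuous_fst).mem_nhds hp
  obtain ⟨S, hS, hSo, hpS⟩ := eventually_nhds_iff.1 (h2.and h3)
  refine ⟨S, hSo.mem_nhds hpS, ?_⟩
  refine (hI.integrableOn (s := S)).congr ?_
  rw [EventuallyEq, ae_restrict_iff' hSo.measurableSet]
  filter_upwards [ishN_ae ishW_ae] with z hz hzS
  rcases hz with hz | hz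
  · rw [indicator_of_mem hz, (hS z hzS).1, one_mul]
  · exact absurd hz (not_lt.2 (hS z hzS).2.le)

theorem ish_locV {f : ℝ × ℝ × ℝ → Fin 3 → ℝ} {p : ℝ × ℝ × ℝ}
    (h : ∀ i, IntegrableAtFilter (fun p => f p i) (nhds p) volume) : IntegrableAtFilter f (nhds p) volume := by
  choose S hS hI using h
  refine ⟨⋂ i, S i, (Filter.iInter_mem).2 hS, ?_⟩
  exact Integrable.of_eval fun i => (hI i).mono_set (iInter_subset _ _)

theorem ishd_pi {U : ℝ × ℝ × ℝ → Fin 3 → ℝ} {p v : ℝ × ℝ × ℝ} (h : DifferentiableAt ℝ U p) (i : Fin 3) :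
    ishd v U p i = ishd v (fun p => U p i) p := by
  unfold ishd
  rw [fderiv_apply h]; rfl

structure IshSol (δ P Q s : ℝ) (U : ℝ × ℝ × ℝ → Fin 3 → ℝ) (Φ G : ℝ × ℝ × ℝ → ℝ) : Prop where
  hU : ∀ i, IshC δ (fun p => U p i)
  hP : IshP δ Φ
  hG : IshG δ G
  form : ∀ p ∈ ishW, Φ p = P * Real.log p.2.1 + Q * Real.log p.2.2 + s * Real.log p.1 - G p
  pde1 : ∀ p ∈ ishW, ishd et U p = (4:ℝ) • cross3 (U p) (ishd ey (ishd ex U) p)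
    + (2 * ishd ey Φ p) • ishd ex U p - (2 * ishd ex Φ p) • ishd ey U p
  pde2 : ∀ p ∈ ishW, dot3 (U p) (cross3 (ishd ex U p) (ishd ey U p)) = -ishd ey (ishd ex G) p

section
variable {δ P Q s : ℝ} {U : ℝ × ℝ × ℝ → Fin 3 → ℝ} {Φ G : ℝ × ℝ × ℝ → ℝ}

theorem IshSol.sm (h : IshSol δ P Q s U Φ G) {p : ℝ × ℝ × ℝ} (hp : p ∈ ishW) :
    ContDiffAt ℝ (⊤ : ℕ∞) U p := contDiffAt_pi.2 fun i => (h.hU i).sm p hp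

theorem IshSol.d1 (h : IshSol δ P Q s U Φ G) {p : ℝ × ℝ × ℝ} (hp : p ∈ ishW) (v : ℝ × ℝ × ℝ) (i : Fin 3) :
    ishd v U p i = ishd v (fun p => U p i) p := ishd_pi (ish_diffAt (h.sm hp)) i

theorem IshSol.d2 (h : IshSol δ P Q s U Φ G) {p : ℝ × ℝ × ℝ} (hp : p ∈ ishW) (v w : ℝ × ℝ × ℝ) (i : Fin 3) :
    ishd v (ishd w U) p i = ishd v (ishd w (fun p => U p i)) p := by
  rw [ishd_pi (ish_diffAt (ishd_smooth (h.sm hp)))]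
  apply ishd_congr
  filter_upwards [ishW_open.mem_nhds hp] with z hz
  exact h.d1 hz w i

theorem ish_test {ψ : ℝ × ℝ × ℝ → ℝ} (h1 : ContDiff ℝ (⊤ : ℕ∞) ψ) (h2 : HasCompactSupport ψ)
    (h3 : ∀ p : ℝ × ℝ × ℝ, p.1 ∉ Ioi (0:ℝ) → ψ p = 0) :
    ∃ M ≥ 1, IshTest M (fun p => ψ (ishN.symm p)) := by
  have hc : HasCompactSupport (fun p => ψ (ishN.symm p)) :=
    h2.comp_homeomorph ishN.symm.toHomeomorph
  obtain ⟨M, hM⟩ := hc.isCompact.isBounded.exists_norm_le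
  refine ⟨max M 1, le_max_right _ _, ⟨h1.comp ishN.symm.contDiff, ?_, ?_⟩⟩
  · intro p hp
    refine image_eq_zero_of_notMem_tsupport (f := fun p => ψ (ishN.symm p)) ?_
    intro hs
    apply hp
    have h1 : ‖p‖ ≤ max M 1 := (hM p hs).trans (le_max_left _ _)
    have h2 : ‖p.2‖ ≤ ‖p‖ := norm_snd_le p
    exact ⟨(norm_fst_le p).trans h1, (norm_fst_le p.2).trans (h2.trans h1),
      (norm_snd_le p.2).trans (h2.trans h1)⟩
  · intro p hp
    apply h3
    rw [ishN_symm_apply]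
    exact not_lt.2 hp

theorem IshTest.mono {M M' : ℝ} {g : ℝ × ℝ × ℝ → ℝ} (h : IshTest M g) (hM : M ≤ M') : IshTest M' g :=
  ⟨h.sm, fun p hp => h.box p fun hb => hp ⟨hb.1.trans hM, hb.2.1.trans hM, hb.2.2.trans hM⟩, h.neg⟩
end

section
variable {δ P Q s : ℝ} {U : ℝ × ℝ × ℝ → Fin 3 → ℝ} {Φ G : ℝ × ℝ × ℝ → ℝ}

theorem ish_nullalg (a b c d e : Fin 3 → ℝ) (h : Fin 3 → ℝ) (φ : ℝ) :
    dot3 (cross3 a (b - c)) (d - e) - dot3 (cross3 a (b + c)) (d + e) + dot3 a h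
      - φ * (dot3 (b - c) (d + e) - dot3 (b + c) (d - e)) =
    ((e 0 * (-2 * (a 1 * b 2 - a 2 * b 1) - 2 * (φ * b 0))
      + d 0 * (-2 * (a 1 * c 2 - a 2 * c 1) + 2 * (φ * c 0)) + h 0 * a 0)
    + (e 1 * (-2 * (a 2 * b 0 - a 0 * b 2) - 2 * (φ * b 1))
      + d 1 * (-2 * (a 2 * c 0 - a 0 * c 2) + 2 * (φ * c 1)) + h 1 * a 1)
    + (e 2 * (-2 * (a 0 * b 1 - a 1 * b 0) - 2 * (φ * b 2))
      + d 2 * (-2 * (a 0 * c 1 - a 1 * c 0) + 2 * (φ * c 2)) + h 2 * a 2)) := by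
  simp [dot3, cross3]
  ring

theorem ish_dotalg (a b c : Fin 3 → ℝ) :
    dot3 a (cross3 (b + c) (b - c)) = -2 * dot3 a (cross3 b c) := by
  simp [dot3, cross3]
  ring

theorem IshSol.weakA (hδ : 0 < δ) (hδ1 : δ ≤ 1 / 8) (h : IshSol δ P Q s U Φ G)
    (ψ : ℝ × ℝ × ℝ → Fin 3 → ℝ) (h1 : ContDiff ℝ (⊤ : ℕ∞) ψ) (h2 : HasCompactSupport ψ)
    (h3 : ∀ p : ℝ × ℝ × ℝ, p.1 ∉ Ioi (0:ℝ) → ψ p = 0) :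
    ∫ p : ℝ × ℝ × ℝ,
      (dot3 (cross3 (U (ishN p)) (ishd ey (fun p => U (ishN p)) p)) (ishd ey ψ p)
        - dot3 (cross3 (U (ishN p)) (ishd ex (fun p => U (ishN p)) p)) (ishd ex ψ p)
        + dot3 (U (ishN p)) (ishd et ψ p)
        - Φ (ishN p) * (dot3 (ishd ey (fun p => U (ishN p)) p) (ishd ex ψ p)
          - dot3 (ishd ex (fun p => U (ishN p)) p) (ishd ey ψ p))) = 0 := by
  set χ : ℝ × ℝ × ℝ → Fin 3 → ℝ := fun p => ψ (ishN.symm p) with hχ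
  have hχs : ContDiff ℝ (⊤ : ℕ∞) χ := h1.comp ishN.symm.contDiff
  have eψ : ψ = fun p => χ (ishN p) := by
    funext p; simp [hχ]
  have hT : ∃ M ≥ 1, ∀ i, IshTest M (fun p => χ p i) := by
    have := fun i : Fin 3 => ish_test (ψ := fun p => ψ p i) (contDiff_pi.1 h1 i)
      (h2.comp_left (g := fun v : Fin 3 → ℝ => v i) rfl) (fun p hp => by rw [h3 p hp]; rfl)
    choose M hM hg using this
    refine ⟨max (M 0) (max (M 1) (M 2)), (hM 0).trans (le_max_left _ _), fun i => (hg i).mono ?_⟩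
    fin_cases i <;> simp
  obtain ⟨M, hM, hg⟩ := hT
  rw [eψ, ishd_Nx, ishd_Ny, ishd_Nx, ishd_Ny, ishd_Nt]
  refine ishN_integral (f := fun q => (dot3 (cross3 (U q) (ishd ex U q - ishd ey U q)) (ishd ex χ q - ishd ey χ q)
        - dot3 (cross3 (U q) (ishd ex U q + ishd ey U q)) (ishd ex χ q + ishd ey χ q)
        + dot3 (U q) (ishd et χ q)
        - Φ q * (dot3 (ishd ex U q - ishd ey U q) (ishd ex χ q + ishd ey χ q)
          - dot3 (ishd ex U q + ishd ey U q) (ishd ex χ q - ishd ey χ q)))) ?_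
  simp only [ish_nullalg]
  have hpde : ∀ i j l : Fin 3, (∀ a b : Fin 3 → ℝ, cross3 a b i = a j * b l - a l * b j) →
      ∀ p ∈ ishW, ishd et (fun p => U p i) p = 4 * ((fun p => U p j) p * ishd ey (ishd ex (fun p => U p l)) p
        - (fun p => U p l) p * ishd ey (ishd ex (fun p => U p j)) p)
      + 2 * ishd ey Φ p * ishd ex (fun p => U p i) p - 2 * ishd ex Φ p * ishd ey (fun p => U p i) p := by
    intro i j l hc p hp
    have := congrFun (h.pde1 p hp) i
    simp only [Pi.add_apply, Pi.sub_apply, Pi.smul_apply, smul_eq_mul, hc] at this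
    rw [h.d1 hp, h.d1 hp, h.d1 hp, h.d2 hp, h.d2 hp] at this
    exact this
  obtain ⟨i0, e0⟩ := ish_weak1 hδ hδ1 hM (h.hU 0) (h.hU 1) (h.hU 2) h.hP
    (hpde 0 1 2 (fun a b => by simp [cross3])) (hg 0)
  obtain ⟨i1, e1⟩ := ish_weak1 hδ hδ1 hM (h.hU 1) (h.hU 2) (h.hU 0) h.hP
    (hpde 1 2 0 (fun a b => by simp [cross3])) (hg 1)
  obtain ⟨i2, e2⟩ := ish_weak1 hδ hδ1 hM (h.hU 2) (h.hU 0) (h.hU 1) h.hP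
    (hpde 2 0 1 (fun a b => by simp [cross3])) (hg 2)
  have key := (ish_int3 i0 i1 i2 e0 e1 e2).2
  refine Eq.trans (integral_congr_ae ?_) key
  have hχd : ∀ v p i, ishd v χ p i = ishd v (fun p => χ p i) p := fun v p i =>
    ishd_pi (ish_diffAt hχs.contDiffAt) i
  filter_upwards [ishW_ae] with p hp
  by_cases hpW : p ∈ ishW
  · simp only [indicator_of_mem hpW, hχd, h.d1 hpW]
    rfl
  · have ht : p.1 ≤ 0 := (hp.resolve_left hpW).le
    have hz : ∀ v i, ishd v χ p i = 0 := fun v i => by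
      rw [hχd]; exact ((hg i).ishd v).neg p ht
    simp only [indicator_of_notMem hpW, hz]
    ring

theorem IshSol.weakB (hδ : 0 < δ) (hδ1 : δ ≤ 1 / 8) (h : IshSol δ P Q s U Φ G)
    (ρ : ℝ × ℝ × ℝ → ℝ) (h1 : ContDiff ℝ (⊤ : ℕ∞) ρ) (h2 : HasCompactSupport ρ)
    (h3 : ∀ p : ℝ × ℝ × ℝ, p.1 ∉ Ioi (0:ℝ) → ρ p = 0) :
    ∫ p : ℝ × ℝ × ℝ,
      ((ishd ex (ishd ex ρ) p - ishd ey (ishd ey ρ) p) * Φ (ishN p)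
        + 2 * ρ p * dot3 (U (ishN p)) (cross3 (ishd ex (fun p => U (ishN p)) p)
          (ishd ey (fun p => U (ishN p)) p))) = 0 := by
  set χ : ℝ × ℝ × ℝ → ℝ := fun p => ρ (ishN.symm p) with hχ
  have hχs : ContDiff ℝ (⊤ : ℕ∞) χ := h1.comp ishN.symm.contDiff
  have eψ : ρ = fun p => χ (ishN p) := by
    funext p; simp [hχ]
  obtain ⟨M, hM, hg⟩ := ish_test h1 h2 h3
  rw [eψ, ishd_Nx U, ishd_Ny U]
  have hb : ∀ p, ishd ex (ishd ex (fun p => χ (ishN p))) p - ishd ey (ishd ey (fun p => χ (ishN p))) p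
      = 4 * ishd ey (ishd ex χ) (ishN p) := fun p => by
    rw [ishd_box hχs.contDiffAt, smul_eq_mul]
  simp only [hb, ish_dotalg]
  refine ishN_integral (f := fun q => (4 * ishd ey (ishd ex χ) q) * Φ q + 2 * χ q *
    (-2 * dot3 (U q) (cross3 (ishd ex U q) (ishd ey U q)))) ?_
  obtain ⟨i0, e0⟩ := ish_weak2 hδ hδ1 hM h.hG P Q s h.form hg
  have key : ∫ p, 4 * (ishW.indicator fun p => ishd ey (ishd ex χ) p * Φ p + χ p * ishd ey (ishd ex G) p) p = 0 := by
    rw [integral_const_mul, e0, mul_zero]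
  refine Eq.trans (integral_congr_ae ?_) key
  filter_upwards [ishW_ae] with p hp
  by_cases hpW : p ∈ ishW
  · simp only [indicator_of_mem hpW, h.pde2 p hpW]
    ring
  · have ht : p.1 ≤ 0 := (hp.resolve_left hpW).le
    have z1 : χ p = 0 := hg.neg p ht
    have z2 : ishd ey (ishd ex χ) p = 0 := ((hg.ishd ex).ishd ey).neg p ht
    simp only [indicator_of_notMem hpW, z1, z2]
    ring

theorem IshSol.weak (hδ : 0 < δ) (hδ1 : δ ≤ 1 / 8) (h : IshSol δ P Q s U Φ G) :
    IsWeakIshimori (Ioi 0) (fun p => U (ishN p)) (fun p => Φ (ishN p)) := by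
  have loc : ∀ {f : ℝ × ℝ × ℝ → ℝ} (g : ℝ × ℝ × ℝ → ℝ), (∀ p ∈ ishW, ContDiffAt ℝ (⊤ : ℕ∞) g p) →
      (∀ M ≥ 1, IshDom δ M g) → (∀ p ∈ ishW, f p = g p) → ∀ p ∈ {p : ℝ × ℝ × ℝ | p.1 ∈ Ioi (0:ℝ)},
      IntegrableAtFilter (fun p => f (ishN p)) (nhds p) volume := by
    intro f g hg hd he p hp
    exact ish_locint hδ ((ish_cont_W hg).congr he) (fun M hM => (hd M hM).congr he) hp
  have mono : ∀ {E : Type} [NormedAddCommGroup E] {f : ℝ × ℝ × ℝ → E}, (∀ p ∈ {p : ℝ × ℝ × ℝ | p.1 ∈ Ioi (0:ℝ)},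
      IntegrableAtFilter f (nhds p) volume) → LocallyIntegrableOn f {p : ℝ × ℝ × ℝ | p.1 ∈ Ioi (0:ℝ)} volume :=
    fun hf p hp => (hf p hp).filter_mono nhdsWithin_le_nhds
  have ux : pdV ex (fun p => U (ishN p)) = fun p => ishd ex U (ishN p) + ishd ey U (ishN p) := ishd_Nx U
  have uy : pdV ey (fun p => U (ishN p)) = fun p => ishd ex U (ishN p) - ishd ey U (ishN p) := ishd_Ny U
  have D0 : ∀ i, ∀ M ≥ 1, IshDom δ M (fun p => U p i) := fun i M hM =>
    ((h.hU i).b0.oneA hδ hδ1 hM).domA hδ hδ1 hM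
  have Dx : ∀ i, ∀ M ≥ 1, IshDom δ M (ishd ex (fun p => U p i)) := fun i M hM =>
    (((h.hU i).bxw.WB hδ hδ1 hM (fun p hp => (ishIx_pos hp).le)).BH (fun p hp => ish_hx hp)).domB hδ hδ1 hM
  have Dy : ∀ i, ∀ M ≥ 1, IshDom δ M (ishd ey (fun p => U p i)) := fun i M hM =>
    (((h.hU i).byw.WB hδ hδ1 hM (fun p hp => (ishIy_pos hp).le)).BH (fun p hp => ish_hy hp)).domB hδ hδ1 hM
  have Px : ∀ i, ∀ M ≥ 1, IshDom δ M (fun p => Φ p * ishd ex (fun p => U p i) p) := fun i M hM =>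
    (((h.hP.b0 M hM).AW (h.hU i).bxw).BH (fun p hp => ish_hx hp)).domB hδ hδ1 hM
  have Py : ∀ i, ∀ M ≥ 1, IshDom δ M (fun p => Φ p * ishd ey (fun p => U p i) p) := fun i M hM =>
    (((h.hP.b0 M hM).AW (h.hU i).byw).BH (fun p hp => ish_hy hp)).domB hδ hδ1 hM
  have Gxyd : ∀ M ≥ 1, IshDom δ M (ishd ey (ishd ex G)) := by
    intro M hM
    refine ((h.hG.bxy.WB hδ hδ1 hM (fun p hp => (mul_pos (ishIx_pos hp) (ishIy_pos hp)).le)).BH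
      (fun p hp => ?_)).domB hδ hδ1 hM
    have := ishH_ge hp
    linarith [this.1, this.2.2.2.2]
  have sx : ∀ i, ∀ p ∈ ishW, ContDiffAt ℝ (⊤ : ℕ∞) (ishd ex (fun p => U p i)) p :=
    fun i p hp => ishd_smooth ((h.hU i).sm p hp)
  have sy : ∀ i, ∀ p ∈ ishW, ContDiffAt ℝ (⊤ : ℕ∞) (ishd ey (fun p => U p i)) p :=
    fun i p hp => ishd_smooth ((h.hU i).sm p hp)
  refine ⟨mono ?_, mono ?_, mono ?_, mono ?_, mono ?_, mono ?_, mono ?_, ?_, ?_⟩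
  · intro p hp
    exact ish_locV fun i => loc (f := fun p => U p i) (fun p => U p i) (h.hU i).sm (D0 i) (fun _ _ => rfl) p hp
  · rw [ux]
    intro p hp
    refine ish_locV fun i => loc (f := fun q => (ishd ex U q + ishd ey U q) i)
      (fun q => ishd ex (fun p => U p i) q + ishd ey (fun p => U p i) q)
      (fun q hq => (sx i q hq).add (sy i q hq)) (fun M hM => (Dx i M hM).add (Dy i M hM)) (fun q hq => ?_) p hp
    rw [Pi.add_apply, h.d1 hq, h.d1 hq]
  · rw [uy]
    intro p hp
    refine ish_locV fun i => loc (f := fun q => (ishd ex U q - ishd ey U q) i)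
      (fun q => ishd ex (fun p => U p i) q + (-1) * ishd ey (fun p => U p i) q)
      (fun q hq => (sx i q hq).add (contDiffAt_const.mul (sy i q hq)))
      (fun M hM => (Dx i M hM).add ((Dy i M hM).const_mul)) (fun q hq => ?_) p hp
    rw [Pi.sub_apply, h.d1 hq, h.d1 hq]; ring
  · intro p hp
    exact loc Φ h.hP.sm (fun M hM => (h.hP.b0 M hM).domA hδ hδ1 hM) (fun _ _ => rfl) p hp
  · rw [ux]
    intro p hp
    refine ish_locV fun i => loc (f := fun q => (Φ q • (ishd ex U q + ishd ey U q)) i)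
      (fun q => Φ q * ishd ex (fun p => U p i) q + Φ q * ishd ey (fun p => U p i) q)
      (fun q hq => ((h.hP.sm q hq).mul (sx i q hq)).add ((h.hP.sm q hq).mul (sy i q hq)))
      (fun M hM => (Px i M hM).add (Py i M hM)) (fun q hq => ?_) p hp
    rw [Pi.smul_apply, Pi.add_apply, h.d1 hq, h.d1 hq, smul_eq_mul]; ring
  · rw [uy]
    intro p hp
    refine ish_locV fun i => loc (f := fun q => (Φ q • (ishd ex U q - ishd ey U q)) i)
      (fun q => Φ q * ishd ex (fun p => U p i) q + (-1) * (Φ q * ishd ey (fun p => U p i) q))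
      (fun q hq => ((h.hP.sm q hq).mul (sx i q hq)).add (contDiffAt_const.mul ((h.hP.sm q hq).mul (sy i q hq))))
      (fun M hM => (Px i M hM).add (Py i M hM).const_mul) (fun q hq => ?_) p hp
    rw [Pi.smul_apply, Pi.sub_apply, h.d1 hq, h.d1 hq, smul_eq_mul]; ring
  · rw [ux, uy]
    intro p hp
    refine loc (f := fun q => dot3 (U q) (cross3 (ishd ex U q + ishd ey U q) (ishd ex U q - ishd ey U q)))
      (fun q => 2 * ishd ey (ishd ex G) q)
      (fun q hq => contDiffAt_const.mul (ishd_smooth (ishd_smooth (h.hG.sm q hq))))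
      (fun M hM => (Gxyd M hM).const_mul) (fun q hq => ?_) p hp
    rw [ish_dotalg, h.pde2 q hq]; ring
  · exact fun ψ h1 h2 h3 => h.weakA hδ hδ1 ψ h1 h2 h3
  · exact fun ρ h1 h2 h3 => h.weakB hδ hδ1 ρ h1 h2 h3

theorem IshSol.point (h : IshSol δ P Q s U Φ G) {p : ℝ × ℝ × ℝ} (hp : ishN p ∈ ishW)
    (hxy : ishd ey (ishd ex Φ) (ishN p) = -ishd ey (ishd ex G) (ishN p)) :
    ContDiffAt ℝ (⊤ : ℕ∞) (fun p => U (ishN p)) p ∧ ContDiffAt ℝ (⊤ : ℕ∞) (fun p => Φ (ishN p)) p ∧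
    pdV et (fun p => U (ishN p)) p = cross3 (U (ishN p)) (pdV ex (pdV ex (fun p => U (ishN p))) p
      - pdV ey (pdV ey (fun p => U (ishN p))) p)
      + pdR ex (fun p => Φ (ishN p)) p • pdV ey (fun p => U (ishN p)) p
      - pdR ey (fun p => Φ (ishN p)) p • pdV ex (fun p => U (ishN p)) p ∧
    pdR ex (pdR ex (fun p => Φ (ishN p))) p - pdR ey (pdR ey (fun p => Φ (ishN p))) p
      = -2 * dot3 (U (ishN p)) (cross3 (pdV ex (fun p => U (ishN p)) p) (pdV ey (fun p => U (ishN p)) p)) := by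
  have sU := h.sm hp
  have sΦ := h.hP.sm _ hp
  have ux : pdV ex (fun p => U (ishN p)) p = ishd ex U (ishN p) + ishd ey U (ishN p) := congrFun (ishd_Nx U) p
  have uy : pdV ey (fun p => U (ishN p)) p = ishd ex U (ishN p) - ishd ey U (ishN p) := congrFun (ishd_Ny U) p
  have ut : pdV et (fun p => U (ishN p)) p = ishd et U (ishN p) := congrFun (ishd_Nt U) p
  have px : pdR ex (fun p => Φ (ishN p)) p = ishd ex Φ (ishN p) + ishd ey Φ (ishN p) := congrFun (ishd_Nx Φ) p
  have py : pdR ey (fun p => Φ (ishN p)) p = ishd ex Φ (ishN p) - ishd ey Φ (ishN p) := congrFun (ishd_Ny Φ) p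
  have ub : pdV ex (pdV ex (fun p => U (ishN p))) p - pdV ey (pdV ey (fun p => U (ishN p))) p
    = (4:ℝ) • ishd ey (ishd ex U) (ishN p) := ishd_box sU
  have pb : pdR ex (pdR ex (fun p => Φ (ishN p))) p - pdR ey (pdR ey (fun p => Φ (ishN p))) p
    = (4:ℝ) • ishd ey (ishd ex Φ) (ishN p) := ishd_box sΦ
  refine ⟨ContDiffAt.comp p sU ishN.contDiff.contDiffAt, ContDiffAt.comp p sΦ ishN.contDiff.contDiffAt, ?_, ?_⟩
  · rw [ux, uy, ut, px, py, ub, h.pde1 _ hp]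
    have ec : ∀ a b : Fin 3 → ℝ, cross3 a ((4:ℝ) • b) = (4:ℝ) • cross3 a b := by
      intro a b
      funext i
      fin_cases i <;> simp [cross3] <;> ring
    rw [ec]
    module
  · rw [ux, uy, pb, hxy, ish_dotalg, h.pde2 _ hp, smul_eq_mul]
    ring
end

theorem IshLe.bmul {S : Set (ℝ × ℝ × ℝ)} {D f g : ℝ × ℝ × ℝ → ℝ} (h : IshLe S D f)
    (hg : IshLe S (fun _ => 1) g) : IshLe S D (fun p => f p * g p) :=
  (h.mul hg).weak (a := 1) zero_le_one (fun p _ => by simp)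

theorem IshLe.const {S : Set (ℝ × ℝ × ℝ)} (a : ℝ) : IshLe S (fun _ => 1) (fun _ => a) :=
  ⟨|a|, abs_nonneg _, fun _ _ => by simp⟩

theorem IshLe.neg {S : Set (ℝ × ℝ × ℝ)} {D f : ℝ × ℝ × ℝ → ℝ} (h : IshLe S D f) :
    IshLe S D (fun p => -f p) := (h.cmul (-1)).congr (fun p _ => by ring)

theorem IshLe.vec {S : Set (ℝ × ℝ × ℝ)} {D x p w θ : ℝ × ℝ × ℝ → ℝ} (h1 : IshLe S D x)
    (h2 : IshLe S D p) (h3 : IshLe S D w) (i : Fin 3) :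
    IshLe S D (fun z => ishvec (x z) (p z) (w z) (θ z) i) := by
  obtain ⟨C1, a1, b1⟩ := h1
  obtain ⟨C2, a2, b2⟩ := h2
  obtain ⟨C3, a3, b3⟩ := h3
  refine ⟨C1 + C2 + C3, by positivity, fun z hz => (ishvec_norm _ _ _ _ _).trans ?_⟩
  have := b1 z hz
  have := b2 z hz
  have := b3 z hz
  linarith

theorem ish_eta (p : ℝ × ℝ × ℝ) : p = (p.1, p.2.1, p.2.2) := rfl

/-- everything needed on one cone. -/
structure IshSide (V : Set (ℝ × ℝ × ℝ)) (δ P Q s : ℝ) (U : ℝ × ℝ × ℝ → Fin 3 → ℝ)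
    (Φ G : ℝ × ℝ × ℝ → ℝ) : Prop where
  sU : ∀ p ∈ V, ContDiffAt ℝ (⊤ : ℕ∞) U p
  sΦ : ∀ p ∈ V, ContDiffAt ℝ (⊤ : ℕ∞) Φ p
  sG : ∀ p ∈ V, ContDiffAt ℝ (⊤ : ℕ∞) G p
  b0 : ∀ i, IshLe V (fun _ => 1) (fun p => U p i)
  bx : ∀ i, IshLe V ishIx (fun p => ishd ex U p i)
  by1 : ∀ i, IshLe V ishIy (fun p => ishd ey U p i)
  bxw : ∀ i, IshLe V (fun p => ishw δ p * ishIx p) (fun p => ishd ex U p i)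
  byw : ∀ i, IshLe V (fun p => ishw δ p * ishIy p) (fun p => ishd ey U p i)
  bt : ∀ i, IshLe V (fun p => ishw δ p * (1 / p.1)) (fun p => ishd et U p i)
  bxy : ∀ i, IshLe V (fun p => ishw δ p * (ishIx p * ishIy p + 1 / p.1))
    (fun p => ishd ey (ishd ex U) p i)
  px : IshLe V ishIx (ishd ex Φ)
  py : IshLe V ishIy (ishd ey Φ)
  g0 : IshLe V (ishw δ) G
  gy : IshLe V (fun p => ishw δ p * ishIy p) (ishd ey G)
  gxy : IshLe V (fun p => ishw δ p * (ishIx p * ishIy p)) (ishd ey (ishd ex G))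
  form : ∀ p ∈ V, Φ p = P * Real.log p.2.1 + Q * Real.log p.2.2 + s * Real.log p.1 - G p
  pde1 : ∀ p ∈ V, ishd et U p = (4:ℝ) • cross3 (U p) (ishd ey (ishd ex U) p)
    + (2 * ishd ey Φ p) • ishd ex U p - (2 * ishd ex Φ p) • ishd ey U p
  pde2 : ∀ p ∈ V, dot3 (U p) (cross3 (ishd ex U p) (ishd ey U p)) = -ishd ey (ishd ex G) p
  hxy : ∀ p ∈ V, ishd ey (ishd ex Φ) p = -ishd ey (ishd ex G) p

section
variable {F : Type*}

theorem ish_ev {V : Set (ℝ × ℝ × ℝ)} (hV : IsOpen V) {f g : ℝ × ℝ × ℝ → F} (h : EqOn f g V) :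
    ∀ p ∈ V, f =ᶠ[nhds p] g := fun p hp => by
  filter_upwards [hV.mem_nhds hp] with z hz using h hz

theorem ish_ev1 [NormedAddCommGroup F] [NormedSpace ℝ F] {V : Set (ℝ × ℝ × ℝ)} (hV : IsOpen V) {f g : ℝ × ℝ × ℝ → F} (h : EqOn f g V)
    (v : ℝ × ℝ × ℝ) : EqOn (ishd v f) (ishd v g) V :=
  fun p hp => ishd_congr (ish_ev hV h p hp)
end

theorem IshSide.congr {V : Set (ℝ × ℝ × ℝ)} (hV : IsOpen V) {δ P Q s : ℝ}
    {U U' : ℝ × ℝ × ℝ → Fin 3 → ℝ} {Φ G Φ' G' : ℝ × ℝ × ℝ → ℝ} (h : IshSide V δ P Q s U Φ G)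
    (e1 : EqOn U' U V) (e2 : EqOn Φ' Φ V) (e3 : EqOn G' G V) : IshSide V δ P Q s U' Φ' G' := by
  have U1 := ish_ev1 hV e1
  have U2 := ish_ev1 hV (U1 ex) ey
  have P1 := ish_ev1 hV e2
  have P2 := ish_ev1 hV (P1 ex) ey
  have G1 := ish_ev1 hV e3
  have G2 := ish_ev1 hV (G1 ex) ey
  constructor
  · exact fun p hp => (h.sU p hp).congr_of_eventuallyEq (ish_ev hV e1 p hp)
  · exact fun p hp => (h.sΦ p hp).congr_of_eventuallyEq (ish_ev hV e2 p hp)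
  · exact fun p hp => (h.sG p hp).congr_of_eventuallyEq (ish_ev hV e3 p hp)
  · exact fun i => (h.b0 i).congr fun p hp => by rw [e1 hp]
  · exact fun i => (h.bx i).congr fun p hp => by rw [U1 _ hp]
  · exact fun i => (h.by1 i).congr fun p hp => by rw [U1 _ hp]
  · exact fun i => (h.bxw i).congr fun p hp => by rw [U1 _ hp]
  · exact fun i => (h.byw i).congr fun p hp => by rw [U1 _ hp]
  · exact fun i => (h.bt i).congr fun p hp => by rw [U1 _ hp]
  · exact fun i => (h.bxy i).congr fun p hp => by rw [U2 hp]
  · exact h.px.congr fun p hp => P1 _ hp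
  · exact h.py.congr fun p hp => P1 _ hp
  · exact h.g0.congr fun p hp => e3 hp
  · exact h.gy.congr fun p hp => G1 _ hp
  · exact h.gxy.congr fun p hp => G2 hp
  · intro p hp; rw [e2 hp, e3 hp]; exact h.form p hp
  · intro p hp; rw [U1 _ hp, U1 _ hp, U1 _ hp, U2 hp, e1 hp, P1 _ hp, P1 _ hp]; exact h.pde1 p hp
  · intro p hp; rw [U1 _ hp, U1 _ hp, e1 hp, G2 hp]; exact h.pde2 p hp
  · intro p hp; rw [P2 hp, G2 hp]; exact h.hxy p hp

theorem ishW_union : ishW = ishV 1 ∪ ishV (-1) := by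
  ext p
  simp only [ishW, ishV, mem_ofPred_eq, mem_union, ← and_or_left]
  refine and_congr_right fun _ => ?_
  constructor
  · rintro ⟨a, b⟩
    rcases lt_or_gt_of_ne (mul_ne_zero a b) with h | h
    · right; linarith
    · left; linarith
  · rintro (h | h)
    · exact ⟨fun e => by simp [e] at h, fun e => by simp [e] at h⟩
    · exact ⟨fun e => by simp [e] at h, fun e => by simp [e] at h⟩

theorem IshLe.union {S T : Set (ℝ × ℝ × ℝ)} {D f : ℝ × ℝ × ℝ → ℝ} (h : IshLe S D f)
    (h' : IshLe T D f) (hD : ∀ p ∈ S ∪ T, 0 ≤ D p) : IshLe (S ∪ T) D f := by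
  obtain ⟨C, a, b⟩ := h
  obtain ⟨C', a', b'⟩ := h'
  refine ⟨max C C', le_max_of_le_left a, fun p hp => ?_⟩
  have h0 := hD p hp
  rcases hp with hp | hp
  · exact (b p hp).trans (mul_le_mul_of_nonneg_right (le_max_left _ _) h0)
  · exact (b' p hp).trans (mul_le_mul_of_nonneg_right (le_max_right _ _) h0)

theorem IshSide.glue {δ P Q s : ℝ} {U : ℝ × ℝ × ℝ → Fin 3 → ℝ} {Φ G : ℝ × ℝ × ℝ → ℝ}
    (h : IshSide (ishV 1) δ P Q s U Φ G) (h' : IshSide (ishV (-1)) δ P Q s U Φ G) :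
    IshSide ishW δ P Q s U Φ G := by
  have nx : ∀ p ∈ ishW, 0 ≤ ishIx p := fun p hp => (ishIx_pos hp).le
  have ny : ∀ p ∈ ishW, 0 ≤ ishIy p := fun p hp => (ishIy_pos hp).le
  have nw : ∀ p ∈ ishW, 0 ≤ ishw δ p := fun p hp => sq_nonneg _
  have nt : ∀ p ∈ ishW, 0 ≤ 1 / p.1 := fun p hp => (one_div_pos.2 hp.1).le
  have n1 : ∀ p ∈ ishW, (0:ℝ) ≤ 1 := fun p hp => zero_le_one
  have nwx : ∀ p ∈ ishW, 0 ≤ ishw δ p * ishIx p := fun p hp => mul_nonneg (nw p hp) (nx p hp)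
  have nwy : ∀ p ∈ ishW, 0 ≤ ishw δ p * ishIy p := fun p hp => mul_nonneg (nw p hp) (ny p hp)
  have nwt : ∀ p ∈ ishW, 0 ≤ ishw δ p * (1 / p.1) := fun p hp => mul_nonneg (nw p hp) (nt p hp)
  have nxy : ∀ p ∈ ishW, 0 ≤ ishw δ p * (ishIx p * ishIy p) := fun p hp =>
    mul_nonneg (nw p hp) (mul_nonneg (nx p hp) (ny p hp))
  have nxyt : ∀ p ∈ ishW, 0 ≤ ishw δ p * (ishIx p * ishIy p + 1 / p.1) := fun p hp =>
    mul_nonneg (nw p hp) (add_nonneg (mul_nonneg (nx p hp) (ny p hp)) (nt p hp))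
  rw [ishW_union] at *
  constructor
  · rintro p (hp | hp); exacts [h.sU p hp, h'.sU p hp]
  · rintro p (hp | hp); exacts [h.sΦ p hp, h'.sΦ p hp]
  · rintro p (hp | hp); exacts [h.sG p hp, h'.sG p hp]
  · exact fun i => (h.b0 i).union (h'.b0 i) n1
  · exact fun i => (h.bx i).union (h'.bx i) nx
  · exact fun i => (h.by1 i).union (h'.by1 i) ny
  · exact fun i => (h.bxw i).union (h'.bxw i) nwx
  · exact fun i => (h.byw i).union (h'.byw i) nwy
  · exact fun i => (h.bt i).union (h'.bt i) nwt
  · exact fun i => (h.bxy i).union (h'.bxy i) nxyt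
  · exact h.px.union h'.px nx
  · exact h.py.union h'.py ny
  · exact h.g0.union h'.g0 nw
  · exact h.gy.union h'.gy nwy
  · exact h.gxy.union h'.gxy nxy
  · rintro p (hp | hp); exacts [h.form p hp, h'.form p hp]
  · rintro p (hp | hp); exacts [h.pde1 p hp, h'.pde1 p hp]
  · rintro p (hp | hp); exacts [h.pde2 p hp, h'.pde2 p hp]
  · rintro p (hp | hp); exacts [h.hxy p hp, h'.hxy p hp]

theorem IshSide.sol {δ P Q s : ℝ} {U : ℝ × ℝ × ℝ → Fin 3 → ℝ} {Φ G : ℝ × ℝ × ℝ → ℝ}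
    (hδ : 0 < δ) (hδ1 : δ ≤ 1 / 8)
    (h : IshSide ishW δ P Q s U Φ G) : IshSol δ P Q s U Φ G := by
  have d1 : ∀ i, ∀ v, ∀ p ∈ ishW, ishd v (fun p => U p i) p = ishd v U p i := fun i v p hp =>
    (ishd_pi (ish_diffAt (h.sU p hp)) i).symm
  have d2 : ∀ i, ∀ p ∈ ishW, ishd ey (ishd ex (fun p => U p i)) p = ishd ey (ishd ex U) p i := by
    intro i p hp
    rw [ishd_pi (ish_diffAt (ishd_smooth (h.sU p hp)))]
    exact ish_ev1 ishW_open (fun z hz => d1 i ex z hz) ey hp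
  constructor
  · intro i
    constructor
    · exact fun p hp => contDiffAt_pi.1 (h.sU p hp) i
    · exact h.b0 i
    · exact (h.bx i).congr (d1 i ex)
    · exact (h.by1 i).congr (d1 i ey)
    · exact (h.bxw i).congr (d1 i ex)
    · exact (h.byw i).congr (d1 i ey)
    · exact (h.bt i).congr (d1 i et)
    · exact (h.bxy i).congr (d2 i)
  · refine ⟨h.sΦ, fun M hM => ?_, h.px, h.py⟩
    obtain ⟨l1, l2, l3⟩ := ish_logA (M := M) hδ hδ1 hM
    have hg : IshLe (ishW ∩ ishBox M) (ishA δ) G :=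
      (h.g0.mono inter_subset_left).weak (a := M ^ 6) (by positivity)
        (fun p hp => ish_wA hδ hδ1 hM hp)
    exact ((((l1.cmul P).add (l2.cmul Q)).add (l3.cmul s)).sub hg).congr
      (fun p hp => h.form p hp.1)
  · exact ⟨h.sG, h.g0, h.gy, h.gxy⟩
  · exact h.form
  · exact h.pde1
  · exact h.pde2

section
variable {σ μ m k c c' b K κ δ : ℝ} {E q d B : ℝ → ℝ}

theorem ishV_W : ishV σ ⊆ ishW := fun p hp => by
  obtain ⟨h1, h2, h3, h4⟩ := ishV_pos (t := p.1) (ξ := p.2.1) (η := p.2.2) hp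
  exact ⟨h1, h2, h3⟩

theorem ishV_rad {p : ℝ × ℝ × ℝ} (hp : p ∈ ishV σ) : 0 < ishRad σ p :=
  (ishV_pos (t := p.1) (ξ := p.2.1) (η := p.2.2) hp).2.2.2

theorem ishV_abs (hσ : σ * σ = 1) {p : ℝ × ℝ × ℝ} (hp : p ∈ ishV σ) :
    ishRad σ p = |p.2.1| * |p.2.2| / p.1 := by
  have h2 : 0 < σ * p.2.1 * p.2.2 := hp.2
  have hs : |σ| = 1 := by
    have : |σ| * |σ| = 1 := by rw [abs_mul_abs_self, hσ]
    nlinarith [abs_nonneg σ]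
  unfold ishRad
  rw [← abs_of_pos h2, abs_mul, abs_mul, hs, one_mul]

theorem ishw_rad (hσ : σ * σ = 1) {p : ℝ × ℝ × ℝ} (hp : p ∈ ishV σ) :
    ishw δ p = ishRad σ p ^ (2 * δ) := by
  obtain ⟨h1, h2, h3⟩ := ishV_W hp
  have h2 := abs_pos.2 h2
  have h3 := abs_pos.2 h3
  rw [ishV_abs hσ hp, mul_comm 2 δ, Real.rpow_mul (by positivity), Real.div_rpow (by positivity) h1.le,
    Real.mul_rpow h2.le h3.le, Real.rpow_two]
  rfl

theorem ish_le_R {F : ℝ → ℝ} {D : ℝ → ℝ} {C : ℝ} (hC : 0 ≤ C) (h : ∀ R > 0, |F R| ≤ C * D R) :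
    IshLe (ishV σ) (fun p => D (ishRad σ p)) (fun p => F (ishRad σ p)) :=
  ⟨C, hC, fun _ hp => h _ (ishV_rad hp)⟩

/-- bounded times linear growth. -/
structure IshB (σ m k c K : ℝ) (E q d : ℝ → ℝ) : Prop where
  E1 : IshLe (ishV σ) (fun _ => 1) (fun p => E (ishRad σ p))
  q1 : IshLe (ishV σ) (fun _ => 1) (fun p => q (ishRad σ p))
  d1 : IshLe (ishV σ) (fun _ => 1) (fun p => d (ishRad σ p))
  i1 : IshLe (ishV σ) (fun _ => 1) (fun p => (2 - E (ishRad σ p))⁻¹)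
  S1 : IshLe (ishV σ) (fun _ => 1) (fun p => ishSq E (ishRad σ p))
  cA : IshLe (ishV σ) (fun _ => 1) (fun p => ishcA E d (ishRad σ p))
  cB : IshLe (ishV σ) (fun _ => 1) (fun p => ishcB c E q (ishRad σ p))
  P : IshLe (ishV σ) (fun p => 1 + ishRad σ p)
    (fun p => ishP m k c K (ishRad σ p) (E (ishRad σ p)) (q (ishRad σ p)))
  DA : IshLe (ishV σ) (fun p => 1 + ishRad σ p) (fun p => ishDA m k c K E q d (ishRad σ p))
  DB : IshLe (ishV σ) (fun p => 1 + ishRad σ p) (fun p => ishDB c E q d (ishRad σ p))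

theorem IshLe.lin {f : ℝ × ℝ × ℝ → ℝ} (h : IshLe (ishV σ) (fun _ => 1) f) :
    IshLe (ishV σ) (fun p => 1 + ishRad σ p) f :=
  h.weak (a := 1) zero_le_one (fun p hp => by linarith [ishV_rad hp])

theorem IshProf.ishB (h : IshProf m k c' K κ E q d B) : IshB σ m k c' K E q d := by
  obtain ⟨C, hC, hb⟩ := h.bdd
  have hC0 : 0 ≤ C := by linarith
  have E1 : IshLe (ishV σ) (fun _ => 1) (fun p => E (ishRad σ p)) :=
    ish_le_R (D := fun _ => 1) zero_le_one (fun R hR => by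
      rw [abs_of_pos (h.pos R hR)]; linarith [h.half R hR])
  have q1 : IshLe (ishV σ) (fun _ => 1) (fun p => q (ishRad σ p)) :=
    ish_le_R (D := fun _ => 1) hC0 (fun R hR => by linarith [(hb R hR).1])
  have d1 : IshLe (ishV σ) (fun _ => 1) (fun p => d (ishRad σ p)) :=
    ish_le_R (D := fun _ => 1) hC0 (fun R hR => by linarith [(hb R hR).2])
  have i1 : IshLe (ishV σ) (fun _ => 1) (fun p => (2 - E (ishRad σ p))⁻¹) :=
    ish_le_R (F := fun R => (2 - E R)⁻¹) (D := fun _ => 1) zero_le_one (fun R hR => by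
      have := h.two R hR
      rw [abs_of_pos (by positivity), mul_one]
      exact inv_le_one_of_one_le₀ (by linarith [h.half R hR]))
  have S1 : IshLe (ishV σ) (fun _ => 1) (fun p => ishSq E (ishRad σ p)) :=
    ish_le_R (D := fun _ => 1) zero_le_one (fun R hR => by
      rw [abs_of_pos (h.Spos R hR), mul_one]
      refine abs_le_of_sq_le_sq' ?_ zero_le_one |>.2
      rw [h.Ssq R hR]; nlinarith [sq_nonneg (E R - 1)])
  have R1 : IshLe (ishV σ) (fun p => 1 + ishRad σ p) (fun p => ishRad σ p) :=
    ⟨1, zero_le_one, fun p hp => by rw [abs_of_pos (ishV_rad hp)]; linarith⟩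
  have oE : IshLe (ishV σ) (fun _ => 1) (fun p => 1 - E (ishRad σ p)) := (IshLe.const 1).sub E1
  have tE : IshLe (ishV σ) (fun _ => 1) (fun p => 2 - E (ishRad σ p)) := (IshLe.const 2).sub E1
  have qc : IshLe (ishV σ) (fun _ => 1) (fun p => q (ishRad σ p) - c') := q1.sub (IshLe.const c')
  have Rq : IshLe (ishV σ) (fun p => 1 + ishRad σ p) (fun p => ishRad σ p / 2 - q (ishRad σ p)) :=
    ((R1.cmul (1/2)).sub q1.lin).congr (fun p _ => by ring)
  have P : IshLe (ishV σ) (fun p => 1 + ishRad σ p)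
    (fun p => ishP m k c' K (ishRad σ p) (E (ishRad σ p)) (q (ishRad σ p))) := by
    have a1 := (Rq.bmul qc).neg
    have a2 := E1.bmul (((q1.cmul (4 * m)).add (IshLe.const (2 * K))).add (E1.cmul (3 * k ^ 2)))
    have a3 := ((Rq.cmul (4 * m)).add (E1.cmul (3 * k ^ 2)).lin).bmul tE
    refine ((a1.sub (a2.cmul (1/2)).lin).add (a3.cmul (1 / 2))).congr (fun p _ => ?_)
    unfold ishP; ring
  refine ⟨E1, q1, d1, i1, S1, ?_, ?_, P, ?_, ?_⟩
  · refine (((oE.bmul d1).bmul i1).cmul (1/2)).congr (fun p hp => ?_)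
    have := h.two _ (ishV_rad hp)
    unfold ishcA; field_simp
  · refine ((qc.bmul i1).cmul (1/2)).congr (fun p hp => ?_)
    have := h.two _ (ishV_rad hp)
    unfold ishcB; field_simp
  · have a1 := ((E1.bmul d1).bmul d1).lin.cmul (-1 / 2)
    have a2 := (P.bmul oE).cmul (1/2)
    have a3 := ((((oE.bmul d1).bmul (E1.bmul d1)).bmul i1).bmul i1).cmul (1/4)
    refine ((((a1.add a2).bmul i1).cmul (1/2)).add a3.lin).congr (fun p hp => ?_)
    have := h.two _ (ishV_rad hp)
    unfold ishDA; field_simp; ring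
  · have a1 := ((Rq.bmul d1).bmul i1).cmul (1/4)
    have a2 := ((((qc.bmul E1).bmul d1).bmul i1).bmul i1).cmul (1/4)
    refine (a1.add a2.lin).congr (fun p hp => ?_)
    have := h.two _ (ishV_rad hp)
    unfold ishDB; field_simp; ring

theorem IshProf.Ew (h : IshProf m k c' K κ E q d B) (hσ : σ * σ = 1) (hδ : 0 < δ) (hκ : 4 * δ ≤ κ) :
    IshLe (ishV σ) (ishw δ) (fun p => E (ishRad σ p)) ∧
    IshLe (ishV σ) (ishw δ) (fun p => ishSq E (ishRad σ p)) := by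
  obtain ⟨A, hA, hb⟩ := h.decay' (δ := 4 * δ) (by linarith) hκ
  have key : ∀ R > 0, ishSq E R ≤ √(2 * A) * R ^ (2 * δ) := by
    intro R hR
    have h1 := h.pos R hR
    have e : √(2 * A) * R ^ (2 * δ) = √(2 * A * R ^ (4 * δ)) := by
      have e2 : R ^ (4 * δ) = (R ^ (2 * δ)) ^ 2 := by
        rw [show 4 * δ = (2 * δ) * 2 by ring, Real.rpow_mul hR.le, Real.rpow_two]
      rw [e2, Real.sqrt_mul (by positivity) (_ ^ 2), Real.sqrt_sq (by positivity)]
    rw [e]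
    apply Real.sqrt_le_sqrt
    nlinarith [hb R hR]
  constructor
  · refine ⟨√(2 * A), by positivity, fun p hp => ?_⟩
    have hR := ishV_rad hp
    rw [ishw_rad hσ hp, abs_of_pos (h.pos _ hR)]
    refine le_trans ?_ (key _ hR)
    refine Real.le_sqrt_of_sq_le ?_
    nlinarith [h.pos _ hR, h.half _ hR]
  · refine ⟨√(2 * A), by positivity, fun p hp => ?_⟩
    have hR := ishV_rad hp
    rw [ishw_rad hσ hp, abs_of_pos (h.Spos _ hR)]
    exact key _ hR

theorem ish_inv_x : IshLe (ishV σ) ishIx (fun p => p.2.1⁻¹) :=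
  ⟨1, zero_le_one, fun p _ => by simp [ishIx, abs_inv]⟩
theorem ish_inv_y : IshLe (ishV σ) ishIy (fun p => p.2.2⁻¹) :=
  ⟨1, zero_le_one, fun p _ => by simp [ishIy, abs_inv]⟩
theorem ish_inv_t : IshLe (ishV σ) (fun p => 1 / p.1) (fun p => p.1⁻¹) :=
  ⟨1, zero_le_one, fun p hp => by
    have : 0 < p.1 := hp.1
    simp [abs_inv, abs_of_pos this]⟩

theorem IshProf.side_d1 (h : IshProf m k c' K κ E q d B) {D : ℝ × ℝ × ℝ → ℝ}
    (hE : IshLe (ishV σ) D (fun p => E (ishRad σ p)))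
    (hS : IshLe (ishV σ) D (fun p => ishSq E (ishRad σ p))) (i : Fin 3) :
    IshLe (ishV σ) (fun p => D p * ishIx p) (fun p => ishd ex (ishU σ μ k E B) p i) ∧
    IshLe (ishV σ) (fun p => D p * ishIy p) (fun p => ishd ey (ishU σ μ k E B) p i) ∧
    IshLe (ishV σ) (fun p => D p * (1 / p.1)) (fun p => ishd et (ishU σ μ k E B) p i) := by
  have b : IshB σ m k c' K E q d := h.ishB
  have e1 := ((hE.bmul b.d1).cmul (1/2))
  have e2 := hS.bmul b.cA
  have e3 := hS.bmul ((b.cB.cmul σ).add (IshLe.const (k/2)))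
  have e4 := hS.bmul ((b.cB.cmul σ).sub (IshLe.const (k/2)))
  have e5 := hS.bmul ((b.cB.cmul σ).neg.add (IshLe.const μ))
  refine ⟨?_, ?_, ?_⟩
  · refine ((IshLe.vec (θ := ishTh σ μ k B) e1.neg e2 e3 i).mul ish_inv_x).congr (fun p hp => ?_)
    rw [ish_eta p] at hp ⊢
    rw [h.U_x hp, Pi.smul_apply, smul_eq_mul, mul_comm]
    congr 3; ring
  · refine ((IshLe.vec (θ := ishTh σ μ k B) e1.neg e2 e4 i).mul ish_inv_y).congr (fun p hp => ?_)
    rw [ish_eta p] at hp ⊢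
    rw [h.U_y hp, Pi.smul_apply, smul_eq_mul, mul_comm]
    congr 3; ring
  · refine ((IshLe.vec (θ := ishTh σ μ k B) e1 e2.neg e5 i).mul ish_inv_t).congr (fun p hp => ?_)
    rw [ish_eta p] at hp ⊢
    rw [h.U_t hp, Pi.smul_apply, smul_eq_mul, mul_comm]
    congr 3; ring

theorem IshProf.side_d2 (h : IshProf m k c' K κ E q d B) (hσ : σ * σ = 1) {D : ℝ × ℝ × ℝ → ℝ}
    (hE : IshLe (ishV σ) D (fun p => E (ishRad σ p)))
    (hS : IshLe (ishV σ) D (fun p => ishSq E (ishRad σ p))) (i : Fin 3) :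
    IshLe (ishV σ) (fun p => D p * (ishIx p * ishIy p + 1 / p.1))
      (fun p => ishd ey (ishd ex (ishU σ μ k E B)) p i) := by
  have b : IshB σ m k c' K E q d := h.ishB
  have e1 := (hE.mul (((b.d1.bmul b.d1).lin.cmul (1/4)).add (b.P.cmul (1/4)))).neg
  have e2 := hS.mul ((((b.cA.bmul b.cA).lin.add b.DA).sub (b.cB.bmul b.cB).lin).add
    (IshLe.const (k ^ 2 / 4)).lin)
  have e3 := (hS.mul (((b.cA.bmul b.cB).cmul 2).lin.add b.DB)).cmul σ
  have := ((IshLe.vec (θ := ishTh σ μ k B) e1 e2 e3 i).mul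
    (ish_inv_x (σ := σ))).mul (ish_inv_y (σ := σ))
  refine (this.congr (g := fun p => ishd ey (ishd ex (ishU σ μ k E B)) p i) (fun p hp => ?_)).weak
    (a := 1) zero_le_one (fun p hp => ?_)
  · rw [ish_eta p] at hp ⊢
    rw [h.U_xy hσ hp, Pi.smul_apply, smul_eq_mul]
    refine (mul_comm _ _).trans ?_
    rw [mul_inv, ← mul_assoc]
    congr 4 <;> ring
  · obtain ⟨h1, h2, h3⟩ := ishV_W hp
    have h2 := abs_pos.2 h2
    have h3 := abs_pos.2 h3
    rw [ishV_abs hσ hp]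
    unfold ishIx ishIy
    apply le_of_eq
    field_simp

theorem IshProf.side (h : IshProf m k c' K κ E q d B) (hσ : σ * σ = 1) (hκ : 0 < κ) (hδ : 0 < δ)
    (hδκ : 4 * δ ≤ κ) (hm : m = σ * μ) (hc : c' = σ * c) (hK : K = -(k ^ 2 + b * k)) :
    IshSide (ishV σ) δ ((c + b) / 2) ((b - c) / 2) (-b / 2) (ishU σ μ k E B) (ishPhi σ k c b E)
      (ishGn σ k E) := by
  have b' : IshB σ m k c' K E q d := h.ishB
  obtain ⟨Ew, Sw⟩ := h.Ew (δ := δ) hσ hδ hδκ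
  have one : ∀ {D f : ℝ × ℝ × ℝ → ℝ}, IshLe (ishV σ) (fun p => 1 * D p) f → IshLe (ishV σ) D f :=
    fun hf => by simpa only [one_mul] using hf
  have kE := b'.E1.cmul k
  constructor
  · exact fun p hp => h.U_smooth (t := p.1) (ξ := p.2.1) (η := p.2.2) hp
  · exact fun p hp => h.Phi_smooth (t := p.1) (ξ := p.2.1) (η := p.2.2) hκ hp
  · exact fun p hp => h.Gn_smooth (t := p.1) (ξ := p.2.1) (η := p.2.2) hκ hp
  · exact fun i => IshLe.vec ((IshLe.const 1).sub b'.E1) b'.S1 (IshLe.const 0) i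
  · exact fun i => one (h.side_d1 b'.E1 b'.S1 i).1
  · exact fun i => one (h.side_d1 b'.E1 b'.S1 i).2.1
  · exact fun i => (h.side_d1 Ew Sw i).1
  · exact fun i => (h.side_d1 Ew Sw i).2.1
  · exact fun i => (h.side_d1 Ew Sw i).2.2
  · exact fun i => h.side_d2 hσ Ew Sw i
  · refine one ((((IshLe.const ((c + b) / 2)).sub kE).mul ish_inv_x).congr fun p hp => ?_)
    rw [ish_eta p] at hp ⊢
    rw [h.Phi_x hκ hp]; rfl
  · refine one ((((IshLe.const ((b - c) / 2)).sub kE).mul ish_inv_y).congr fun p hp => ?_)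
    rw [ish_eta p] at hp ⊢
    rw [h.Phi_y hκ hp]; rfl
  · obtain ⟨A, hA, hb⟩ := h.G_bound (δ := 2 * δ) (by linarith) (by linarith)
    refine ⟨A, hA.le, fun p hp => ?_⟩
    rw [ishw_rad hσ hp]; exact hb _ (ishV_rad hp)
  · refine ((Ew.cmul k).mul ish_inv_y).congr fun p hp => ?_
    rw [ish_eta p] at hp ⊢
    rw [h.Gn_y hκ hp]; rfl
  · refine (((Ew.bmul b'.d1).cmul (k / 2)).mul (ish_inv_x.mul ish_inv_y)).congr fun p hp => ?_
    rw [ish_eta p] at hp ⊢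
    rw [h.Gn_xy hκ hp, div_eq_mul_inv _ (_ * _), mul_inv]; ring
  · intro p hp
    unfold ishPhi; ring
  · exact fun p hp => h.pde1 (t := p.1) (ξ := p.2.1) (η := p.2.2) hκ hσ hm hc hK hp
  · intro p hp
    rw [ish_eta p] at hp ⊢
    rw [h.Gn_xy hκ hp]; exact h.pde2 hp
  · intro p hp
    rw [ish_eta p] at hp ⊢
    rw [h.Gn_xy hκ hp]; exact h.Phi_xy hκ hp
end

section
variable {σ μ m k c c' b K κ δ : ℝ} {E q d B : ℝ → ℝ}

theorem ish_geo (hσ : σ * σ = 1) {p : ℝ × ℝ × ℝ} (hp : p ∈ ishV σ) :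
    rOf p.1 ((p.2.1 + p.2.2) / 2) ((p.2.1 - p.2.2) / 2) = √(ishRad σ p) ∧
    alphaOf ((p.2.1 + p.2.2) / 2) ((p.2.1 - p.2.2) / 2)
      = 1 / 2 * (Real.log p.2.1 - Real.log p.2.2) := by
  obtain ⟨h1, h2, h3⟩ := ishV_W hp
  constructor
  · unfold rOf
    rw [ishV_abs hσ hp, ← abs_mul]
    congr 3; ring
  · unfold alphaOf
    rw [show (p.2.1 + p.2.2) / 2 + (p.2.1 - p.2.2) / 2 = p.2.1 by ring,
      show (p.2.1 + p.2.2) / 2 - (p.2.1 - p.2.2) / 2 = p.2.2 by ring,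
      Real.log_div (abs_pos.2 h2).ne' (abs_pos.2 h3).ne', Real.log_abs, Real.log_abs]

theorem ish_log_rad (hσ : σ * σ = 1) {p : ℝ × ℝ × ℝ} (hp : p ∈ ishV σ) :
    Real.log (√(ishRad σ p)) = 1 / 2 * (Real.log p.2.1 + Real.log p.2.2 - Real.log p.1) := by
  obtain ⟨h1, h2, h3⟩ := ishV_W hp
  have h2' := abs_pos.2 h2
  have h3' := abs_pos.2 h3
  rw [Real.log_sqrt (ishV_rad hp).le, ishV_abs hσ hp, Real.log_div (by positivity) h1.ne',
    Real.log_mul h2'.ne' h3'.ne', Real.log_abs, Real.log_abs]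
  ring

theorem ish_vec0 (s θ : ℝ) : ![Real.cos s, Real.sin s * Real.cos θ, Real.sin s * Real.sin θ]
    = ishvec (Real.cos s) (Real.sin s) 0 θ := by
  simp [ishvec]

theorem IshProf.linkU (h : IshProf m k c' K κ E q d B) (hσ : σ * σ = 1) {p : ℝ × ℝ × ℝ}
    (hp : p ∈ ishV σ) {r α : ℝ} (hr : r = √(ishRad σ p))
    (hα : α = 1 / 2 * (Real.log p.2.1 - Real.log p.2.2)) :
    ![Real.cos (ishS E r), Real.sin (ishS E r) * Real.cos (σ * B (r ^ 2) + k * α + μ * Real.log p.1),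
      Real.sin (ishS E r) * Real.sin (σ * B (r ^ 2) + k * α + μ * Real.log p.1)]
      = ishU σ μ k E B p := by
  have hR := ishV_rad hp
  have hr0 : 0 < r := hr ▸ Real.sqrt_pos.2 hR
  have hr2 : r ^ 2 = ishRad σ p := by rw [hr, Real.sq_sqrt hR.le]
  rw [ish_vec0, h.cos hr0, h.sin hr0, hr2, hα]
  unfold ishU ishSq ishTh
  congr 1; ring

theorem IshProf.linkPhi (hσ : σ * σ = 1) {p : ℝ × ℝ × ℝ}
    (hp : p ∈ ishV σ) {r α : ℝ} (hr : r = √(ishRad σ p))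
    (hα : α = 1 / 2 * (Real.log p.2.1 - Real.log p.2.2)) :
    c * α + b * Real.log r - ∫ r' in (0:ℝ)..r, 2 * k / r' * (1 - Real.cos (ishS E r'))
      = ishPhi σ k c b E p := by
  unfold ishPhi ishGn ishG
  rw [hα, hr, ish_log_rad hσ hp]
  ring

theorem IshProf.near (h : IshProf m k c' K κ E q d B) (hσ : σ * σ = 1) (hδ : 0 < δ)
    (hδκ : 4 * δ ≤ κ) (i : Fin 3) :
    IshLe (ishV σ) (ishw δ) (fun p => ishU σ μ k E B p i - (![1, 0, 0] : Fin 3 → ℝ) i) := by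
  obtain ⟨Ew, Sw⟩ := h.Ew (δ := δ) hσ hδ hδκ
  have h0 : IshLe (ishV σ) (ishw δ) (fun _ => 0) := (Ew.cmul 0).congr (fun _ _ => by ring)
  refine (IshLe.vec (θ := ishTh σ μ k B) Ew.neg Sw h0 i).congr (fun p hp => ?_)
  unfold ishU
  fin_cases i <;> simp [ishvec]
end

theorem ish_cone1 {p : ℝ × ℝ × ℝ} (hp : p ∈ ishV 1) :
    |(p.2.1 + p.2.2) / 2| > |(p.2.1 - p.2.2) / 2| := by
  have h : 0 < 1 * p.2.1 * p.2.2 := hp.2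
  exact sq_lt_sq.1 (by nlinarith)

theorem ish_cone2 {p : ℝ × ℝ × ℝ} (hp : p ∈ ishV (-1)) :
    |(p.2.1 + p.2.2) / 2| < |(p.2.1 - p.2.2) / 2| := by
  have h : 0 < -1 * p.2.1 * p.2.2 := hp.2
  exact sq_lt_sq.1 (by nlinarith)

theorem ish_mem_W {t x y : ℝ} (ht : 0 < t) (h : |x| ≠ |y|) : ishN (t, x, y) ∈ ishW := by
  rw [ishN_apply]
  refine ⟨ht, fun e => h ?_, fun e => h ?_⟩
  · have : x = -y := by simp only at e; linarith
    rw [this, abs_neg]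
  · have : x = y := by simp only at e; linarith
    rw [this]

theorem ish_not_W {t x y : ℝ} (h : |x| = |y|) : (x + y) * (x - y) = 0 := by
  have := (sq_eq_sq_iff_abs_eq_abs x y).2 h
  linear_combination this

theorem ishw_cont {δ : ℝ} (hδ : 0 < δ) {p : ℝ × ℝ × ℝ} (hp : 0 < p.1) :
    ContinuousAt (ishw δ) p := by
  unfold ishw ishX ishY ishZ
  have a : ContinuousAt (fun p : ℝ × ℝ × ℝ => |p.2.1| ^ δ) p :=
    ((Real.continuous_rpow_const hδ.le).comp (by fun_prop : Continuous fun p : ℝ × ℝ × ℝ => |p.2.1|)).continuousAt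
  have b : ContinuousAt (fun p : ℝ × ℝ × ℝ => |p.2.2| ^ δ) p :=
    ((Real.continuous_rpow_const hδ.le).comp (by fun_prop : Continuous fun p : ℝ × ℝ × ℝ => |p.2.2|)).continuousAt
  have c : ContinuousAt (fun p : ℝ × ℝ × ℝ => p.1 ^ δ) p :=
    ((Real.continuous_rpow_const hδ.le).comp (by fun_prop : Continuous fun p : ℝ × ℝ × ℝ => p.1)).continuousAt
  exact ((a.mul b).div c (Real.rpow_pos_of_pos hp δ).ne').pow 2

theorem ish_unit (μ k : ℝ) (sh βh sv βv : ℝ → ℝ) (p : ℝ × ℝ × ℝ) :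
    dot3 (uSim μ k sh βh sv βv p) (uSim μ k sh βh sv βv p) = 1 := by
  unfold uSim
  split_ifs
  · rw [ish_vec0, ishvec_dot]
    nlinarith [Real.sin_sq_add_cos_sq (sh (rOf p.1 p.2.1 p.2.2))]
  · rw [ish_vec0, ishvec_dot]
    nlinarith [Real.sin_sq_add_cos_sq (sv (rOf p.1 p.2.1 p.2.2))]
  · simp [dot3]

theorem ish_main (μ k c b : ℝ) (hb : c ^ 2 < -4 * (k ^ 2 + b * k)) :
    ∃ sh βh sv βv : ℝ → ℝ,
      ContDiffOn ℝ (⊤ : ℕ∞) sh (Ioi 0) ∧ ContDiffOn ℝ (⊤ : ℕ∞) βh (Ioi 0) ∧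
      ContDiffOn ℝ (⊤ : ℕ∞) sv (Ioi 0) ∧ ContDiffOn ℝ (⊤ : ℕ∞) βv (Ioi 0) ∧
      Tendsto sh (nhdsWithin 0 (Ioi 0)) (nhds 0) ∧
      Tendsto sv (nhdsWithin 0 (Ioi 0)) (nhds 0) ∧
      (∃ r > (0:ℝ), sh r ≠ 0) ∧ (∃ r > (0:ℝ), sv r ≠ 0) ∧
      sh =O[nhdsWithin 0 (Ioi 0)]
        (fun r : ℝ => r ^ (Real.sqrt (-(k ^ 2 + b * k) - c ^ 2 / 4))) ∧
      sv =O[nhdsWithin 0 (Ioi 0)]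
        (fun r : ℝ => r ^ (Real.sqrt (-(k ^ 2 + b * k) - c ^ 2 / 4))) ∧
      IsWeakIshimori (Ioi 0) (uSim μ k sh βh sv βv) (φSim k c b sh sv) ∧
      (∀ p : ℝ × ℝ × ℝ, dot3 (uSim μ k sh βh sv βv p) (uSim μ k sh βh sv βv p) = 1) ∧
      ContinuousOn (uSim μ k sh βh sv βv) {p : ℝ × ℝ × ℝ | 0 < p.1} ∧
      (∀ t x y : ℝ, 0 < t → |x| ≠ |y| →
        ContDiffAt ℝ (⊤ : ℕ∞) (uSim μ k sh βh sv βv) (t, x, y) ∧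
        ContDiffAt ℝ (⊤ : ℕ∞) (φSim k c b sh sv) (t, x, y) ∧
        pdV et (uSim μ k sh βh sv βv) (t, x, y)
          = cross3 (uSim μ k sh βh sv βv (t, x, y))
              (pdV ex (pdV ex (uSim μ k sh βh sv βv)) (t, x, y)
                - pdV ey (pdV ey (uSim μ k sh βh sv βv)) (t, x, y))
            + pdR ex (φSim k c b sh sv) (t, x, y) • pdV ey (uSim μ k sh βh sv βv) (t, x, y)
            - pdR ey (φSim k c b sh sv) (t, x, y)
                • pdV ex (uSim μ k sh βh sv βv) (t, x, y) ∧
        pdR ex (pdR ex (φSim k c b sh sv)) (t, x, y)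
            - pdR ey (pdR ey (φSim k c b sh sv)) (t, x, y)
          = -2 * dot3 (uSim μ k sh βh sv βv (t, x, y))
              (cross3 (pdV ex (uSim μ k sh βh sv βv) (t, x, y))
                (pdV ey (uSim μ k sh βh sv βv) (t, x, y)))) ∧
      (∀ s ∈ ({sh, sv} : Set (ℝ → ℝ)),
        ∃ sstar > (0:ℝ),
          Tendsto s atTop (nhds sstar) ∧
          (fun r => s r - sstar) =O[atTop] (fun r : ℝ => (r ^ 2)⁻¹) ∧
          (deriv s) =O[atTop] (fun r : ℝ => r⁻¹)) := by
  set κ := Real.sqrt (-(k ^ 2 + b * k) - c ^ 2 / 4) with hκd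
  have hpos : 0 < -(k ^ 2 + b * k) - c ^ 2 / 4 := by linarith
  have hκ : 0 < κ := Real.sqrt_pos.2 hpos
  have hκ2 : κ ^ 2 = -(k ^ 2 + b * k) - c ^ 2 / 4 := Real.sq_sqrt hpos.le
  obtain ⟨Eh, qh, dh, Bh, hh⟩ := ish_global μ k c (-(k ^ 2 + b * k)) κ hκ (by rw [hκ2]; ring)
  obtain ⟨Ev, qv, dv, Bv, hv⟩ := ish_global (-μ) k (-c) (-(k ^ 2 + b * k)) κ hκ (by rw [hκ2]; ring)
  set δ := min (1 / 8) (κ / 4) with hδd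
  have hδ : 0 < δ := lt_min (by norm_num) (by linarith)
  have hδ1 : δ ≤ 1 / 8 := min_le_left _ _
  have hδκ : 4 * δ ≤ κ := by linarith [min_le_right (1 / 8) (κ / 4)]
  have s1 : (1:ℝ) * 1 = 1 := by norm_num
  have s2 : (-1:ℝ) * -1 = 1 := by norm_num
  set u := uSim μ k (ishS Eh) (fun r => 1 * Bh (r ^ 2)) (ishS Ev) (fun r => -1 * Bv (r ^ 2)) with hu
  set φ := φSim k c b (ishS Eh) (ishS Ev) with hφ
  set U : ℝ × ℝ × ℝ → Fin 3 → ℝ := fun p => u (ishN.symm p) with hU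
  set Φ : ℝ × ℝ × ℝ → ℝ := fun p => φ (ishN.symm p) with hΦ
  have eu : u = fun p => U (ishN p) := by funext p; simp [hU]
  have eφ : φ = fun p => Φ (ishN p) := by funext p; simp [hΦ]
  have U1 : EqOn U (ishU 1 μ k Eh Bh) (ishV 1) := by
    intro p hp
    obtain ⟨g1, g2⟩ := ish_geo s1 hp
    simp only [hU, hu, ishN_symm_apply, uSim]
    rw [if_pos (ish_cone1 hp)]
    exact hh.linkU s1 hp g1 g2
  have U2 : EqOn U (ishU (-1) μ k Ev Bv) (ishV (-1)) := by
    intro p hp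
    obtain ⟨g1, g2⟩ := ish_geo s2 hp
    simp only [hU, hu, ishN_symm_apply, uSim]
    rw [if_neg (ish_cone2 hp).not_gt, if_pos (ish_cone2 hp)]
    exact hv.linkU s2 hp g1 g2
  have P1 : EqOn Φ (ishPhi 1 k c b Eh) (ishV 1) := by
    intro p hp
    obtain ⟨g1, g2⟩ := ish_geo s1 hp
    simp only [hΦ, hφ, ishN_symm_apply, φSim]
    rw [if_pos (ish_cone1 hp)]
    exact IshProf.linkPhi s1 hp g1 g2
  have P2 : EqOn Φ (ishPhi (-1) k c b Ev) (ishV (-1)) := by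
    intro p hp
    obtain ⟨g1, g2⟩ := ish_geo s2 hp
    simp only [hΦ, hφ, ishN_symm_apply, φSim]
    rw [if_neg (ish_cone2 hp).not_gt, if_pos (ish_cone2 hp)]
    exact IshProf.linkPhi s2 hp g1 g2
  set G : ℝ × ℝ × ℝ → ℝ := fun p => if 0 < p.2.1 * p.2.2 then ishGn 1 k Eh p
    else ishGn (-1) k Ev p with hG
  have G1 : EqOn G (ishGn 1 k Eh) (ishV 1) := by
    intro p hp
    have h : 0 < 1 * p.2.1 * p.2.2 := hp.2
    simp only [hG]
    rw [if_pos (by linarith)]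
  have G2 : EqOn G (ishGn (-1) k Ev) (ishV (-1)) := by
    intro p hp
    have h : 0 < -1 * p.2.1 * p.2.2 := hp.2
    simp only [hG]
    rw [if_neg (by linarith)]
  have side : IshSide ishW δ ((c + b) / 2) ((b - c) / 2) (-b / 2) U Φ G :=
    ((hh.side s1 hκ hδ hδκ (by ring) (by ring) rfl).congr (ishV_open 1) U1 P1 G1).glue
      ((hv.side s2 hκ hδ hδκ (by ring) (by ring) rfl).congr (ishV_open (-1)) U2 P2 G2)
  have sol := side.sol hδ hδ1
  refine ⟨ishS Eh, fun r => 1 * Bh (r ^ 2), ishS Ev, fun r => -1 * Bv (r ^ 2), hh.s_smooth,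
    hh.B_smooth 1, hv.s_smooth, hv.B_smooth (-1), hh.s_tendsto hκ, hv.s_tendsto hκ,
    ⟨1, one_pos, (hh.s_pos one_pos).ne'⟩, ⟨1, one_pos, (hv.s_pos one_pos).ne'⟩,
    hh.s_bigO, hv.s_bigO, ?_, fun p => ish_unit _ _ _ _ _ _ p, ?_, ?_, ?_⟩
  · have := sol.weak hδ hδ1
    rw [← eu, ← eφ] at this
    exact this
  · rintro ⟨t, x, y⟩ ht
    have ht : 0 < t := ht
    apply ContinuousAt.continuousWithinAt
    change ContinuousAt u (t, x, y)
    by_cases hxy : |x| = |y|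
    · have near : ∀ i, IshLe ishW (ishw δ) (fun p => U p i - (![1, 0, 0] : Fin 3 → ℝ) i) := by
        intro i
        rw [ishW_union]
        refine IshLe.union ?_ ?_ (fun p _ => sq_nonneg _)
        · exact (hh.near s1 hδ hδκ i).congr (fun p hp => by rw [U1 hp])
        · exact (hv.near s2 hδ hδκ i).congr (fun p hp => by rw [U2 hp])
      have hcross : ∀ p : ℝ × ℝ × ℝ, |p.2.1| = |p.2.2| → u p = ![1, 0, 0] := by
        intro p hp
        simp only [hu, uSim]
        rw [if_neg (by simp [hp]), if_neg (by simp [hp])]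
      have hw0 : Tendsto (fun p => ishw δ (ishN p)) (nhds (t, x, y)) (nhds 0) := by
        have h0 : ishw δ (ishN (t, x, y)) = 0 := by
          have := ish_not_W (t := t) hxy
          unfold ishw ishX ishY
          rw [ishN_apply]
          rcases mul_eq_zero.1 this with e | e
          · simp [e, Real.zero_rpow hδ.ne']
          · simp [e, Real.zero_rpow hδ.ne']
        have := ContinuousAt.comp (f := ishN) (x := (t, x, y)) (ishw_cont hδ (p := ishN (t, x, y)) ht)
          ishN.continuous.continuousAt
        unfold ContinuousAt at this
        rw [Function.comp_apply, h0] at this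
        exact this
      unfold ContinuousAt
      rw [hcross (t, x, y) hxy, tendsto_pi_nhds]
      intro i
      obtain ⟨C, hC, hCb⟩ := near i
      rw [tendsto_iff_norm_sub_tendsto_zero]
      refine squeeze_zero' (g := fun p => C * ishw δ (ishN p))
        (Eventually.of_forall fun p => norm_nonneg _) ?_ (by simpa using hw0.const_mul C)
      have hev : ∀ᶠ p : ℝ × ℝ × ℝ in nhds (t, x, y), 0 < p.1 :=
        continuous_fst.continuousAt.eventually (lt_mem_nhds ht)
      filter_upwards [hev] with p hp
      by_cases hc : |p.2.1| = |p.2.2|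
      · rw [hcross p hc, sub_self, norm_zero]
        exact mul_nonneg hC (sq_nonneg _)
      · have := hCb (ishN p) (ish_mem_W hp hc)
        rw [eu]
        exact this
    · have := (sol.point (ish_mem_W ht hxy) (side.hxy _ (ish_mem_W ht hxy))).1
      rw [← eu] at this
      exact this.continuousAt
  · intro t x y ht hxy
    have := sol.point (ish_mem_W ht hxy) (side.hxy _ (ish_mem_W ht hxy))
    rw [← eu, ← eφ] at this
    have e1 : U (ishN (t, x, y)) = u (t, x, y) := by rw [eu]
    rw [e1] at this
    exact this
  · intro s hs
    rcases hs with rfl | hs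
    · exact hh.s_infty
    · rw [mem_singleton_iff] at hs
      subst hs
      exact hv.s_infty

/-- Main Theorem 3: existence of nontrivial `(μ,k,c)`-equivariant standing waves in
similarity variables of the Ishimori system with target `S²` (`c² < −4(k² + bk)`), which
are weak solutions on `(0,∞) × ℝ²`; the spin is continuous, Hölder up to the cross,
smooth and pointwise solving the system off the cross, and its radial profiles converge
at `r = ∞` to strictly positive limits at rate `O(r⁻²)` with `s′(r) = O(1/r)`. -/
theorem stmt18 (μ k c b : ℝ) (hμ : μ ≠ 0) (hk : k ≠ 0) (hc : c ≠ 0)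
    (hb : c ^ 2 < -4 * (k ^ 2 + b * k)) :
    ∃ sh βh sv βv : ℝ → ℝ,
      ContDiffOn ℝ (⊤ : ℕ∞) sh (Ioi 0) ∧ ContDiffOn ℝ (⊤ : ℕ∞) βh (Ioi 0) ∧
      ContDiffOn ℝ (⊤ : ℕ∞) sv (Ioi 0) ∧ ContDiffOn ℝ (⊤ : ℕ∞) βv (Ioi 0) ∧
      Tendsto sh (nhdsWithin 0 (Ioi 0)) (nhds 0) ∧
      Tendsto sv (nhdsWithin 0 (Ioi 0)) (nhds 0) ∧
      (∃ r > (0:ℝ), sh r ≠ 0) ∧ (∃ r > (0:ℝ), sv r ≠ 0) ∧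
      sh =O[nhdsWithin 0 (Ioi 0)]
        (fun r : ℝ => r ^ (Real.sqrt (-(k ^ 2 + b * k) - c ^ 2 / 4))) ∧
      sv =O[nhdsWithin 0 (Ioi 0)]
        (fun r : ℝ => r ^ (Real.sqrt (-(k ^ 2 + b * k) - c ^ 2 / 4))) ∧
      IsWeakIshimori (Ioi 0) (uSim μ k sh βh sv βv) (φSim k c b sh sv) ∧
      (∀ p : ℝ × ℝ × ℝ, dot3 (uSim μ k sh βh sv βv p) (uSim μ k sh βh sv βv p) = 1) ∧
      ContinuousOn (uSim μ k sh βh sv βv) {p : ℝ × ℝ × ℝ | 0 < p.1} ∧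
      (∀ t x y : ℝ, 0 < t → |x| ≠ |y| →
        ContDiffAt ℝ (⊤ : ℕ∞) (uSim μ k sh βh sv βv) (t, x, y) ∧
        ContDiffAt ℝ (⊤ : ℕ∞) (φSim k c b sh sv) (t, x, y) ∧
        pdV et (uSim μ k sh βh sv βv) (t, x, y)
          = cross3 (uSim μ k sh βh sv βv (t, x, y))
              (pdV ex (pdV ex (uSim μ k sh βh sv βv)) (t, x, y)
                - pdV ey (pdV ey (uSim μ k sh βh sv βv)) (t, x, y))
            + pdR ex (φSim k c b sh sv) (t, x, y) • pdV ey (uSim μ k sh βh sv βv) (t, x, y)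
            - pdR ey (φSim k c b sh sv) (t, x, y)
                • pdV ex (uSim μ k sh βh sv βv) (t, x, y) ∧
        pdR ex (pdR ex (φSim k c b sh sv)) (t, x, y)
            - pdR ey (pdR ey (φSim k c b sh sv)) (t, x, y)
          = -2 * dot3 (uSim μ k sh βh sv βv (t, x, y))
              (cross3 (pdV ex (uSim μ k sh βh sv βv) (t, x, y))
                (pdV ey (uSim μ k sh βh sv βv) (t, x, y)))) ∧
      (∀ s ∈ ({sh, sv} : Set (ℝ → ℝ)),
        ∃ sstar > (0:ℝ),
          Tendsto s atTop (nhds sstar) ∧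
          (fun r => s r - sstar) =O[atTop] (fun r : ℝ => (r ^ 2)⁻¹) ∧
          (deriv s) =O[atTop] (fun r : ℝ => r⁻¹)) := by
  exact ish_main μ k c b hb
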